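/- arXiv:1607.02543 — 3 statements merged into one kernel-verified Lean document; each statement's English description precedes it below -/
import Mathlib

section
/- For every ε ∈ (0,1/2) there exists k₀ such that for all integers k ≥ k₀ the following holds with m_k := ⌈(2+ε)·φ(k)·log φ(k)⌉: one has π_t + 2 ≤ φ(k) for all 1 ≤ t ≤ m_k, and φ(k) · ∏_{t=1}^{m_k} (1 − 1/(φ(k) − π_t)) ≤ φ(k)^{−1−ε/2}. -/
open scoped Classical

/-- `π_t` (0-indexed): the number of indices `j < t` with `p_{t+1} - p_{j+1} < k`,
where `p_1 < p_2 < ⋯` are the primes (so `Nat.nth Nat.Prime t` is `p_{t+1}`). -/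
noncomputable def pit (k t : ℕ) : ℕ :=
  ((Finset.range t).filter
    (fun j : ℕ => Nat.nth Nat.Prime t - Nat.nth Nat.Prime j < k)).card

/-- Legendre's sieve on an interval: the number of integers in `[a, b)` free of the primes in `s`
is `(b - a) ∏ (1 - 1/p)` up to an error less than `2 ^ #s`. -/
lemma abs_card_filter_not_dvd_sub_le (s : Finset ℕ) (hs : ∀ p ∈ s, p.Prime) :
    ∀ a b : ℕ, a ≤ b →
      |(((Finset.Ico a b).filter (fun n => ∀ p ∈ s, ¬ p ∣ n)).card : ℝ) -
        ((b : ℝ) - a) * ∏ p ∈ s, (1 - 1 / (p : ℝ))| ≤ 2 ^ s.card - 1 := by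
  induction s using Finset.induction_on with
  | empty =>
    intro a b hab
    simp [Nat.cast_sub hab]
  | insert p s hps ih =>
    intro a b hab
    have hs' : ∀ q ∈ s, q.Prime := fun q hq => hs q (Finset.mem_insert_of_mem hq)
    have hp : p.Prime := hs p (Finset.mem_insert_self p s)
    have hp0 : 0 < p := hp.pos
    have hcoprime : ∀ q ∈ s, ∀ m, q ∣ p * m ↔ q ∣ m := by
      intro q hq m
      have hqp : q.Coprime p := (Nat.coprime_primes (hs' q hq) hp).2 (by rintro rfl; exact hps hq)
      exact ⟨fun h => hqp.dvd_of_dvd_mul_left h, fun h => h.mul_left p⟩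
    have hab' : a ⌈/⌉ p ≤ b ⌈/⌉ p := by
      rw [ceilDiv_le_iff_le_mul hp0]
      exact hab.trans (le_smul_ceilDiv hp0)
    have hmul : ((Finset.Ico a b).filter
          (fun n => (∀ q ∈ s, ¬ q ∣ n) ∧ p ∣ n)).card =
        ((Finset.Ico (a ⌈/⌉ p) (b ⌈/⌉ p)).filter (fun n => ∀ q ∈ s, ¬ q ∣ n)).card := by
      symm
      apply Finset.card_bij (fun m _ => p * m)
      · intro m hm
        simp only [Finset.mem_filter, Finset.mem_Ico] at hm ⊢
        obtain ⟨⟨h1, h2⟩, h3⟩ := hm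
        rw [ceilDiv_le_iff_le_mul hp0] at h1
        rw [← not_le, ceilDiv_le_iff_le_mul hp0, not_le] at h2
        exact ⟨⟨h1, h2⟩, fun q hq h => h3 q hq ((hcoprime q hq m).1 h), dvd_mul_right p m⟩
      · intro m _ m' _ h
        exact Nat.eq_of_mul_eq_mul_left hp0 h
      · intro n hn
        simp only [Finset.mem_filter, Finset.mem_Ico] at hn
        obtain ⟨⟨h1, h2⟩, h3, m, rfl⟩ := hn
        refine ⟨m, ?_, rfl⟩
        simp only [Finset.mem_filter, Finset.mem_Ico]
        refine ⟨⟨?_, ?_⟩, fun q hq h => h3 q hq ((hcoprime q hq m).2 h)⟩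
        · rwa [ceilDiv_le_iff_le_mul hp0]
        · rwa [← not_le, ceilDiv_le_iff_le_mul hp0, not_le]
    have hsplit := Finset.card_filter_add_card_filter_not
      (s := (Finset.Ico a b).filter (fun n => ∀ q ∈ s, ¬ q ∣ n)) (fun n => p ∣ n)
    rw [Finset.filter_filter, Finset.filter_filter, hmul] at hsplit
    have hins : (Finset.Ico a b).filter (fun n => ∀ q ∈ insert p s, ¬ q ∣ n) =
        (Finset.Ico a b).filter (fun n => (∀ q ∈ s, ¬ q ∣ n) ∧ ¬ p ∣ n) := by
      apply Finset.filter_congr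
      intro n _
      rw [Finset.forall_mem_insert, and_comm]
    have h1 := ih hs' a b hab
    have h2 := ih hs' _ _ hab'
    have hsplit' := congrArg (Nat.cast : ℕ → ℝ) hsplit
    push_cast at hsplit'
    have hceil : ∀ c : ℕ, (c : ℝ) / p ≤ (c ⌈/⌉ p : ℕ) ∧ ((c ⌈/⌉ p : ℕ) : ℝ) < c / p + 1 := by
      intro c
      have hpR : (0 : ℝ) < p := by exact_mod_cast hp0
      constructor
      · rw [div_le_iff₀ hpR, mul_comm]
        exact_mod_cast le_smul_ceilDiv (b := c) hp0
      · rw [div_add_one hpR.ne', lt_div_iff₀ hpR]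
        have h : (c ⌈/⌉ p) * p < c + p := by
          rw [Nat.ceilDiv_eq_add_pred_div]
          exact (Nat.div_mul_le_self _ _).trans_lt (by omega)
        exact_mod_cast h
    obtain ⟨ha1, ha2⟩ := hceil a
    obtain ⟨hb1, hb2⟩ := hceil b
    have hP0 : 0 ≤ ∏ q ∈ s, (1 - 1 / (q : ℝ)) :=
      Finset.prod_nonneg fun q hq => sub_nonneg.2 <| by
        simpa using Nat.cast_inv_le_one q
    have hP1 : ∏ q ∈ s, (1 - 1 / (q : ℝ)) ≤ 1 :=
      Finset.prod_le_one (fun q hq => sub_nonneg.2 (by simpa using Nat.cast_inv_le_one q))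
        fun q _ => by simp
    rw [hins, Finset.prod_insert hps, Finset.card_insert_of_notMem hps, pow_succ]
    generalize ∏ q ∈ s, (1 - 1 / (q : ℝ)) = P at *
    have h3 : |((b ⌈/⌉ p : ℕ) - (a ⌈/⌉ p : ℕ) : ℝ) * P - ((b : ℝ) / p - a / p) * P| ≤ 1 := by
      rw [← sub_mul, abs_mul, abs_of_nonneg hP0]
      exact mul_le_one₀ (abs_le.2 ⟨by linarith, by linarith⟩) hP0 hP1
    have hexp : ((b : ℝ) - a) * ((1 - 1 / p) * P) =
        ((b : ℝ) - a) * P - ((b : ℝ) / p - a / p) * P := by ring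
    rw [hexp]
    rw [abs_le] at h1 h2 h3 ⊢
    constructor <;> linarith [h1.1, h1.2, h2.1, h2.2, h3.1, h3.2]

lemma coprime_iff_forall_primeFactors_not_dvd {k : ℕ} (hk : k ≠ 0) (n : ℕ) :
    k.Coprime n ↔ ∀ p ∈ k.primeFactors, ¬ p ∣ n := by
  rw [← not_iff_not, Nat.Prime.not_coprime_iff_dvd]
  simp [hk]

/-- A lower bound for the number of integers coprime to `k` in an interval. -/
lemma le_card_filter_coprime_Ico {k : ℕ} (hk : k ≠ 0) {a b : ℕ} (hab : a ≤ b) :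
    ((b : ℝ) - a) / 2 ^ k.primeFactors.card - (2 ^ k.primeFactors.card - 1) ≤
      (((Finset.Ico a b).filter (fun n => k.Coprime n)).card : ℝ) := by
  have h := abs_card_filter_not_dvd_sub_le k.primeFactors
    (fun p hp => Nat.prime_of_mem_primeFactors hp) a b hab
  have hfil : (Finset.Ico a b).filter (fun n => k.Coprime n) =
      (Finset.Ico a b).filter (fun n => ∀ p ∈ k.primeFactors, ¬ p ∣ n) :=
    Finset.filter_congr fun n _ => coprime_iff_forall_primeFactors_not_dvd hk n
  have hprod : (1 / 2 : ℝ) ^ k.primeFactors.card ≤ ∏ p ∈ k.primeFactors, (1 - 1 / (p : ℝ)) := by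
    rw [← Finset.prod_const]
    refine Finset.prod_le_prod (fun _ _ => by norm_num) fun p hp => ?_
    have hp2 : (2 : ℝ) ≤ p := by
      exact_mod_cast (Nat.prime_of_mem_primeFactors hp).two_le
    have := one_div_le_one_div_of_le two_pos hp2
    linarith
  have hab' : (0 : ℝ) ≤ (b : ℝ) - a := sub_nonneg.2 (by exact_mod_cast hab)
  have hmul := mul_le_mul_of_nonneg_left hprod hab'
  rw [one_div, inv_pow, ← div_eq_mul_inv] at hmul
  rw [hfil]
  linarith [(abs_le.1 h).1]

lemma pow_card_primeFactors_le {k : ℕ} (hk : k ≠ 0) {B : ℕ} (hB : 1 ≤ B) :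
    B ^ k.primeFactors.card ≤ B ^ B * k := by
  have hsplit := Finset.card_filter_add_card_filter_not (s := k.primeFactors) (fun p => p < B)
  have hsmall : (k.primeFactors.filter (fun p => p < B)).card ≤ B := by
    calc _ ≤ (Finset.range B).card := Finset.card_le_card fun p hp => by
            simpa using (Finset.mem_filter.1 hp).2
      _ = B := Finset.card_range B
  have hlarge : B ^ (k.primeFactors.filter (fun p => ¬ p < B)).card ≤ k := by
    calc _ ≤ ∏ p ∈ k.primeFactors.filter (fun p => ¬ p < B), p :=
          Finset.pow_card_le_prod _ _ _ fun p hp => not_lt.1 (Finset.mem_filter.1 hp).2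
      _ ≤ ∏ p ∈ k.primeFactors, p :=
          Finset.prod_le_prod_of_subset_of_one_le' (Finset.filter_subset _ _)
            fun p hp _ => (Nat.prime_of_mem_primeFactors hp).one_le
      _ ≤ k := Nat.le_of_dvd (Nat.pos_of_ne_zero hk) (Nat.prod_primeFactors_dvd k)
  rw [← hsplit, pow_add]
  exact Nat.mul_le_mul (Nat.pow_le_pow_right hB hsmall) hlarge

lemma exists_coprime_le_four_pow {k : ℕ} (hk : k ≠ 0) :
    ∃ r, 2 ≤ r ∧ r < 2 + 4 ^ k.primeFactors.card ∧ k.Coprime r := by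
  have h := le_card_filter_coprime_Ico hk (Nat.le_add_right 2 (4 ^ k.primeFactors.card))
  have h4 : (4 : ℝ) ^ k.primeFactors.card =
      2 ^ k.primeFactors.card * 2 ^ k.primeFactors.card := by
    rw [← mul_pow]; norm_num
  push_cast at h
  rw [add_sub_cancel_left, h4, mul_div_cancel_right₀ _ (by positivity)] at h
  have hpos : 0 < ((Finset.Ico 2 (2 + 4 ^ k.primeFactors.card)).filter
      (fun n => k.Coprime n)).card := by
    have : (0 : ℝ) < (((Finset.Ico 2 (2 + 4 ^ k.primeFactors.card)).filter
      (fun n => k.Coprime n)).card : ℝ) := by linarith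
    exact_mod_cast this
  obtain ⟨r, hr⟩ := Finset.card_pos.1 hpos
  simp only [Finset.mem_filter, Finset.mem_Ico] at hr
  exact ⟨r, hr.1.1, hr.1.2, hr.2⟩

/-- An interval of length `k` contains many composite integers coprime to `k`, hence fewer than
`φ(k) - 1` primes, as soon as `k` is large compared with its number of prime factors. -/
lemma card_primes_Ico_add_two_le_totient {k : ℕ} (hk : k ≠ 0)
    (hlarge : 15 * 16 ^ k.primeFactors.card ≤ k) (a : ℕ) :
    ((Finset.Ico a (a + k)).filter Nat.Prime).card + 2 ≤ k.totient := by
  obtain ⟨r, hr2, hr, hkr⟩ := exists_coprime_le_four_pow hk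
  have hr0 : 0 < r := by omega
  set w := k.primeFactors.card with hw
  set S := (Finset.Ico a (a + k)).filter (fun n => k.Coprime n) with hS
  have hScard : S.card = k.totient := by
    rw [hS, ← Nat.filter_coprime_Ico_eq_totient k a]
  set M := (Finset.Ico (a ⌈/⌉ r) ((a + k) ⌈/⌉ r)).filter (fun n => k.Coprime n) with hM
  have hab : a ⌈/⌉ r ≤ (a + k) ⌈/⌉ r := by
    rw [ceilDiv_le_iff_le_mul hr0]
    exact (Nat.le_add_right a k).trans (le_smul_ceilDiv hr0)
  have hMcard : w + 3 ≤ M.card := by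
    have h := le_card_filter_coprime_Ico hk hab
    rw [← hM, ← hw] at h
    have hlen : k ≤ r * ((a + k) ⌈/⌉ r - a ⌈/⌉ r + 1) := by
      have h1 : a + k ≤ r * ((a + k) ⌈/⌉ r) := le_smul_ceilDiv hr0
      have h2 : r * (a ⌈/⌉ r) < a + r := by
        rw [Nat.ceilDiv_eq_add_pred_div]
        exact (Nat.mul_div_le _ _).trans_lt (by omega)
      rw [Nat.mul_add, Nat.mul_sub]
      omega
    have hlen' : 4 * 4 ^ w ≤ (a + k) ⌈/⌉ r - a ⌈/⌉ r := by
      by_contra! hlt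
      have h1 : (a + k) ⌈/⌉ r - a ⌈/⌉ r + 1 ≤ 4 * 4 ^ w := hlt
      have h2 : r * ((a + k) ⌈/⌉ r - a ⌈/⌉ r + 1) ≤ (1 + 4 ^ w) * (4 * 4 ^ w) :=
        Nat.mul_le_mul (by omega) h1
      have h3 : 1 ≤ 4 ^ w := Nat.one_le_pow _ _ (by norm_num)
      have h4 : 16 ^ w = 4 ^ w * 4 ^ w := by
        rw [← mul_pow]; norm_num
      nlinarith
    have hlenR : (4 : ℝ) * 4 ^ w ≤ (((a + k) ⌈/⌉ r : ℕ) : ℝ) - (a ⌈/⌉ r : ℕ) := by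
      rw [← Nat.cast_sub hab]
      exact_mod_cast hlen'
    have h4 : (4 : ℝ) ^ w = 2 ^ w * 2 ^ w := by
      rw [← mul_pow]; norm_num
    have hdiv : (4 : ℝ) * 2 ^ w ≤ ((((a + k) ⌈/⌉ r : ℕ) : ℝ) - (a ⌈/⌉ r : ℕ)) / 2 ^ w := by
      rw [le_div_iff₀ (by positivity)]
      linarith
    have hw2 : ((w : ℝ) + 1) ≤ 2 ^ w := by
      exact_mod_cast Nat.lt_two_pow_self (n := w)
    have h1 : (1 : ℝ) ≤ 2 ^ w := one_le_pow₀ (by norm_num)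
    have : ((w + 3 : ℕ) : ℝ) ≤ M.card := by
      push_cast
      linarith
    exact_mod_cast this
  have hcomp : M.card ≤ (S.filter (fun n => ¬ n.Prime)).card + 1 := by
    have hle : (M.erase 1).card ≤ (S.filter (fun n => ¬ n.Prime)).card := by
      apply Finset.card_le_card_of_injOn (fun m => r * m)
      · intro m hm
        simp only [hM, hS, Finset.coe_erase, Finset.coe_filter, Finset.mem_filter, Finset.mem_Ico,
          Set.mem_sdiff, Set.mem_ofPred_eq, Set.mem_singleton_iff] at hm ⊢
        obtain ⟨⟨⟨h1, h2⟩, h3⟩, h4⟩ := hm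
        rw [ceilDiv_le_iff_le_mul hr0] at h1
        rw [← not_le, ceilDiv_le_iff_le_mul hr0, not_le] at h2
        exact ⟨⟨⟨h1, h2⟩, Nat.Coprime.mul_right hkr h3⟩, Nat.not_prime_mul (by omega) h4⟩
      · intro m _ m' _ h
        exact Nat.eq_of_mul_eq_mul_left hr0 h
    have := Finset.pred_card_le_card_erase (s := M) (a := 1)
    omega
  have hprimes : ((Finset.Ico a (a + k)).filter Nat.Prime).card ≤
      w + (S.filter (fun n => n.Prime)).card := by
    rw [hw]
    refine le_trans (Finset.card_le_card fun p hp => ?_) (Finset.card_union_le _ _)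
    obtain ⟨hpI, hpp⟩ := Finset.mem_filter.1 hp
    by_cases hpk : p ∣ k
    · exact Finset.mem_union_left _ (Nat.mem_primeFactors.2 ⟨hpp, hpk, hk⟩)
    · refine Finset.mem_union_right _ (Finset.mem_filter.2 ⟨Finset.mem_filter.2 ⟨hpI, ?_⟩, hpp⟩)
      exact ((Nat.Prime.coprime_iff_not_dvd hpp).2 hpk).symm
  have hsplit := Finset.card_filter_add_card_filter_not (s := S) (fun n => n.Prime)
  omega

lemma pit_le_card_primes_Ico (k t : ℕ) :
    pit k t ≤ ((Finset.Ico (Nat.nth Nat.Prime t + 1 - k)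
      (Nat.nth Nat.Prime t + 1 - k + k)).filter Nat.Prime).card := by
  have hmono := Nat.nth_strictMono Nat.infinite_setOfPred_prime
  refine Finset.card_le_card_of_injOn (Nat.nth Nat.Prime) ?_ hmono.injective.injOn
  intro j hj
  simp only [Finset.coe_filter, Finset.mem_range, Set.mem_ofPred_eq, Finset.mem_Ico] at hj ⊢
  have hlt : Nat.nth Nat.Prime j < Nat.nth Nat.Prime t := hmono hj.1
  exact ⟨⟨by omega, by omega⟩, Nat.prime_nth_prime j⟩

/-- A product of `m ≥ c n log n` factors `1 - 1/(n - x t)`, each in `[0, 1 - 1/n]`, is at most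
`n ^ (-c)`. -/
lemma prod_one_sub_one_div_sub_le_rpow_neg {n c : ℝ} (hn : 0 < n) {m : ℕ}
    (hm : c * n * Real.log n ≤ m) {x : ℕ → ℝ} (hx0 : ∀ t < m, 0 ≤ x t)
    (hx : ∀ t < m, x t + 1 ≤ n) :
    ∏ t ∈ Finset.range m, (1 - 1 / (n - x t)) ≤ n ^ (-c) := by
  calc ∏ t ∈ Finset.range m, (1 - 1 / (n - x t))
      ≤ ∏ _t ∈ Finset.range m, Real.exp (-(1 / n)) := by
        refine Finset.prod_le_prod (fun t ht => ?_) fun t ht => ?_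
        · have h1 := hx t (Finset.mem_range.1 ht)
          rw [sub_nonneg, div_le_one (by linarith)]
          linarith
        · have h0 := hx0 t (Finset.mem_range.1 ht)
          have h1 := hx t (Finset.mem_range.1 ht)
          have h2 : 1 / n ≤ 1 / (n - x t) :=
            one_div_le_one_div_of_le (by linarith) (by linarith)
          linarith [Real.add_one_le_exp (-(1 / n))]
    _ = Real.exp (-(m / n)) := by
        rw [Finset.prod_const, Finset.card_range, ← Real.exp_nat_mul]
        congr 1
        ring
    _ ≤ n ^ (-c) := by
        rw [Real.rpow_def_of_pos hn, Real.exp_le_exp]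
        have : c * Real.log n ≤ m / n := by
          rw [le_div_iff₀ hn]
          linarith
        linarith

/-- For every `ε ∈ (0,1/2)` there is `k₀` such that for all `k ≥ k₀`, with
`m_k = ⌈(2+ε)·φ(k)·log φ(k)⌉`: `π_t + 2 ≤ φ(k)` for all `1 ≤ t ≤ m_k`, and
`φ(k) · ∏_{t=1}^{m_k} (1 - 1/(φ(k) - π_t)) ≤ φ(k)^{-1-ε/2}`. -/
theorem coupon_upper_tail :
    ∀ ε : ℝ, 0 < ε → ε < 1 / 2 →
      ∃ k₀ : ℕ, ∀ k : ℕ, k₀ ≤ k →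
        (∀ t : ℕ, t < ⌈(2 + ε) * (Nat.totient k : ℝ) *
            Real.log (Nat.totient k)⌉₊ → pit k t + 2 ≤ Nat.totient k) ∧
        (Nat.totient k : ℝ) *
            ∏ t ∈ Finset.range ⌈(2 + ε) * (Nat.totient k : ℝ) *
                Real.log (Nat.totient k)⌉₊,
              (1 - 1 / ((Nat.totient k : ℝ) - (pit k t : ℝ))) ≤
          (Nat.totient k : ℝ) ^ (-1 - ε / 2 : ℝ) := by
  intro ε hε _
  refine ⟨15 ^ 2 * 256 ^ 256, fun k hk => ?_⟩
  have hk0 : k ≠ 0 := by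
    rintro rfl
    exact absurd hk (Nat.not_le.2 (Nat.mul_pos (by norm_num) (Nat.pow_pos (by norm_num))))
  have hlarge : 15 * 16 ^ k.primeFactors.card ≤ k := by
    have h := pow_card_primeFactors_le hk0 (B := 256) (by norm_num)
    have hsq : (256 : ℕ) ^ k.primeFactors.card =
        16 ^ k.primeFactors.card * 16 ^ k.primeFactors.card := by
      rw [← mul_pow]; norm_num
    rw [hsq] at h
    generalize (256 : ℕ) ^ 256 = C at h hk
    generalize (16 : ℕ) ^ k.primeFactors.card = W at h ⊢
    nlinarith
  have hpit : ∀ t, pit k t + 2 ≤ k.totient := fun t =>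
    (Nat.add_le_add_right (pit_le_card_primes_Ico k t) 2).trans
      (card_primes_Ico_add_two_le_totient hk0 hlarge _)
  refine ⟨fun t _ => hpit t, ?_⟩
  have hφ1 : (1 : ℝ) ≤ k.totient := by
    exact_mod_cast Nat.totient_pos.2 (Nat.pos_of_ne_zero hk0)
  have hφ0 : (0 : ℝ) < k.totient := by linarith
  have hprod := prod_one_sub_one_div_sub_le_rpow_neg hφ0
    (Nat.le_ceil ((2 + ε) * (k.totient : ℝ) * Real.log k.totient))
    (x := fun t => (pit k t : ℝ)) (fun t _ => Nat.cast_nonneg _)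
    (fun t _ => by exact_mod_cast (Nat.le_succ _).trans (hpit t))
  calc _ ≤ (k.totient : ℝ) * (k.totient : ℝ) ^ (-(2 + ε)) :=
        mul_le_mul_of_nonneg_left hprod hφ0.le
    _ = (k.totient : ℝ) ^ (1 + -(2 + ε)) := by
        rw [Real.rpow_add hφ0, Real.rpow_one]
    _ ≤ (k.totient : ℝ) ^ (-1 - ε / 2 : ℝ) :=
        Real.rpow_le_rpow_of_exponent_le hφ1 (by linarith)
end

section
/- For every ε ∈ (0,1/2) there exists k₀ such that for all integers k ≥ k₀ the following holds with m_k := ⌊(1−ε)·φ(k)·log φ(k)⌋: one has π_t + 2 ≤ φ(k) for all 1 ≤ t ≤ m_k, and (1 − ∏_{t=1}^{m_k} (1 − 1/(φ(k) − π_t)))^{φ(k)} ≤ k^{−2}. -/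
open scoped Classical

open Finset in
lemma abs_card_dvd_Ico_sub_le (a k d : ℕ) (hd : 0 < d) :
    |(#{n ∈ Ico a (a + k) | d ∣ n} : ℝ) - k / d| ≤ 1 := by
  have h := Nat.Ico_filter_modEq_card a (a + k) hd 0
  simp only [Nat.modEq_zero_iff_dvd, Nat.cast_zero, sub_zero, Nat.cast_add] at h
  have hd' : (0 : ℚ) < d := by exact_mod_cast hd
  have hle : ⌈(a : ℚ) / d⌉ ≤ ⌈((a : ℚ) + k) / d⌉ := by
    apply Int.ceil_mono
    gcongr
    simp
  rw [max_eq_left (by omega)] at h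
  have h1 := Int.le_ceil ((a : ℚ) / d)
  have h2 := Int.ceil_lt_add_one ((a : ℚ) / d)
  have h3 := Int.le_ceil (((a : ℚ) + k) / d)
  have h4 := Int.ceil_lt_add_one (((a : ℚ) + k) / d)
  have h5 : |(#{n ∈ Ico a (a + k) | d ∣ n} : ℚ) - k / d| ≤ 1 := by
    have : (#{n ∈ Ico a (a + k) | d ∣ n} : ℚ) = ⌈((a : ℚ) + k) / d⌉ - ⌈(a : ℚ) / d⌉ := by
      exact_mod_cast h
    rw [this, abs_le]
    rw [add_div] at *
    constructor <;> linarith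
  have h6 := (Rat.cast_le (K := ℝ)).2 h5
  push_cast at h6
  exact h6

open Finset in
/-- Legendre's sieve with the trivial error term. -/
lemma abs_card_sifted_sub_le (a k : ℕ) (P : Finset ℕ) (hP : ∀ p ∈ P, p.Prime) (d : ℕ)
    (hd : 0 < d) (hdP : ∀ p ∈ P, ¬ p ∣ d) :
    |(#{n ∈ Ico a (a + k) | d ∣ n ∧ ∀ p ∈ P, ¬ p ∣ n} : ℝ)
      - k / d * ∏ p ∈ P, (1 - (p : ℝ)⁻¹)| ≤ 2 ^ #P := by
  induction P using Finset.induction_on generalizing d with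
  | empty => simpa using abs_card_dvd_Ico_sub_le a k d hd
  | insert q P hq ih =>
    have hqp : q.Prime := hP q (mem_insert_self _ _)
    have hqd : ¬ q ∣ d := hdP q (mem_insert_self _ _)
    have hP' : ∀ p ∈ P, p.Prime := fun p hp => hP p (mem_insert_of_mem hp)
    have h1 := ih hP' d hd fun p hp => hdP p (mem_insert_of_mem hp)
    have h2 := ih hP' (d * q) (Nat.mul_pos hd hqp.pos) (by
      intro p hp hpd
      rcases (hP' p hp).dvd_mul.1 hpd with h | h
      · exact hdP p (mem_insert_of_mem hp) h
      · exact hq ((Nat.prime_dvd_prime_iff_eq (hP' p hp) hqp).1 h ▸ hp))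
    have hcop : d.Coprime q := ((Nat.Prime.coprime_iff_not_dvd hqp).2 hqd).symm
    have hsplit : #{n ∈ Ico a (a + k) | d ∣ n ∧ ∀ p ∈ P, ¬ p ∣ n}
        = #{n ∈ Ico a (a + k) | d * q ∣ n ∧ ∀ p ∈ P, ¬ p ∣ n}
          + #{n ∈ Ico a (a + k) | d ∣ n ∧ ∀ p ∈ insert q P, ¬ p ∣ n} := by
      rw [← card_filter_add_card_filter_not (fun n => q ∣ n), filter_filter, filter_filter]
      congr 2
      · ext n
        simp only [mem_filter]
        have : d * q ∣ n ↔ d ∣ n ∧ q ∣ n :=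
          ⟨fun h => ⟨(Dvd.intro _ rfl).trans h, (Dvd.intro_left _ rfl).trans h⟩,
            fun h => hcop.mul_dvd_of_dvd_of_dvd h.1 h.2⟩
        tauto
      · ext n
        simp only [mem_filter, mem_insert, forall_eq_or_imp]
        tauto
    have hsplit' : (#{n ∈ Ico a (a + k) | d ∣ n ∧ ∀ p ∈ P, ¬ p ∣ n} : ℝ)
        = #{n ∈ Ico a (a + k) | d * q ∣ n ∧ ∀ p ∈ P, ¬ p ∣ n}
          + #{n ∈ Ico a (a + k) | d ∣ n ∧ ∀ p ∈ insert q P, ¬ p ∣ n} := by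
      exact_mod_cast hsplit
    rw [prod_insert hq, card_insert_of_notMem hq, pow_succ]
    have hmain : (k : ℝ) / d * ((1 - (q : ℝ)⁻¹) * ∏ p ∈ P, (1 - (p : ℝ)⁻¹))
        = k / d * ∏ p ∈ P, (1 - (p : ℝ)⁻¹)
          - k / (d * q : ℕ) * ∏ p ∈ P, (1 - (p : ℝ)⁻¹) := by
      have : (d : ℝ) ≠ 0 := by exact_mod_cast hd.ne'
      have : (q : ℝ) ≠ 0 := by exact_mod_cast hqp.ne_zero
      push_cast
      field_simp
    rw [hmain]
    rw [abs_le] at *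
    constructor <;> linarith

lemma totient_eq_mul_prod_one_sub_inv (k : ℕ) :
    (Nat.totient k : ℝ) = k * ∏ p ∈ k.primeFactors, (1 - (p : ℝ)⁻¹) := by
  have h := congrArg (Rat.cast : ℚ → ℝ) (Nat.totient_eq_mul_prod_factors k)
  push_cast at h
  exact h

open Finset in
lemma abs_card_dvd_coprime_sub_le (a k d : ℕ) (hd : 0 < d) (hdk : d.Coprime k) (hk : k ≠ 0) :
    |(#{n ∈ Ico a (a + k) | d ∣ n ∧ n.Coprime k} : ℝ) - Nat.totient k / d|
      ≤ 2 ^ #k.primeFactors := by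
  have h := abs_card_sifted_sub_le a k k.primeFactors (fun p => Nat.prime_of_mem_primeFactors) d hd
    (fun p hp hpd => (Nat.prime_of_mem_primeFactors hp).not_dvd_one
      (hdk ▸ Nat.dvd_gcd hpd (Nat.dvd_of_mem_primeFactors hp)))
  have htot : (Nat.totient k : ℝ) = k * ∏ p ∈ k.primeFactors, (1 - (p : ℝ)⁻¹) :=
    totient_eq_mul_prod_one_sub_inv k
  rw [htot]
  have hset : ∀ n : ℕ, n.Coprime k ↔ ∀ p ∈ k.primeFactors, ¬ p ∣ n := by
    intro n
    constructor
    · intro hn p hp hpn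
      exact (Nat.prime_of_mem_primeFactors hp).not_dvd_one
        (hn ▸ Nat.dvd_gcd hpn (Nat.dvd_of_mem_primeFactors hp))
    · intro hn
      exact Nat.coprime_of_dvd fun p hp hpn hpk => hn p (Nat.mem_primeFactors.2 ⟨hp, hpk, hk⟩) hpn
  simp only [hset]
  convert h using 3
  ring

open Finset in
/-- Turán's second moment bound for the elements of `A` not divisible by any element of `Q`. -/
lemma card_forall_not_dvd_mul_sq_le (A Q : Finset ℕ) (N R : ℝ) (hN : 0 ≤ N) (hR : 0 ≤ R)
    (h0 : (#A : ℝ) ≤ N + R) (hQ : ∀ q ∈ Q, 0 < q)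
    (h1 : ∀ q ∈ Q, |(#{n ∈ A | q ∣ n} : ℝ) - N / q| ≤ R)
    (h2 : ∀ q ∈ Q, ∀ r ∈ Q, q ≠ r → (#{n ∈ A | q ∣ n ∧ r ∣ n} : ℝ) ≤ N / (q * r) + R) :
    (#{n ∈ A | ∀ q ∈ Q, ¬ q ∣ n} : ℝ) * (∑ q ∈ Q, (q : ℝ)⁻¹) ^ 2
      ≤ N * (∑ q ∈ Q, (q : ℝ)⁻¹) + 5 * R * (#Q : ℝ) ^ 2 := by
  set S := ∑ q ∈ Q, (q : ℝ)⁻¹ with hS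
  have hS0 : 0 ≤ S := sum_nonneg fun q _ => by positivity
  have hSQ : S ≤ #Q := by
    rw [card_eq_sum_ones, Nat.cast_sum]
    refine sum_le_sum fun q hq => ?_
    have : (1 : ℝ) ≤ q := by exact_mod_cast hQ q hq
    simpa using inv_le_one_of_one_le₀ this
  let w : ℕ → ℝ := fun n => ∑ q ∈ Q, if q ∣ n then 1 else 0
  have hlow : (#{n ∈ A | ∀ q ∈ Q, ¬ q ∣ n} : ℝ) * S ^ 2 ≤ ∑ n ∈ A, (w n - S) ^ 2 := by
    calc (#{n ∈ A | ∀ q ∈ Q, ¬ q ∣ n} : ℝ) * S ^ 2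
        = ∑ n ∈ A with ∀ q ∈ Q, ¬ q ∣ n, (w n - S) ^ 2 := by
          rw [← nsmul_eq_mul, ← sum_const]
          refine sum_congr rfl fun n hn => ?_
          have : w n = 0 := sum_eq_zero fun q hq => if_neg ((mem_filter.1 hn).2 q hq)
          rw [this]; ring
      _ ≤ _ := sum_le_sum_of_subset_of_nonneg (filter_subset _ _) fun _ _ _ => sq_nonneg _
  have hw1 : ∑ n ∈ A, w n = ∑ q ∈ Q, (#{n ∈ A | q ∣ n} : ℝ) := by
    rw [sum_comm]
    exact sum_congr rfl fun q _ => by rw [sum_boole]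
  have hw2 : ∑ n ∈ A, w n ^ 2 = ∑ q ∈ Q, ∑ r ∈ Q, (#{n ∈ A | q ∣ n ∧ r ∣ n} : ℝ) := by
    simp only [w, sq, sum_mul_sum]
    rw [sum_comm]
    refine sum_congr rfl fun q _ => ?_
    rw [sum_comm]
    refine sum_congr rfl fun r _ => ?_
    rw [← sum_boole]
    refine sum_congr rfl fun n _ => ?_
    by_cases hq : q ∣ n <;> by_cases hr : r ∣ n <;> simp [hq, hr]
  have hb1 : N * S - R * #Q ≤ ∑ n ∈ A, w n := by
    rw [hw1, hS, mul_sum, mul_comm R, ← nsmul_eq_mul, ← sum_const, ← sum_sub_distrib]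
    refine sum_le_sum fun q hq => ?_
    have := (abs_le.1 (h1 q hq)).1
    rw [div_eq_mul_inv] at this
    linarith
  have hb2 : ∑ n ∈ A, w n ^ 2 ≤ N * S ^ 2 + N * S + R * (#Q : ℝ) ^ 2 + R * #Q := by
    rw [hw2]
    have hpt : ∀ q ∈ Q, ∀ r ∈ Q, (#{n ∈ A | q ∣ n ∧ r ∣ n} : ℝ)
        ≤ (N * ((q : ℝ)⁻¹ * (r : ℝ)⁻¹) + R) + if q = r then N * (q : ℝ)⁻¹ + R else 0 := by
      intro q hq r hr
      by_cases hqr : q = r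
      · subst hqr
        have := (abs_le.1 (h1 q hq)).2
        rw [div_eq_mul_inv] at this
        have h3 : 0 ≤ N * ((q : ℝ)⁻¹ * (q : ℝ)⁻¹) := by positivity
        simp only [and_self, if_true]
        linarith
      · have := h2 q hq r hr hqr
        rw [div_eq_mul_inv, mul_inv] at this
        simpa [hqr] using this
    refine (sum_le_sum fun q hq => sum_le_sum fun r hr => hpt q hq r hr).trans (le_of_eq ?_)
    simp only [sum_add_distrib, sum_ite_eq, ← mul_sum, sum_const, nsmul_eq_mul, ← sum_mul]
    rw [sum_congr rfl fun q hq => if_pos hq]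
    simp only [sum_add_distrib, ← mul_sum, sum_const, nsmul_eq_mul]
    ring
  have hexp : ∑ n ∈ A, (w n - S) ^ 2 = ∑ n ∈ A, w n ^ 2 - 2 * S * ∑ n ∈ A, w n + #A * S ^ 2 := by
    rw [mul_sum, ← nsmul_eq_mul, ← sum_const, ← sum_sub_distrib, ← sum_add_distrib]
    exact sum_congr rfl fun n _ => by ring
  have hQ2 : (#Q : ℝ) ≤ (#Q : ℝ) ^ 2 := by
    exact_mod_cast Nat.le_self_pow two_ne_zero _
  have e1 : 2 * S * (N * S - R * #Q) ≤ 2 * S * ∑ n ∈ A, w n := by gcongr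
  have e2 : #A * S ^ 2 ≤ (N + R) * S ^ 2 := by gcongr
  have e3 : R * #Q ≤ R * (#Q : ℝ) ^ 2 := by gcongr
  have e4 : R * (S * #Q) ≤ R * (#Q : ℝ) ^ 2 := by rw [sq]; gcongr
  have e5 : R * S ^ 2 ≤ R * (#Q : ℝ) ^ 2 := by gcongr
  nlinarith

open Finset in
lemma factorial_card_le_prod (P : Finset ℕ) (hP : ∀ p ∈ P, 0 < p) :
    (#P).factorial ≤ ∏ p ∈ P, p := by
  induction P using Finset.induction_on_max with
  | empty => simp
  | insert a s ha ih =>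
    have has : a ∉ s := fun h => (ha a h).false
    have hcard : #s + 1 ≤ a := by
      have hsub : s ⊆ Ico 1 a := fun x hx =>
        mem_Ico.2 ⟨hP x (mem_insert_of_mem hx), ha x hx⟩
      have h1 := card_le_card hsub
      have h2 := hP a (mem_insert_self _ _)
      rw [Nat.card_Ico] at h1
      omega
    rw [card_insert_of_notMem has, prod_insert has, Nat.factorial_succ]
    exact Nat.mul_le_mul hcard (ih fun p hp => hP p (mem_insert_of_mem hp))

open Finset in
lemma inv_card_succ_le_prod_one_sub_inv (P : Finset ℕ) (hP : ∀ p ∈ P, 2 ≤ p) :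
    ((#P : ℝ) + 1)⁻¹ ≤ ∏ p ∈ P, (1 - (p : ℝ)⁻¹) := by
  induction P using Finset.induction_on_max with
  | empty => simp
  | insert a s ha ih =>
    have has : a ∉ s := fun h => (ha a h).false
    have hcard : #s + 2 ≤ a := by
      have hsub : s ⊆ Ico 2 a := fun x hx =>
        mem_Ico.2 ⟨hP x (mem_insert_of_mem hx), ha x hx⟩
      have h1 := card_le_card hsub
      have h2 := hP a (mem_insert_self _ _)
      rw [Nat.card_Ico] at h1
      omega
    have hcard' : (#s : ℝ) + 2 ≤ a := by exact_mod_cast hcard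
    have h0 : (0 : ℝ) ≤ #s := Nat.cast_nonneg _
    have h3 : 1 - ((#s : ℝ) + 2)⁻¹ ≤ 1 - (a : ℝ)⁻¹ := by gcongr
    have h4 : 0 ≤ 1 - ((#s : ℝ) + 2)⁻¹ := by
      rw [sub_nonneg]
      exact inv_le_one_of_one_le₀ (by linarith)
    rw [card_insert_of_notMem has, prod_insert has]
    calc (((#s + 1 : ℕ) : ℝ) + 1)⁻¹ = (1 - ((#s : ℝ) + 2)⁻¹) * ((#s : ℝ) + 1)⁻¹ := by
          push_cast
          field_simp
          ring
      _ ≤ _ := mul_le_mul h3 (ih fun p hp => hP p (mem_insert_of_mem hp)) (by positivity)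
          (h4.trans h3)

open Finset in
lemma pow_card_primeFactors_le_s12 (k : ℕ) (hk : k ≠ 0) (x : ℝ) (hx : 0 ≤ x) :
    x ^ #k.primeFactors ≤ Real.exp x * k := by
  have h1 := Real.pow_div_factorial_le_exp x hx #k.primeFactors
  rw [div_le_iff₀ (by positivity)] at h1
  refine h1.trans ?_
  gcongr
  exact (factorial_card_le_prod _ fun p => Nat.pos_of_mem_primeFactors).trans
    (Nat.le_of_dvd hk.bot_lt (Nat.prod_primeFactors_dvd k))

open Finset in
lemma log_succ_le_prod_primesBelow (z : ℕ) :
    Real.log (z + 1) ≤ ∏ p ∈ (z + 1).primesBelow, (1 - (p : ℝ)⁻¹)⁻¹ := by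
  let f : ℕ →* ℝ :=
    { toFun := fun n => (n : ℝ)⁻¹
      map_one' := by simp
      map_mul' := fun m n => by push_cast; rw [mul_inv] }
  have hf : ∀ {p : ℕ}, p.Prime → ‖f p‖ < 1 := by
    intro p hp
    have h1 : (1 : ℝ) < p := by exact_mod_cast hp.one_lt
    simpa [f] using inv_lt_one_of_one_lt₀ h1
  have hsum := (EulerProduct.summable_and_hasSum_smoothNumbers_prod_primesBelow_geometric hf
    (z + 1)).2
  have hlog := log_add_one_le_harmonic z
  rw [harmonic_eq_sum_Icc] at hlog
  push_cast at hlog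
  refine hlog.trans ?_
  have hmem : ∀ n ∈ Icc 1 z, n ∈ (z + 1).smoothNumbers := fun n hn =>
    Nat.mem_smoothNumbers_of_lt (mem_Icc.1 hn).1 (Nat.lt_succ_of_le (mem_Icc.1 hn).2)
  have hle := sum_le_hasSum ((Icc 1 z).subtype (· ∈ (z + 1).smoothNumbers))
    (fun n _ => by simp [f]) hsum
  rwa [sum_subtype_of_mem f hmem] at hle

lemma exp_neg_two_mul_le_one_sub {x : ℝ} (h0 : 0 ≤ x) (h1 : x ≤ 1 / 2) :
    Real.exp (-(2 * x)) ≤ 1 - x := by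
  rw [← Real.le_log_iff_exp_le (by linarith)]
  refine le_trans ?_ (Real.one_sub_inv_le_log_of_pos (by linarith))
  have h2 : (1 - x)⁻¹ ≤ 1 + 2 * x := by
    rw [inv_le_iff_one_le_mul₀ (by linarith)]
    nlinarith
  linarith

open Finset in
/-- The primes at most `z` not dividing `k` have a large sum of reciprocals. -/
lemma log_succ_mul_inv_card_succ_le (k z : ℕ) (hk : k ≠ 0) :
    Real.log (z + 1) * ((#k.primeFactors : ℝ) + 1)⁻¹
      ≤ Real.exp (2 * ∑ q ∈ (z + 1).primesBelow with ¬ q ∣ k, (q : ℝ)⁻¹) := by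
  have hpos : ∀ p : ℕ, p.Prime → 0 < 1 - (p : ℝ)⁻¹ := fun p hp => by
    have h1 : (1 : ℝ) < p := by exact_mod_cast hp.one_lt
    exact sub_pos.2 (inv_lt_one_of_one_lt₀ h1)
  have hle1 : ∀ p : ℕ, 1 - (p : ℝ)⁻¹ ≤ 1 := fun p => sub_le_self _ (by positivity)
  have hdvd : ∏ p ∈ k.primeFactors, (1 - (p : ℝ)⁻¹)
      ≤ ∏ p ∈ (z + 1).primesBelow with p ∣ k, (1 - (p : ℝ)⁻¹) := by
    refine prod_le_prod_of_subset_of_le_one ?_ ?_ ?_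
    · intro p hp
      rw [mem_filter, Nat.mem_primesBelow] at hp
      exact Nat.mem_primeFactors.2 ⟨hp.1.2, hp.2, hk⟩
    · exact fun p hp => (hpos p (Nat.prime_of_mem_primeFactors hp)).le
    · exact fun p _ _ => hle1 p
  have hP : ∀ p ∈ (z + 1).primesBelow, p.Prime := fun p hp => (Nat.mem_primesBelow.1 hp).2
  have hlow := inv_card_succ_le_prod_one_sub_inv k.primeFactors fun p hp =>
    (Nat.prime_of_mem_primeFactors hp).two_le
  have hexp : ∏ p ∈ (z + 1).primesBelow with ¬ p ∣ k, (1 - (p : ℝ)⁻¹)⁻¹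
      ≤ Real.exp (2 * ∑ q ∈ (z + 1).primesBelow with ¬ q ∣ k, (q : ℝ)⁻¹) := by
    rw [mul_sum, Real.exp_sum]
    refine prod_le_prod (fun p hp => (inv_pos.2 (hpos p (hP p (mem_filter.1 hp).1))).le)
      fun p hp => ?_
    have hpp := hP p (mem_filter.1 hp).1
    have h2 : (p : ℝ)⁻¹ ≤ 1 / 2 := by
      have : (2 : ℝ) ≤ p := by exact_mod_cast hpp.two_le
      rw [one_div]; gcongr
    have h3 := exp_neg_two_mul_le_one_sub (by positivity) h2
    rw [inv_le_comm₀ (hpos p hpp) (Real.exp_pos _), ← Real.exp_neg]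
    exact h3
  refine le_trans ?_ hexp
  have hz := log_succ_le_prod_primesBelow z
  rw [← prod_filter_mul_prod_filter_not _ (fun p => p ∣ k)] at hz
  have hA : 0 < ∏ p ∈ (z + 1).primesBelow with p ∣ k, (1 - (p : ℝ)⁻¹) :=
    prod_pos fun p hp => hpos p (hP p (mem_filter.1 hp).1)
  have hB : 0 ≤ Real.log (z + 1) := Real.log_nonneg (by simp)
  calc Real.log (z + 1) * ((#k.primeFactors : ℝ) + 1)⁻¹
      ≤ Real.log (z + 1) * ∏ p ∈ (z + 1).primesBelow with p ∣ k, (1 - (p : ℝ)⁻¹) :=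
        mul_le_mul_of_nonneg_left (hlow.trans hdvd) hB
    _ ≤ _ := by
        rw [← le_div_iff₀ hA, div_eq_inv_mul, ← prod_inv_distrib]
        exact hz

open Finset in
lemma cube_le_exp_mul_totient_pow (k : ℕ) :
    (k : ℝ) ^ 3 ≤ Real.exp 16 * (Nat.totient k : ℝ) ^ 4 := by
  rcases eq_or_ne k 0 with rfl | hk
  · simp
  have hk0 : (0 : ℝ) < k := by exact_mod_cast hk.bot_lt
  have h1 : (k : ℝ) ≤ Nat.totient k * 2 ^ #k.primeFactors := by
    rw [totient_eq_mul_prod_one_sub_inv, mul_assoc]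
    refine le_mul_of_one_le_right hk0.le ?_
    rw [← prod_const, ← prod_mul_distrib]
    refine one_le_prod fun p hp => ?_
    have h2 : (2 : ℝ) ≤ p := by exact_mod_cast (Nat.prime_of_mem_primeFactors hp).two_le
    have h3 : (p : ℝ)⁻¹ ≤ 2⁻¹ := by gcongr
    linarith
  have h2 := pow_card_primeFactors_le_s12 k hk 16 (by norm_num)
  have h3 : ((2 : ℝ) ^ #k.primeFactors) ^ 4 = 16 ^ #k.primeFactors := by
    rw [← pow_mul, mul_comm, pow_mul]; norm_num
  refine le_of_mul_le_mul_right ?_ hk0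
  calc (k : ℝ) ^ 3 * k = (k : ℝ) ^ 4 := by ring
    _ ≤ ((Nat.totient k : ℝ) * 2 ^ #k.primeFactors) ^ 4 := by gcongr
    _ = (Nat.totient k : ℝ) ^ 4 * 16 ^ #k.primeFactors := by rw [mul_pow, h3]
    _ ≤ (Nat.totient k : ℝ) ^ 4 * (Real.exp 16 * k) := by gcongr
    _ = _ := by ring

open Finset in
lemma pit_le (k z t : ℕ) (hk : k ≠ 0) {s : ℝ} (hs : 1 ≤ s)
    (hS : s ≤ ∑ q ∈ (z + 1).primesBelow with ¬ q ∣ k, (q : ℝ)⁻¹) :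
    (pit k t : ℝ) ≤ Nat.totient k / s + 2 ^ #k.primeFactors + z
      + 5 * 2 ^ #k.primeFactors * (z : ℝ) ^ 2 := by
  set Q := {q ∈ (z + 1).primesBelow | ¬ q ∣ k} with hQdef
  set S := ∑ q ∈ Q, (q : ℝ)⁻¹
  set R : ℝ := 2 ^ #k.primeFactors with hR
  have hQprime : ∀ q ∈ Q, q.Prime := fun q hq => (Nat.mem_primesBelow.1 (mem_filter.1 hq).1).2
  have hQcop : ∀ q ∈ Q, q.Coprime k := fun q hq =>
    (hQprime q hq).coprime_iff_not_dvd.2 (mem_filter.1 hq).2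
  have hQcard : #Q ≤ z := by
    have hsub : Q ⊆ Icc 1 z := fun q hq => mem_Icc.2 ⟨(hQprime q hq).one_le,
      Nat.le_of_lt_succ (Nat.mem_primesBelow.1 (mem_filter.1 hq).1).1⟩
    simpa using card_le_card hsub
  set a := Nat.nth Nat.Prime t + 1 - k with ha
  set A := {n ∈ Ico a (a + k) | n.Coprime k} with hA
  set T := {n ∈ A | ∀ q ∈ Q, ¬ q ∣ n} with hT
  have hpit : pit k t ≤ #k.primeFactors + #Q + #T := by
    refine le_trans ?_ ((card_union_le (k.primeFactors ∪ Q) T).trans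
      (Nat.add_le_add_right (card_union_le _ _) _))
    refine card_le_card_of_injOn (Nat.nth Nat.Prime) ?_
      (Nat.nth_injective Nat.infinite_setOfPred_prime).injOn
    intro j hj
    have hj' := mem_filter.1 (mem_coe.1 hj)
    have hlt : Nat.nth Nat.Prime j < Nat.nth Nat.Prime t :=
      Nat.nth_strictMono Nat.infinite_setOfPred_prime (mem_range.1 hj'.1)
    have hp : (Nat.nth Nat.Prime j).Prime := Nat.prime_nth_prime j
    have hclose := hj'.2
    rw [mem_coe, mem_union, mem_union]
    by_cases h1 : Nat.nth Nat.Prime j ∣ k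
    · exact Or.inl (Or.inl (Nat.mem_primeFactors.2 ⟨hp, h1, hk⟩))
    by_cases h2 : Nat.nth Nat.Prime j ∈ Q
    · exact Or.inl (Or.inr h2)
    refine Or.inr (mem_filter.2 ⟨mem_filter.2 ⟨mem_Ico.2 ⟨by omega, by omega⟩,
      hp.coprime_iff_not_dvd.2 h1⟩, fun q hq hdvd => h2 ?_⟩)
    rwa [← (Nat.prime_dvd_prime_iff_eq (hQprime q hq) hp).1 hdvd]
  have hcount : ∀ d : ℕ, 0 < d → d.Coprime k →
      |(#{n ∈ A | d ∣ n} : ℝ) - Nat.totient k / d| ≤ R := by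
    intro d hd hdk
    have h := abs_card_dvd_coprime_sub_le a k d hd hdk hk
    rw [hA, filter_filter]
    simpa only [and_comm] using h
  have hmoment := card_forall_not_dvd_mul_sq_le A Q (Nat.totient k) R (by positivity)
    (by positivity) ?_ (fun q hq => (hQprime q hq).pos)
    (fun q hq => hcount q (hQprime q hq).pos (hQcop q hq)) ?_
  · have hS1 : 1 ≤ S := hs.trans hS
    have hT' : (#T : ℝ) ≤ Nat.totient k / s + 5 * R * (z : ℝ) ^ 2 := by
      have h1 : (#T : ℝ) ≤ Nat.totient k / S + 5 * R * (z : ℝ) ^ 2 := by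
        have hz : 5 * R * (#Q : ℝ) ^ 2 ≤ 5 * R * (z : ℝ) ^ 2 * S ^ 2 := by
          have h3 : 5 * R * (#Q : ℝ) ^ 2 ≤ 5 * R * (z : ℝ) ^ 2 := by gcongr
          exact h3.trans (le_mul_of_one_le_right (by positivity) (one_le_pow₀ hS1))
        have hS2 : 0 < S ^ 2 := by positivity
        refine le_of_mul_le_mul_right ?_ hS2
        have h4 : (Nat.totient k / S + 5 * R * (z : ℝ) ^ 2) * S ^ 2
            = Nat.totient k * S + 5 * R * (z : ℝ) ^ 2 * S ^ 2 := by
          field_simp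
        rw [h4]
        linarith
      have h5 : (Nat.totient k : ℝ) / S ≤ Nat.totient k / s := by gcongr
      linarith
    have hω : (#k.primeFactors : ℝ) ≤ R := by
      rw [hR]; exact_mod_cast Nat.lt_two_pow_self.le
    have hQ' : (#Q : ℝ) ≤ z := by exact_mod_cast hQcard
    have hpit' : (pit k t : ℝ) ≤ #k.primeFactors + #Q + #T := by exact_mod_cast hpit
    linarith
  · have h := hcount 1 one_pos (Nat.coprime_one_left k)
    simp only [one_dvd, filter_true, Nat.cast_one, div_one] at h
    linarith [(abs_le.1 h).2]
  · intro q hq r hr hqr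
    have hcop : q.Coprime r := (Nat.coprime_primes (hQprime q hq) (hQprime r hr)).2 hqr
    have h := hcount (q * r) (Nat.mul_pos (hQprime q hq).pos (hQprime r hr).pos)
      (Nat.Coprime.mul_left (hQcop q hq) (hQcop r hr))
    have heq : ∀ n, q * r ∣ n ↔ q ∣ n ∧ r ∣ n := fun n =>
      ⟨fun h => ⟨(Dvd.intro _ rfl).trans h, (Dvd.intro_left _ rfl).trans h⟩,
        fun h => hcop.mul_dvd_of_dvd_of_dvd h.1 h.2⟩
    simp only [heq, Nat.cast_mul] at h
    linarith [(abs_le.1 h).2]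

open Finset Filter in
/-- The number of primes in an interval of length `k` is `o(φ(k))`. -/
lemma eventually_pit_add_one_le {δ : ℝ} (hδ : 0 < δ) :
    ∀ᶠ k : ℕ in atTop, ∀ t, (pit k t : ℝ) + 1 ≤ δ * Nat.totient k := by
  set s : ℝ := max 1 (2 / δ) with hs
  set M : ℝ := Real.exp (2 * s) with hM
  set K : ℝ := Real.exp (16 * M) with hK
  set C : ℝ := Real.exp 4 with hC
  have hC1 : 1 ≤ C := Real.one_le_exp (by norm_num)
  have hlog : Tendsto (fun k : ℕ => Real.log (k : ℝ)) atTop atTop :=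
    Real.tendsto_log_atTop.comp tendsto_natCast_atTop_atTop
  have hroot : Tendsto (fun k : ℕ => (k : ℝ) ^ (1 / 8 : ℝ)) atTop atTop :=
    (tendsto_rpow_atTop (by norm_num)).comp tendsto_natCast_atTop_atTop
  filter_upwards [hlog.eventually_ge_atTop (K + 16 * M), hroot.eventually_ge_atTop 1,
    hroot.eventually_ge_atTop (16 * C ^ 2 / δ), eventually_ne_atTop 0] with k hk1 hk2 hk3 hk0 t
  set x : ℝ := (k : ℝ) ^ (1 / 8 : ℝ) with hx
  have hkpos : (0 : ℝ) < k := by exact_mod_cast hk0.bot_lt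
  have hx8 : x ^ 8 = k := by
    rw [hx, ← Real.rpow_natCast, ← Real.rpow_mul hkpos.le]; norm_num
  have hx0 : 0 < x := by linarith
  set R : ℝ := 2 ^ #k.primeFactors with hR
  have hC4 : C ^ 4 = Real.exp 16 := by rw [hC, ← Real.exp_nat_mul]; norm_num
  have hRx : R ≤ C * x ^ 2 := by
    refine le_of_pow_le_pow_left₀ (n := 4) (by norm_num) (by positivity) ?_
    have h2 := pow_card_primeFactors_le_s12 k hk0 16 (by norm_num)
    have h3 : R ^ 4 = 16 ^ #k.primeFactors := by
      rw [hR, ← pow_mul, mul_comm, pow_mul]; norm_num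
    rw [h3, mul_pow, hC4, ← pow_mul, hx8]
    exact h2
  have hN : x ^ 6 ≤ C * Nat.totient k := by
    refine le_of_pow_le_pow_left₀ (n := 4) (by norm_num) (by positivity) ?_
    have h := cube_le_exp_mul_totient_pow k
    rw [mul_pow, hC4, ← pow_mul]
    rw [← hx8, ← pow_mul] at h
    exact h
  set z := ⌊x⌋₊ with hz
  have hzx : (z : ℝ) ≤ x := Nat.floor_le hx0.le
  have hS : s ≤ ∑ q ∈ (z + 1).primesBelow with ¬ q ∣ k, (q : ℝ)⁻¹ := by
    have h1 := log_succ_mul_inv_card_succ_le k z hk0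
    have h2 : Real.log k / 8 ≤ Real.log (z + 1) := by
      have h3 : Real.log x ≤ Real.log (z + 1) :=
        Real.log_le_log hx0 (Nat.lt_floor_add_one x).le
      rw [← hx8, Real.log_pow]
      push_cast
      linarith
    have h4 : #k.primeFactors * (16 * M) ≤ K + Real.log k := by
      have h5 := Real.log_le_log (by positivity) (pow_card_primeFactors_le_s12 k hk0 K (by positivity))
      rw [Real.log_pow, Real.log_mul (by positivity) hkpos.ne', Real.log_exp, hK, Real.log_exp]
        at h5
      exact h5
    have h6 : M ≤ Real.log (z + 1) * ((#k.primeFactors : ℝ) + 1)⁻¹ := by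
      rw [← div_eq_mul_inv, le_div_iff₀ (by positivity)]
      linarith
    have h7 := Real.exp_le_exp.1 (h6.trans h1)
    linarith
  have hpit := pit_le k z t hk0 (le_max_left 1 (2 / δ)) hS
  have hs2 : (Nat.totient k : ℝ) / s ≤ δ / 2 * Nat.totient k := by
    rw [div_le_iff₀ (by positivity)]
    have h1 : 2 / δ ≤ s := le_max_right _ _
    rw [div_le_iff₀ hδ] at h1
    nlinarith [(Nat.cast_nonneg (Nat.totient k) : (0 : ℝ) ≤ Nat.totient k)]
  have herr : 1 + R + z + 5 * R * (z : ℝ) ^ 2 ≤ 8 * C * x ^ 4 := by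
    have h1 : 5 * R * (z : ℝ) ^ 2 ≤ 5 * (C * x ^ 2) * x ^ 2 := by gcongr
    have h2 : x ^ 2 ≤ x ^ 4 := pow_le_pow_right₀ hk2 (by norm_num)
    have h3 : x ≤ x ^ 4 := le_self_pow₀ hk2 (by norm_num)
    have h4 : 1 ≤ x ^ 4 := one_le_pow₀ hk2
    have h5 : x ^ 4 ≤ C * x ^ 4 := le_mul_of_one_le_left (by positivity) hC1
    have h6 : C * x ^ 2 ≤ C * x ^ 4 := by gcongr
    linarith
  have hmain : 8 * C * x ^ 4 ≤ δ / 2 * Nat.totient k := by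
    rw [div_le_iff₀ hδ] at hk3
    have h1 : 16 * C ^ 2 ≤ δ * x ^ 2 := by nlinarith
    refine le_of_mul_le_mul_left ?_ (show 0 < 2 * C by positivity)
    calc 2 * C * (8 * C * x ^ 4) = 16 * C ^ 2 * x ^ 4 := by ring
      _ ≤ δ * x ^ 2 * x ^ 4 := by gcongr
      _ = δ * x ^ 6 := by ring
      _ ≤ δ * (C * Nat.totient k) := by gcongr
      _ = _ := by ring
  linarith

lemma exp_neg_div_one_sub_le_one_sub {y : ℝ} (h1 : y < 1) :
    Real.exp (-(y / (1 - y))) ≤ 1 - y := by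
  have h0 : 0 < 1 - y := by linarith
  rw [← Real.le_log_iff_exp_le h0]
  refine le_of_eq_of_le ?_ (Real.one_sub_inv_le_log_of_pos h0)
  field_simp
  ring

/-- For every `ε ∈ (0,1/2)` there is `k₀` such that for all `k ≥ k₀`, with
`m_k = ⌊(1-ε)·φ(k)·log φ(k)⌋`: `π_t + 2 ≤ φ(k)` for all `1 ≤ t ≤ m_k`, and
`(1 - ∏_{t=1}^{m_k} (1 - 1/(φ(k) - π_t)))^{φ(k)} ≤ k^{-2}`. -/
theorem coupon_lower_tail :
    ∀ ε : ℝ, 0 < ε → ε < 1 / 2 →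
      ∃ k₀ : ℕ, ∀ k : ℕ, k₀ ≤ k →
        (∀ t : ℕ, t < ⌊(1 - ε) * (Nat.totient k : ℝ) *
            Real.log (Nat.totient k)⌋₊ → pit k t + 2 ≤ Nat.totient k) ∧
        (1 - ∏ t ∈ Finset.range ⌊(1 - ε) * (Nat.totient k : ℝ) *
              Real.log (Nat.totient k)⌋₊,
            (1 - 1 / ((Nat.totient k : ℝ) - (pit k t : ℝ)))) ^ (Nat.totient k) ≤
          (((k : ℝ)) ^ (2 : ℕ))⁻¹ := by
  intro ε hε hε2
  have hlog : Filter.Tendsto (fun k : ℕ => Real.log (k : ℝ)) Filter.atTop Filter.atTop :=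
    Real.tendsto_log_atTop.comp tendsto_natCast_atTop_atTop
  have hlittle : ∀ᶠ k : ℕ in Filter.atTop,
      ‖Real.log (k : ℝ)‖ ≤ 1 / 2 * ‖(k : ℝ) ^ (ε / 4)‖ :=
    tendsto_natCast_atTop_atTop.eventually
      ((isLittleO_log_rpow_atTop (by linarith : 0 < ε / 4)).def (by norm_num : (0 : ℝ) < 1 / 2))
  refine Filter.eventually_atTop.1 ?_
  filter_upwards [eventually_pit_add_one_le (half_pos hε), hlittle,
    hlog.eventually_ge_atTop 16] with k hpit hk2 hk3
  have hk0 : k ≠ 0 := by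
    rintro rfl
    norm_num at hk3
  have hkpos : (0 : ℝ) < k := by exact_mod_cast hk0.bot_lt
  set N : ℝ := (Nat.totient k : ℝ) with hN
  have hNpos : 0 < N := by
    rw [hN]; exact_mod_cast Nat.totient_pos.2 hk0.bot_lt
  set L : ℝ := Real.log N with hL
  have hLk : Real.log k / 2 ≤ L := by
    have h := Real.log_le_log (by positivity) (cube_le_exp_mul_totient_pow k)
    rw [Real.log_mul (by positivity) (by positivity), Real.log_pow, Real.log_pow, Real.log_exp]
      at h
    push_cast at h
    linarith
  have hL0 : 0 < L := by linarith
  have hN2 : 2 ≤ N := by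
    have h := Real.add_one_le_exp L
    rw [hL, Real.exp_log hNpos] at h
    linarith
  refine ⟨fun t _ => ?_, ?_⟩
  · have h : (pit k t : ℝ) + 2 ≤ N := by nlinarith [hpit t]
    rw [hN] at h
    exact_mod_cast h
  set m := ⌊(1 - ε) * N * L⌋₊ with hm
  have hm' : (m : ℝ) ≤ (1 - ε) * N * L :=
    Nat.floor_le (mul_nonneg (mul_nonneg (by linarith) hNpos.le) hL0.le)
  have hD : 0 < (1 - ε / 2) * N := mul_pos (by linarith) hNpos
  have hfactor : ∀ t, Real.exp (-((1 - ε / 2) * N)⁻¹) ≤ 1 - 1 / (N - pit k t) := by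
    intro t
    have h1 : (1 - ε / 2) * N ≤ N - pit k t - 1 := by linarith [hpit t]
    have h2 : 0 < N - pit k t - 1 := hD.trans_le h1
    have h3 : 1 / (N - pit k t) < 1 := by
      rw [div_lt_one (by linarith)]; linarith
    refine le_trans (Real.exp_le_exp.2 (neg_le_neg ?_)) (exp_neg_div_one_sub_le_one_sub h3)
    have h4 : 1 / (N - pit k t) / (1 - 1 / (N - pit k t)) = (N - pit k t - 1)⁻¹ := by
      have h5 : N - pit k t ≠ 0 := by linarith
      have h6 := h2.ne'
      field_simp
    rw [h4]
    gcongr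
  have hfactor1 : ∀ t, 1 - 1 / (N - pit k t) ≤ 1 := by
    intro t
    have h : 0 ≤ 1 / (N - pit k t) := by
      apply one_div_nonneg.2
      nlinarith [hpit t]
    linarith
  set P : ℝ := ∏ t ∈ Finset.range m, (1 - 1 / (N - pit k t)) with hP
  have hP1 : P ≤ 1 :=
    Finset.prod_le_one (fun t _ => (Real.exp_pos _).le.trans (hfactor t)) fun t _ => hfactor1 t
  have hPlow : Real.exp (-((1 - ε / 2) * L)) ≤ P := by
    have h1 : Real.exp (-((1 - ε / 2) * N)⁻¹) ^ m ≤ P := by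
      rw [hP]
      nth_rewrite 1 [← Finset.card_range m]
      rw [← Finset.prod_const]
      exact Finset.prod_le_prod (fun _ _ => (Real.exp_pos _).le) fun t _ => hfactor t
    refine le_trans ?_ h1
    rw [← Real.exp_nat_mul, Real.exp_le_exp, mul_neg, neg_le_neg_iff, ← div_eq_mul_inv,
      div_le_iff₀ hD]
    have h2 : (1 - ε) * (N * L) ≤ (1 - ε / 2) ^ 2 * (N * L) := by
      gcongr
      nlinarith
    linarith
  have hPN : 2 * Real.log k ≤ N * P := by
    have h1 : (k : ℝ) ^ (ε / 4) = Real.exp (Real.log k * (ε / 4)) := Real.rpow_def_of_pos hkpos _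
    rw [Real.norm_of_nonneg (by linarith), Real.norm_of_nonneg (by positivity), h1] at hk2
    have h2 : Real.exp (Real.log k * (ε / 4)) ≤ Real.exp (ε / 2 * L) := by
      apply Real.exp_le_exp.2
      nlinarith
    calc 2 * Real.log k ≤ Real.exp (ε / 2 * L) := by linarith
      _ = N * Real.exp (-((1 - ε / 2) * L)) := by
        have h3 : N = Real.exp L := (Real.exp_log hNpos).symm
        rw [h3, ← Real.exp_add]
        congr 1
        ring
      _ ≤ N * P := by gcongr
  calc (1 - P) ^ Nat.totient k ≤ Real.exp (-P) ^ Nat.totient k := by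
        have h := Real.add_one_le_exp (-P)
        have h1 : 0 ≤ 1 - P := by linarith
        gcongr
        linarith
    _ = Real.exp (-(N * P)) := by rw [← Real.exp_nat_mul, mul_neg]
    _ ≤ Real.exp (-(2 * Real.log k)) := Real.exp_le_exp.2 (neg_le_neg hPN)
    _ = ((k : ℝ) ^ 2)⁻¹ := by
        rw [Real.exp_neg, ← Real.exp_log (pow_pos hkpos 2), Real.log_pow]
        norm_num
end

section
/- There exists an absolute constant c > 0 such that for every real Q ≥ 100 there is a positive integer B* which is either equal to 1 or is a prime with B* ≥ c·log log Q, with the following property: for every modulus q ≤ Q with gcd(q, B*) = 1, every Dirichlet character χ modulo q, and all real σ, t such that L(σ + it, χ) = 0, one has 1 − σ ≥ c/log(Q·(1 + |t|)). -/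
open Complex Metric in
/-- A Borel–Carathéodory bound for the logarithmic derivative of a zero-free function. -/
lemma norm_logDeriv_zero_le_of_norm_le {h : ℂ → ℂ} {R M : ℝ} (hR : 0 < R) (hM : 0 < M)
    (hd : DifferentiableOn ℂ h (ball 0 R)) (h0 : ∀ z ∈ ball (0 : ℂ) R, h z ≠ 0)
    (hb : ∀ z ∈ ball (0 : ℂ) R, ‖h z‖ ≤ Real.exp M * ‖h 0‖) :
    ‖logDeriv h 0‖ ≤ 4 * M / R := by
  have hmem : (0 : ℂ) ∈ ball (0 : ℂ) R := mem_ball_self hR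
  have hd' : DifferentiableOn ℂ (fun z ↦ deriv h z / h z) (ball 0 R) :=
    (hd.deriv isOpen_ball).div hd h0
  obtain ⟨k₀, hk₀⟩ := hd'.isExactOn_ball
  set k : ℂ → ℂ := fun z ↦ k₀ z - k₀ 0 with hk
  have hkd : ∀ z ∈ ball (0 : ℂ) R, HasDerivAt k (deriv h z / h z) z := fun z hz ↦
    (hk₀ z hz).sub_const _
  have hk0 : k 0 = 0 := by simp [hk]
  have hconst : ∀ z ∈ ball (0 : ℂ) R, h z * exp (-k z) = h 0 := by
    intro z hz
    have key : ∀ w ∈ ball (0 : ℂ) R, HasDerivAt (fun z ↦ h z * exp (-k z)) 0 w := by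
      intro w hw
      have h1 := ((hd w hw).differentiableAt (isOpen_ball.mem_nhds hw)).hasDerivAt
      have h2 := (hkd w hw).neg.cexp
      refine (h1.mul h2).congr_deriv ?_
      have := h0 w hw
      field_simp
      ring
    have := (convex_ball (0 : ℂ) R).is_const_of_fderivWithin_eq_zero (𝕜 := ℂ)
      (fun w hw ↦ (key w hw).differentiableAt.differentiableWithinAt)
      (fun w hw ↦ by
        rw [fderivWithin_of_isOpen isOpen_ball hw]
        simpa using (key w hw).hasFDerivAt.fderiv) hz hmem
    simpa [hk0] using this
  have hkre : Set.MapsTo k (ball 0 R) {z | z.re ≤ M} := by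
    intro z hz
    have h1 := hconst z hz
    have h2 : h z = h 0 * exp (k z) := by
      rw [← h1, mul_assoc, ← Complex.exp_add]; simp
    have h3 := hb z hz
    rw [h2, norm_mul, Complex.norm_exp, mul_comm] at h3
    have h4 := le_of_mul_le_mul_right h3 (norm_pos_iff.2 (h0 0 hmem))
    simpa using h4
  have hkD : DifferentiableOn ℂ k (ball 0 R) := fun z hz ↦
    (hkd z hz).differentiableAt.differentiableWithinAt
  have hsub : ball (0 : ℂ) (R / 2) ⊆ ball 0 R := ball_subset_ball (by linarith)
  have hmaps : Set.MapsTo k (ball 0 (R / 2)) (closedBall (k 0) (2 * M)) := by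
    intro z hz
    have h1 := borelCaratheodory_zero hM hkD hkre hR (hsub hz) hk0
    rw [mem_ball_zero_iff] at hz
    rw [hk0, mem_closedBall_zero_iff]
    refine h1.trans ?_
    rw [div_le_iff₀ (by linarith)]
    nlinarith [norm_nonneg z]
  have h5 := norm_deriv_le_div_of_mapsTo_ball (hkD.mono hsub) hmaps (by positivity)
  rw [(hkd 0 hmem).deriv] at h5
  rw [logDeriv_apply]
  refine h5.trans (le_of_eq ?_)
  field_simp
  norm_num

/-- An entire function not vanishing at the origin has only finitely many zeros, with multiplicity,
in a closed disc, and they can be divided out. -/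
lemma exists_eq_prod_sub_mul_of_differentiable {f : ℂ → ℂ} {R : ℝ} (hR : 0 < R)
    (hf : Differentiable ℂ f) (hf0 : f 0 ≠ 0) :
    ∃ (n : ℕ) (ρ : Fin n → ℂ) (g : ℂ → ℂ), Differentiable ℂ g ∧ (∀ i, ‖ρ i‖ ≤ R) ∧
      (∀ z, ‖z‖ ≤ R → g z ≠ 0) ∧ ∀ z, f z = (∏ i, (z - ρ i)) * g z := by
  set P : ℕ → Prop := fun n ↦ ∃ (ρ : Fin n → ℂ) (g : ℂ → ℂ), Differentiable ℂ g ∧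
    (∀ i, ‖ρ i‖ ≤ R) ∧ ∀ z, f z = (∏ i, (z - ρ i)) * g z with hP
  have hP0 : P 0 := ⟨Fin.elim0, f, hf, fun i ↦ i.elim0, fun z ↦ by simp⟩
  obtain ⟨C, hC⟩ := (isCompact_closedBall (0 : ℂ) (3 * R)).exists_bound_of_continuousOn
    hf.continuous.continuousOn
  have hbd : ∀ n, P n → ‖f 0‖ * 2 ^ n ≤ C := by
    rintro n ⟨ρ, g, hg, hρ, hfg⟩
    have h1 : ∀ z ∈ Metric.sphere (0 : ℂ) (3 * R), ‖g z‖ ≤ C / (2 * R) ^ n := by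
      intro z hz
      have hz' : ‖z‖ = 3 * R := by simpa using hz
      rw [le_div_iff₀ (by positivity)]
      refine le_trans ?_ (hC z (Metric.sphere_subset_closedBall hz))
      rw [hfg, norm_mul, norm_prod, mul_comm]
      gcongr
      calc (2 * R) ^ n = ∏ _i : Fin n, (2 * R) := by simp
        _ ≤ _ := by
          apply Finset.prod_le_prod (fun _ _ ↦ by positivity)
          intro i _
          have := norm_sub_norm_le z (ρ i)
          linarith [hρ i]
    have h2 : ‖g 0‖ ≤ C / (2 * R) ^ n := by
      refine Complex.norm_le_of_forall_mem_frontier_norm_le (U := Metric.ball 0 (3 * R))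
        Metric.isBounded_ball hg.diffContOnCl ?_ ?_
      · intro z hz
        rw [frontier_ball _ (by positivity)] at hz
        exact h1 z hz
      · exact subset_closure (Metric.mem_ball_self (by positivity))
    rw [le_div_iff₀ (by positivity)] at h2
    rw [hfg, norm_mul, norm_prod]
    calc (∏ i, ‖0 - ρ i‖) * ‖g 0‖ * 2 ^ n ≤ (∏ _i : Fin n, R) * ‖g 0‖ * 2 ^ n := by
          gcongr with i
          simpa using hρ i
      _ = ‖g 0‖ * (2 * R) ^ n := by simp [mul_pow]; ring
      _ ≤ C := h2
  obtain ⟨N, hN⟩ : ∃ N : ℕ, ∀ n, P n → n ≤ N := by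
    obtain ⟨N, hN⟩ := pow_unbounded_of_one_lt (C / ‖f 0‖) (one_lt_two (α := ℝ))
    refine ⟨N, fun n hn ↦ ?_⟩
    by_contra! hlt
    have h1 := hbd n hn
    rw [div_lt_iff₀ (norm_pos_iff.2 hf0)] at hN
    have h2 : (2 : ℝ) ^ N ≤ 2 ^ n := pow_le_pow_right₀ (by norm_num) hlt.le
    nlinarith [norm_pos_iff.2 hf0]
  classical
  have hmax := Nat.findGreatest_spec (P := P) (Nat.zero_le N) hP0
  set m := Nat.findGreatest P N with hm
  obtain ⟨ρ, g, hg, hρ, hfg⟩ := hmax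
  refine ⟨m, ρ, g, hg, hρ, fun z hz hgz ↦ ?_, hfg⟩
  have hP1 : P (m + 1) := by
    refine ⟨Fin.cons z ρ, dslope g z, ?_, ?_, ?_⟩
    · rw [← differentiableOn_univ]
      exact (Complex.differentiableOn_dslope Filter.univ_mem).2 hg.differentiableOn
    · intro i
      refine Fin.cases ?_ (fun j ↦ ?_) i
      · simpa using hz
      · simpa using hρ j
    · intro w
      have := sub_smul_dslope g z w
      rw [hgz, sub_zero, smul_eq_mul] at this
      rw [Fin.prod_univ_succ, hfg w, ← this]
      simp only [Fin.cons_zero, Fin.cons_succ]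
      ring
  have h1 := hN _ hP1
  have h2 := Nat.le_findGreatest h1 hP1
  omega

open Complex Metric ComplexConjugate in
/-- Landau's local lemma: a lower bound for the real part of the logarithmic derivative at the
centre of a disc all of whose zeros lie in the left half. -/
lemma sum_re_sub_le_re_logDeriv {f : ℂ → ℂ} {R M : ℝ} (hR : 0 < R) (hM : 0 < M)
    (hf : Differentiable ℂ f) (hf0 : f 0 ≠ 0)
    (hb : ∀ z, ‖z‖ ≤ R → ‖f z‖ ≤ Real.exp M * ‖f 0‖)
    (hre : ∀ z, ‖z‖ ≤ R → f z = 0 → z.re ≤ 0) (Z : Finset ℂ)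
    (hZ : ∀ z ∈ Z, ‖z‖ ≤ R ∧ f z = 0) :
    ∑ z ∈ Z, (-(1 / z) + conj z / (R : ℂ) ^ 2).re - 4 * M / R ≤ (logDeriv f 0).re := by
  obtain ⟨n, ρ, g, hg, hρ, hg0, hfg⟩ := exists_eq_prod_sub_mul_of_differentiable hR hf hf0
  have hρ0 : ∀ i, ρ i ≠ 0 := by
    intro i hi
    apply hf0
    rw [hfg, Finset.prod_eq_zero (Finset.mem_univ i) (by simp [hi]), zero_mul]
  have hρf : ∀ i, f (ρ i) = 0 := by
    intro i
    rw [hfg, Finset.prod_eq_zero (Finset.mem_univ i) (by simp), zero_mul]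
  have hRc : (R : ℂ) ≠ 0 := by exact_mod_cast hR.ne'
  set B : Fin n → ℂ → ℂ := fun i z ↦ ((R : ℂ) ^ 2 - conj (ρ i) * z) / R with hB
  set h : ℂ → ℂ := fun z ↦ (∏ i, B i z) * g z with hh
  have hBd : ∀ i, Differentiable ℂ (B i) := fun i ↦ by simp only [hB]; fun_prop
  have hhd : Differentiable ℂ h := by
    simp only [hh]
    exact (Differentiable.fun_finsetProd fun i _ ↦ hBd i).mul hg
  have hB0 : ∀ i, ∀ z ∈ ball (0 : ℂ) R, B i z ≠ 0 := by
    intro i z hz h0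
    rw [mem_ball_zero_iff] at hz
    simp only [hB, div_eq_zero_iff, hRc, or_false, sub_eq_zero] at h0
    have h1 := congrArg norm h0
    rw [norm_mul, norm_pow, RCLike.norm_conj, Complex.norm_real, Real.norm_of_nonneg hR.le] at h1
    nlinarith [hρ i, norm_nonneg z, norm_nonneg (ρ i)]
  have hsph : ∀ i, ∀ z, ‖z‖ = R → ‖B i z‖ = ‖z - ρ i‖ := by
    intro i z hz
    have h1 : (R : ℂ) ^ 2 = z * conj z := by
      rw [Complex.mul_conj, Complex.normSq_eq_norm_sq, hz]; push_cast; rfl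
    simp only [hB]
    rw [h1, mul_comm (conj (ρ i)), ← mul_sub, ← map_sub, norm_div, norm_mul, RCLike.norm_conj, hz,
      Complex.norm_real, Real.norm_of_nonneg hR.le]
    field_simp
  have hh0 : ‖f 0‖ ≤ ‖h 0‖ := by
    rw [hfg, norm_mul, norm_prod]
    simp only [hh, norm_mul, norm_prod]
    gcongr with i
    simp only [hB, mul_zero, sub_zero, zero_sub, norm_neg]
    rw [pow_two, mul_div_cancel_right₀ _ hRc, Complex.norm_real, Real.norm_of_nonneg hR.le]
    exact hρ i
  have hhb : ∀ z ∈ ball (0 : ℂ) R, ‖h z‖ ≤ Real.exp M * ‖h 0‖ := by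
    intro z hz
    refine norm_le_of_forall_mem_frontier_norm_le (U := ball 0 R) isBounded_ball
      hhd.diffContOnCl (fun w hw ↦ ?_) (subset_closure hz)
    rw [frontier_ball _ hR.ne', mem_sphere_zero_iff_norm] at hw
    have h1 : ‖h w‖ = ‖f w‖ := by
      rw [hfg]
      simp only [hh, norm_mul, norm_prod]
      congr 1
      exact Finset.prod_congr rfl fun i _ ↦ hsph i w hw
    rw [h1]
    exact (hb w hw.le).trans (by gcongr)
  have hmem : (0 : ℂ) ∈ ball (0 : ℂ) R := mem_ball_self hR
  have key := norm_logDeriv_zero_le_of_norm_le hR hM hhd.differentiableOn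
    (fun z hz ↦ mul_ne_zero (Finset.prod_ne_zero_iff.2 fun i _ ↦ hB0 i z hz)
      (hg0 z (mem_ball_zero_iff.1 hz).le)) hhb
  have hlh : logDeriv h 0 = (∑ i, (-(conj (ρ i)) / (R : ℂ) ^ 2)) + logDeriv g 0 := by
    simp only [hh]
    rw [logDeriv_mul 0 (Finset.prod_ne_zero_iff.2 fun i _ ↦ hB0 i 0 hmem) (hg0 0 (by simp [hR.le]))
      (Differentiable.fun_finsetProd fun i _ ↦ hBd i).differentiableAt hg.differentiableAt,
      logDeriv_prod (fun i _ ↦ hB0 i 0 hmem) (fun i _ ↦ (hBd i).differentiableAt)]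
    congr 1
    refine Finset.sum_congr rfl fun i _ ↦ ?_
    have h1 : HasDerivAt (B i) (-(conj (ρ i)) / R) 0 := by
      have := (((hasDerivAt_id (0 : ℂ)).const_mul (conj (ρ i))).const_sub ((R : ℂ) ^ 2)).div_const
        (R : ℂ)
      simpa [hB] using this
    rw [logDeriv_apply, h1.deriv]
    simp only [hB, mul_zero, sub_zero]
    field_simp
  have hlf : logDeriv f 0 = (∑ i, -(1 / ρ i)) + logDeriv g 0 := by
    have h0 : f = fun z ↦ (∏ i, (z - ρ i)) * g z := funext hfg
    rw [h0, logDeriv_mul 0 (Finset.prod_ne_zero_iff.2 fun i _ ↦ by simpa using hρ0 i)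
      (hg0 0 (by simp [hR.le]))
      (Differentiable.fun_finsetProd fun i _ ↦ by fun_prop).differentiableAt hg.differentiableAt,
      logDeriv_prod (fun i _ ↦ by simpa using hρ0 i) (fun i _ ↦ by fun_prop)]
    congr 1
    refine Finset.sum_congr rfl fun i _ ↦ ?_
    rw [logDeriv_apply]
    simp [← inv_neg]
  have hdiff : logDeriv f 0 = logDeriv h 0 + ∑ i, (-(1 / ρ i) + conj (ρ i) / (R : ℂ) ^ 2) := by
    rw [hlh, hlf, Finset.sum_add_distrib]
    simp only [neg_div, Finset.sum_neg_distrib]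
    ring
  have hnn : ∀ i, 0 ≤ (-(1 / ρ i) + conj (ρ i) / (R : ℂ) ^ 2).re := by
    intro i
    have h1 : (-(1 / ρ i) + conj (ρ i) / (R : ℂ) ^ 2).re
        = -(ρ i).re * (1 / ‖ρ i‖ ^ 2 - 1 / R ^ 2) := by
      rw [show (R : ℂ) ^ 2 = ((R ^ 2 : ℝ) : ℂ) by push_cast; rfl, add_re, div_ofReal_re, neg_re,
        one_div, inv_re, Complex.normSq_eq_norm_sq, conj_re]
      ring
    rw [h1]
    have h2 := norm_pos_iff.2 (hρ0 i)
    have h3 : 1 / R ^ 2 ≤ 1 / ‖ρ i‖ ^ 2 := by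
      gcongr
      exact hρ i
    exact mul_nonneg (neg_nonneg.2 (hre _ (hρ i) (hρf i))) (by linarith)
  have hsum : ∑ z ∈ Z, (-(1 / z) + conj z / (R : ℂ) ^ 2).re
      ≤ ∑ i, (-(1 / ρ i) + conj (ρ i) / (R : ℂ) ^ 2).re := by
    have hex : ∀ z ∈ Z, ∃ i, ρ i = z := by
      intro z hz
      obtain ⟨h1, h2⟩ := hZ z hz
      rw [hfg, mul_eq_zero, or_iff_left (hg0 z h1), Finset.prod_eq_zero_iff] at h2
      obtain ⟨i, -, hi⟩ := h2
      exact ⟨i, (sub_eq_zero.1 hi).symm⟩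
    rcases Z.eq_empty_or_nonempty with rfl | ⟨z₀, hz₀⟩
    · simpa using Finset.sum_nonneg fun i _ ↦ hnn i
    have : Nonempty (Fin n) := ⟨(hex z₀ hz₀).choose⟩
    choose! e he using hex
    classical
    have hinj : Set.InjOn e Z := fun a ha b hb hab ↦ by rw [← he a ha, ← he b hb, hab]
    calc ∑ z ∈ Z, (-(1 / z) + conj z / (R : ℂ) ^ 2).re
        = ∑ i ∈ Z.image e, (-(1 / ρ i) + conj (ρ i) / (R : ℂ) ^ 2).re := by
          rw [Finset.sum_image hinj]
          exact Finset.sum_congr rfl fun z hz ↦ by rw [he z hz]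
      _ ≤ ∑ i, (-(1 / ρ i) + conj (ρ i) / (R : ℂ) ^ 2).re :=
          Finset.sum_le_sum_of_subset_of_nonneg (Finset.subset_univ _) fun i _ _ ↦ hnn i
  have hre' := (abs_re_le_norm (logDeriv h 0)).trans key
  rw [hdiff, add_re, re_sum]
  linarith [neg_abs_le (logDeriv h 0).re]

section

open Complex MeasureTheory Set Filter Topology Asymptotics

namespace DirichletCharacter

lemma sum_range_cast_succ {q : ℕ} [NeZero q] (f : ZMod q → ℂ) :
    ∑ k ∈ Finset.range q, f ((k + 1 : ℕ) : ZMod q) = ∑ a, f a := by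
  classical
  have hinj : Set.InjOn (fun k : ℕ ↦ ((k + 1 : ℕ) : ZMod q)) (Finset.range q) := by
    intro a ha b hb hab
    simp only [Finset.coe_range, Set.mem_Iio] at ha hb
    have h1 : ((a : ℕ) : ZMod q) = b := by simpa using hab
    rw [ZMod.natCast_eq_natCast_iff', Nat.mod_eq_of_lt ha, Nat.mod_eq_of_lt hb] at h1
    exact h1
  rw [← Finset.sum_image (f := f) hinj, Finset.eq_univ_of_card (Finset.image _ _)]
  rw [Finset.card_image_of_injOn hinj, Finset.card_range, ZMod.card]

/-- The mean value of a Dirichlet character. -/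
noncomputable def meanValue {q : ℕ} [NeZero q] (χ : DirichletCharacter ℂ q) : ℂ :=
  (∑ a, χ a) / q

lemma meanValue_of_ne_one {q : ℕ} [NeZero q] {χ : DirichletCharacter ℂ q} (hχ : χ ≠ 1) :
    χ.meanValue = 0 := by
  rw [meanValue, MulChar.sum_eq_zero_of_ne_one hχ, zero_div]

lemma norm_meanValue_le_one {q : ℕ} [NeZero q] (χ : DirichletCharacter ℂ q) :
    ‖χ.meanValue‖ ≤ 1 := by
  have hq : (0 : ℝ) < q := by exact_mod_cast Nat.pos_of_neZero q
  rw [meanValue, norm_div, Complex.norm_natCast, div_le_one hq]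
  refine (norm_sum_le _ _).trans ?_
  calc ∑ a, ‖χ a‖ ≤ ∑ _a : ZMod q, (1 : ℝ) := Finset.sum_le_sum fun a _ ↦ χ.norm_le_one a
    _ = q := by simp [ZMod.card]

/-- The error term in the summatory function of a Dirichlet character. -/
noncomputable def sumError {q : ℕ} [NeZero q] (χ : DirichletCharacter ℂ q) (x : ℝ) : ℂ :=
  ∑ k ∈ Finset.Icc 1 ⌊x⌋₊, χ k - χ.meanValue * x

lemma norm_sumError_le {q : ℕ} [NeZero q] (χ : DirichletCharacter ℂ q) {x : ℝ} (hx : 0 ≤ x) :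
    ‖χ.sumError x‖ ≤ 2 * q - 1 := by
  set T : ℕ → ℂ := fun N ↦ ∑ k ∈ Finset.range N, (χ ((k + 1 : ℕ) : ZMod q) - χ.meanValue) with hT
  have hq : (q : ℂ) ≠ 0 := by exact_mod_cast NeZero.ne q
  have hTq : T q = 0 := by
    simp only [hT, Finset.sum_sub_distrib, sum_range_cast_succ, Finset.sum_const,
      Finset.card_range, nsmul_eq_mul, meanValue]
    field_simp
    ring
  have hper : Function.Periodic T q := by
    intro N
    have : T (N + q) = T q + T N := by
      simp only [hT]
      rw [add_comm N q, Finset.sum_range_add]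
      congr 1
      refine Finset.sum_congr rfl fun k _ ↦ ?_
      congr 2
      push_cast
      simp
    rw [this, hTq, zero_add]
  have hTb : ∀ N, ‖T N‖ ≤ 2 * q - 2 := by
    intro N
    rw [← hper.map_mod_nat]
    have h1 : N % q + 1 ≤ q := Nat.mod_lt _ (Nat.pos_of_neZero q)
    have h1' : ((N % q : ℕ) : ℝ) + 1 ≤ q := by exact_mod_cast h1
    refine (norm_sum_le _ _).trans ?_
    calc _ ≤ ∑ _k ∈ Finset.range (N % q), (2 : ℝ) := by
          refine Finset.sum_le_sum fun k _ ↦ (norm_sub_le _ _).trans ?_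
          linarith [χ.norm_le_one ((k + 1 : ℕ) : ZMod q), χ.norm_meanValue_le_one]
      _ ≤ 2 * q - 2 := by
        rw [Finset.sum_const, Finset.card_range, nsmul_eq_mul]
        linarith
  have h2 : χ.sumError x = T ⌊x⌋₊ - χ.meanValue * ((x - ⌊x⌋₊ : ℝ) : ℂ) := by
    simp only [sumError, hT, Finset.sum_sub_distrib, Finset.sum_const, Finset.card_range,
      nsmul_eq_mul]
    rw [Finset.range_eq_Ico, Finset.sum_Ico_add' (fun k : ℕ ↦ χ (k : ZMod q))]
    push_cast
    rw [show Finset.Icc 1 ⌊x⌋₊ = Finset.Ico (0 + 1) (⌊x⌋₊ + 1) by ext; simp]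
    ring
  rw [h2]
  refine (norm_sub_le _ _).trans ?_
  have h3 : ‖χ.meanValue * ((x - ⌊x⌋₊ : ℝ) : ℂ)‖ ≤ 1 := by
    rw [norm_mul, Complex.norm_real, Real.norm_of_nonneg (by linarith [Nat.floor_le hx])]
    have := (Nat.lt_floor_add_one x).le
    exact mul_le_one₀ χ.norm_meanValue_le_one (by linarith [Nat.floor_le hx]) (by linarith)
  linarith [hTb ⌊x⌋₊]

lemma measurable_sumError {q : ℕ} [NeZero q] (χ : DirichletCharacter ℂ q) :
    Measurable χ.sumError := by
  have h1 : Measurable fun x : ℝ ↦ ∑ k ∈ Finset.Icc 1 ⌊x⌋₊, χ k :=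
    (measurable_from_nat (f := fun n : ℕ ↦ ∑ k ∈ Finset.Icc 1 n, χ k)).comp Nat.measurable_floor
  exact h1.sub (by fun_prop)

/-- The Mellin-type transform `∫ x in (1, ∞), E(x) x ^ (-s-1)` of the error term in the summatory
function of a Dirichlet character. -/
noncomputable def errorIntegral {q : ℕ} [NeZero q] (χ : DirichletCharacter ℂ q) (s : ℂ) : ℂ :=
  ∫ t in Ioi (1 : ℝ), (t : ℂ) ^ (-s - 1) * χ.sumError t

lemma errorIntegral_eq_mellin {q : ℕ} [NeZero q] (χ : DirichletCharacter ℂ q) (s : ℂ) :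
    χ.errorIntegral s = mellin (indicator (Ioi 1) χ.sumError) (-s) := by
  rw [errorIntegral, mellin, ← integral_indicator measurableSet_Ioi,
    ← integral_indicator measurableSet_Ioi]
  congr 1
  ext t
  by_cases ht : t ∈ Ioi (1 : ℝ)
  · have : t ∈ Ioi (0 : ℝ) := lt_trans zero_lt_one (mem_Ioi.1 ht)
    simp [indicator_of_mem ht, indicator_of_mem this]
  · rw [indicator_of_notMem ht]
    by_cases ht0 : t ∈ Ioi (0 : ℝ)
    · rw [indicator_of_mem ht0, indicator_of_notMem ht, smul_zero]
    · rw [indicator_of_notMem ht0]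

lemma differentiableAt_errorIntegral {q : ℕ} [NeZero q] (χ : DirichletCharacter ℂ q) {s : ℂ}
    (hs : 0 < s.re) : DifferentiableAt ℂ χ.errorIntegral s := by
  have h1 : DifferentiableAt ℂ (mellin (indicator (Ioi 1) χ.sumError)) (-s) := by
    refine mellin_differentiableAt_of_isBigO_rpow (a := 0) (b := (-s).re - 1) ?_ ?_ (by simpa) ?_
      (by linarith)
    · refine LocallyIntegrable.locallyIntegrableOn ?_ _
      refine (locallyIntegrable_const (2 * (q : ℝ) - 1)).mono
        (χ.measurable_sumError.indicator measurableSet_Ioi).aestronglyMeasurable ?_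
      refine Eventually.of_forall fun x ↦ ?_
      by_cases hx : x ∈ Ioi (1 : ℝ)
      · rw [indicator_of_mem hx]
        exact (χ.norm_sumError_le (zero_le_one.trans (le_of_lt hx))).trans (Real.le_norm_self _)
      · rw [indicator_of_notMem hx]; simp
    · refine IsBigO.of_bound (2 * (q : ℝ) - 1) ?_
      filter_upwards [eventually_gt_atTop 1] with x hx
      rw [indicator_of_mem (by exact hx)]
      simpa using χ.norm_sumError_le (zero_le_one.trans (le_of_lt hx))
    · refine EventuallyEq.trans_isBigO (f₂ := fun _ ↦ (0 : ℂ)) ?_ (isBigO_zero _ _)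
      have : Iio (1 : ℝ) ∈ 𝓝[>] (0 : ℝ) := mem_nhdsWithin_of_mem_nhds (Iio_mem_nhds one_pos)
      filter_upwards [this] with x hx
      exact indicator_of_notMem (by simpa using le_of_lt hx) _
  have h2 : χ.errorIntegral = fun s ↦ mellin (indicator (Ioi 1) χ.sumError) (-s) :=
    funext χ.errorIntegral_eq_mellin
  rw [h2]
  exact h1.comp s differentiableAt_id.neg

lemma integrableOn_errorIntegral {q : ℕ} [NeZero q] (χ : DirichletCharacter ℂ q) {s : ℂ}
    (hs : 0 < s.re) :
    IntegrableOn (fun t : ℝ ↦ (t : ℂ) ^ (-s - 1) * χ.sumError t) (Ioi 1) := by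
  have h1 := (integrableOn_Ioi_cpow_of_lt (a := -s - 1) (by simp; linarith) one_pos)
  refine Integrable.mul_bdd (c := 2 * q - 1) h1 χ.measurable_sumError.aestronglyMeasurable ?_
  filter_upwards [ae_restrict_mem measurableSet_Ioi] with x hx
  exact χ.norm_sumError_le (zero_le_one.trans (le_of_lt hx))

lemma norm_errorIntegral_le {q : ℕ} [NeZero q] (χ : DirichletCharacter ℂ q) {s : ℂ}
    (hs : 0 < s.re) : ‖χ.errorIntegral s‖ ≤ (2 * q - 1) / s.re := by
  have h1 := integral_Ioi_rpow_of_lt (a := -s.re - 1) (by linarith) one_pos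
  have h2 := integrableOn_Ioi_rpow_of_lt (a := -s.re - 1) (by linarith) one_pos
  have h3 : ∀ᵐ t : ℝ ∂(volume.restrict (Ioi (1 : ℝ))),
      ‖(t : ℂ) ^ (-s - 1) * χ.sumError t‖ ≤ t ^ (-s.re - 1) * (2 * q - 1) := by
    filter_upwards [ae_restrict_mem measurableSet_Ioi] with x hx
    have hx0 : (0 : ℝ) < x := lt_trans zero_lt_one hx
    rw [norm_mul, Complex.norm_cpow_eq_rpow_re_of_pos hx0]
    simp only [sub_re, neg_re, one_re]
    exact mul_le_mul_of_nonneg_left (χ.norm_sumError_le hx0.le) (by positivity)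
  refine (norm_integral_le_of_norm_le (h2.mul_const _) h3).trans (le_of_eq ?_)
  rw [integral_mul_const, h1, Real.one_rpow, sub_add_cancel, neg_div_neg_eq]
  ring

lemma LFunction_eq_add_errorIntegral {q : ℕ} [NeZero q] (χ : DirichletCharacter ℂ q) {s : ℂ}
    (hs : 1 < s.re) :
    χ.LFunction s = χ.meanValue * s / (s - 1) + s * χ.errorIntegral s := by
  have hs0 : s - 1 ≠ 0 := fun h ↦ by
    rw [sub_eq_zero] at h
    simp [h] at hs
  rw [LFunction_eq_LSeries χ hs, LSeries_eq_mul_integral' _ zero_le_one hs]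
  · have h1 : ∫ t in Ioi (1 : ℝ), (∑ k ∈ Finset.Icc 1 ⌊t⌋₊, χ k) * (t : ℂ) ^ (-(s + 1))
        = ∫ t in Ioi (1 : ℝ), ((t : ℂ) ^ (-s - 1) * χ.sumError t
            + χ.meanValue * (t : ℂ) ^ (-s)) := by
      refine setIntegral_congr_fun measurableSet_Ioi fun t ht ↦ ?_
      have ht0 : (t : ℂ) ≠ 0 := by exact_mod_cast (lt_trans zero_lt_one ht).ne'
      have h2 : (t : ℂ) ^ (-s) = (t : ℂ) ^ (-s - 1) * t := by
        rw [cpow_sub _ _ ht0, cpow_one, div_mul_cancel₀ _ ht0]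
      simp only [sumError]
      rw [h2, show -(s + 1) = -s - 1 by ring]
      ring
    rw [h1, integral_add (χ.integrableOn_errorIntegral (by linarith))
      ((integrableOn_Ioi_cpow_of_lt (by simpa) one_pos).const_mul _), integral_const_mul,
      integral_Ioi_cpow_of_lt (by simpa) one_pos, ← errorIntegral]
    have h3 : -s + 1 ≠ 0 := fun h ↦ hs0 (by linear_combination -h)
    simp only [ofReal_one, one_cpow]
    rw [show -s + 1 = -(s - 1) by ring]
    field_simp
    ring
  · refine IsBigO.of_bound 1 (Eventually.of_forall fun n ↦ ?_)
    rw [Real.rpow_one, one_mul, Real.norm_of_nonneg (by positivity), Real.norm_of_nonneg (by simp)]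
    calc ∑ k ∈ Finset.Icc 1 n, ‖χ k‖ ≤ ∑ k ∈ Finset.Icc 1 n, (1 : ℝ) :=
        Finset.sum_le_sum fun a _ ↦ χ.norm_le_one a
      _ = n := by simp

/-- Continuation of the integral representation to the half-plane `0 < re s`. -/
lemma eq_add_errorIntegral_of_differentiable {q : ℕ} [NeZero q] (χ : DirichletCharacter ℂ q)
    {F : ℂ → ℂ} (hF : Differentiable ℂ F)
    (h : ∀ s : ℂ, 1 < s.re → F s = (s - 1) * χ.LFunction s) {s : ℂ} (hs : 0 < s.re) :
    F s = χ.meanValue * s + s * (s - 1) * χ.errorIntegral s := by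
  have hopen : IsOpen {z : ℂ | 0 < z.re} := isOpen_lt continuous_const continuous_re
  have hG : DifferentiableOn ℂ
      (fun s ↦ χ.meanValue * s + s * (s - 1) * χ.errorIntegral s) {z | 0 < z.re} := by
    intro z hz
    have := χ.differentiableAt_errorIntegral hz
    exact DifferentiableAt.differentiableWithinAt (by fun_prop)
  refine (hF.differentiableOn.analyticOnNhd hopen).eqOn_of_preconnected_of_eventuallyEq
    (hG.analyticOnNhd hopen) (convex_halfSpace_re_gt 0).isPreconnected (z₀ := 2) (by simp) ?_ hs
  have : {z : ℂ | 1 < z.re} ∈ 𝓝 (2 : ℂ) :=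
    (isOpen_lt continuous_const continuous_re).mem_nhds (by simp)
  filter_upwards [this] with z hz
  have hs0 : z - 1 ≠ 0 := fun h ↦ by
    rw [sub_eq_zero] at h
    simp [h] at hz
  rw [h z hz, χ.LFunction_eq_add_errorIntegral hz]
  field_simp

lemma norm_LFunction_le {q : ℕ} [NeZero q] {χ : DirichletCharacter ℂ q} (hχ : χ ≠ 1) {s : ℂ}
    (hs : 0 < s.re) : ‖χ.LFunction s‖ ≤ ‖s‖ * ((2 * q - 1) / s.re) := by
  have h1 : ∀ z : ℂ, 0 < z.re → z ≠ 1 → χ.LFunction z = z * χ.errorIntegral z := by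
    intro z hz hz1
    have h2 := χ.eq_add_errorIntegral_of_differentiable (F := fun s ↦ (s - 1) * χ.LFunction s)
      ((differentiable_id.sub_const 1).mul (differentiable_LFunction hχ)) (fun _ _ ↦ rfl) hz
    rw [meanValue_of_ne_one hχ] at h2
    exact mul_left_cancel₀ (sub_ne_zero.2 hz1) (by rw [h2]; ring)
  have h2 : χ.LFunction s = s * χ.errorIntegral s := by
    by_cases hs1 : s = 1
    · subst hs1
      have h3 : ContinuousAt χ.LFunction 1 := (differentiable_LFunction hχ).continuous.continuousAt
      have h4 : ContinuousAt (fun s ↦ s * χ.errorIntegral s) 1 :=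
        continuousAt_id.mul (χ.differentiableAt_errorIntegral (by simp)).continuousAt
      refine tendsto_nhds_unique (h3.tendsto.mono_left (nhdsWithin_le_nhds (s := {1}ᶜ)))
        ((h4.tendsto.mono_left nhdsWithin_le_nhds).congr' ?_)
      have : {z : ℂ | 0 < z.re} ∈ 𝓝 (1 : ℂ) :=
        (isOpen_lt continuous_const continuous_re).mem_nhds (by simp)
      filter_upwards [self_mem_nhdsWithin, mem_nhdsWithin_of_mem_nhds this] with z hz1 hz
      exact (h1 z hz hz1).symm
    · exact h1 s hs hs1
  rw [h2, norm_mul]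
  exact mul_le_mul_of_nonneg_left (χ.norm_errorIntegral_le hs) (norm_nonneg _)

lemma LFunctionTrivChar₁_eq {q : ℕ} [NeZero q] {s : ℂ} (hs : 0 < s.re) :
    LFunctionTrivChar₁ q s = (1 : DirichletCharacter ℂ q).meanValue * s
      + s * (s - 1) * (1 : DirichletCharacter ℂ q).errorIntegral s := by
  refine eq_add_errorIntegral_of_differentiable _ (differentiable_LFunctionTrivChar₁ q)
    (fun z hz ↦ ?_) hs
  have hz1 : z ≠ 1 := fun h ↦ by simp [h] at hz
  rw [LFunctionTrivChar₁, Function.update_of_ne hz1]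

lemma norm_LFunctionTrivChar₁_le {q : ℕ} [NeZero q] {s : ℂ} (hs : 0 < s.re) :
    ‖LFunctionTrivChar₁ q s‖ ≤ ‖s‖ * (1 + ‖s - 1‖ * ((2 * q - 1) / s.re)) := by
  rw [LFunctionTrivChar₁_eq hs, mul_comm _ s, mul_assoc, ← mul_add, norm_mul]
  gcongr
  refine (norm_add_le _ _).trans <| add_le_add (norm_meanValue_le_one _) ?_
  rw [norm_mul]
  gcongr
  exact norm_errorIntegral_le _ hs

end DirichletCharacter

/-- The Riemann zeta function has no zeros near its pole. -/
lemma riemannZeta_ne_zero_of_norm_sub_one_lt {s : ℂ} (hs : ‖s - 1‖ < 1 / 2) :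
    riemannZeta s ≠ 0 := by
  rcases eq_or_ne s 1 with rfl | hs1
  · exact riemannZeta_one_ne_zero
  have hre : 1 / 2 < s.re := by
    have := (abs_le.1 ((abs_re_le_norm (s - 1)).trans hs.le)).1
    have h2 := (abs_lt.1 ((abs_re_le_norm (s - 1)).trans_lt hs)).1
    simp at h2
    linarith
  have h1 := DirichletCharacter.LFunctionTrivChar₁_eq (q := 1) (s := s) (by linarith)
  have hm : (1 : DirichletCharacter ℂ 1).meanValue = 1 := by
    rw [DirichletCharacter.meanValue, Fintype.sum_subsingleton _ (1 : ZMod 1), map_one]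
    simp
  intro h0
  rw [DirichletCharacter.LFunctionTrivChar₁, Function.update_of_ne hs1, hm, one_mul,
    DirichletCharacter.LFunctionTrivChar, DirichletCharacter.LFunction_modOne_eq, h0,
    mul_zero] at h1
  have hs0 : s ≠ 0 := fun h ↦ by simp [h] at hre; linarith
  have h2 : (s - 1) * (1 : DirichletCharacter ℂ 1).errorIntegral s = -1 := by
    apply mul_left_cancel₀ hs0
    linear_combination -h1
  have h3 := DirichletCharacter.norm_errorIntegral_le (1 : DirichletCharacter ℂ 1) (s := s)
    (by linarith)
  have h4 := congrArg norm h2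
  rw [norm_mul, norm_neg, norm_one] at h4
  norm_num at h3
  have h5 : (s.re)⁻¹ ≤ 2 := by
    rw [inv_le_comm₀ (by linarith) (by norm_num)]; linarith
  nlinarith [norm_nonneg (s - 1), norm_nonneg ((1 : DirichletCharacter ℂ 1).errorIntegral s)]

end

section

open Complex MeasureTheory Set Filter Topology Asymptotics

lemma riemannZeta_ofReal_eq_tsum {σ : ℝ} (hσ : 1 < σ) :
    riemannZeta σ = ((∑' n : ℕ, 1 / (n : ℝ) ^ σ : ℝ) : ℂ) := by
  rw [zeta_eq_tsum_one_div_nat_cpow (by simpa using hσ), ofReal_tsum]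
  refine tsum_congr fun n ↦ ?_
  push_cast
  rw [ofReal_cpow n.cast_nonneg]
  simp

lemma tsum_one_div_nat_rpow_le {η : ℝ} (h0 : 0 < η) (h1 : η ≤ 1 / 2) :
    ∑' n : ℕ, 1 / (n : ℝ) ^ (1 + η) ≤ 2 / η := by
  have h2 := (1 : DirichletCharacter ℂ 1).LFunction_eq_add_errorIntegral (s := (1 + η : ℝ))
    (by simp; linarith)
  rw [DirichletCharacter.LFunction_modOne_eq, riemannZeta_ofReal_eq_tsum (by linarith)] at h2
  have h3 := congrArg norm h2
  have h4 : 0 ≤ ∑' n : ℕ, 1 / (n : ℝ) ^ (1 + η) := tsum_nonneg fun n ↦ by positivity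
  rw [Complex.norm_real, Real.norm_of_nonneg h4] at h3
  rw [h3]
  have h5 := (1 : DirichletCharacter ℂ 1).norm_errorIntegral_le (s := (1 + η : ℝ))
    (by simp; linarith)
  have h6 := (1 : DirichletCharacter ℂ 1).norm_meanValue_le_one
  have h7 : ‖((1 + η : ℝ) : ℂ)‖ = 1 + η := by
    rw [Complex.norm_real, Real.norm_of_nonneg (by linarith)]
  have h8 : ‖((1 + η : ℝ) : ℂ) - 1‖ = η := by
    rw [← ofReal_one, ← ofReal_sub, Complex.norm_real]
    simp [abs_of_pos h0]
  refine (norm_add_le _ _).trans ?_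
  rw [norm_div, norm_mul, norm_mul, h7, h8]
  rw [ofReal_re, le_div_iff₀ (by linarith),
    show 2 * ((1 : ℕ) : ℝ) - 1 = 1 by norm_num] at h5
  have h9 : ‖(1 : DirichletCharacter ℂ 1).meanValue‖ * (1 + η) / η ≤ (1 + η) / η := by
    gcongr
    exact mul_le_of_le_one_left (by linarith) h6
  have h10 : (1 + η) / η + 1 ≤ 2 / η := by
    rw [← sub_nonneg]
    have : 2 / η - ((1 + η) / η + 1) = (1 - 2 * η) / η := by field_simp; ring
    rw [this]
    exact div_nonneg (by linarith) h0.le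
  linarith

namespace DirichletCharacter

lemma half_le_norm_LFunction {q : ℕ} [NeZero q] (χ : DirichletCharacter ℂ q) {s : ℂ} {η : ℝ}
    (h0 : 0 < η) (h1 : η ≤ 1 / 2) (hs : s.re = 1 + η) : η / 2 ≤ ‖χ.LFunction s‖ := by
  have hs1 : 1 < s.re := by linarith
  have h2 := LSeries.mul_mu_eq_one χ hs1
  rw [← LFunction_eq_LSeries χ hs1] at h2
  set g : ℕ → ℂ := (fun n : ℕ ↦ χ n) * fun n ↦ ((ArithmeticFunction.moebius n : ℤ) : ℂ) with hg
  have hg1 : ∀ n, ‖g n‖ ≤ 1 := by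
    intro n
    simp only [hg, Pi.mul_apply, norm_mul]
    refine mul_le_one₀ (χ.norm_le_one _) (norm_nonneg _) ?_
    rw [Complex.norm_intCast]
    exact_mod_cast ArithmeticFunction.abs_moebius_le_one
  have hterm : ∀ n, ‖LSeries.term g s n‖ ≤ 1 / (n : ℝ) ^ (1 + η) := by
    intro n
    rw [LSeries.norm_term_eq]
    split_ifs with hn
    · positivity
    · rw [hs]
      gcongr
      exact hg1 n
  have hsum : Summable fun n : ℕ ↦ 1 / (n : ℝ) ^ (1 + η) :=
    Real.summable_one_div_nat_rpow.2 (by linarith)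
  have h3 : ‖LSeries g s‖ ≤ 2 / η :=
    (tsum_of_norm_bounded hsum.hasSum hterm).trans (tsum_one_div_nat_rpow_le h0 h1)
  have h4 := congrArg norm h2
  rw [norm_mul, norm_one] at h4
  have h5 : 1 ≤ ‖χ.LFunction s‖ * (2 / η) := by
    rw [← h4]
    gcongr
  rw [← mul_div_assoc, le_div_iff₀ h0] at h5
  linarith

end DirichletCharacter

lemma mul_log_bound_of_mul_log_le {η W : ℝ} (hη : 0 < η) (hW : 2 ≤ W)
    (h : η * Real.log W ≤ 1 / 10 ^ 7) :
    η ≤ 1 / 4 ∧ η * (8 / 3 + 16 / 3 * (2 * Real.log (16 * W / η))) ≤ 1 / 50 := by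
  have h1 : Real.log 2 ≤ Real.log W := Real.log_le_log (by norm_num) hW
  have h2 := Real.log_two_gt_d9
  have h3 := Real.log_two_lt_d9
  have hη1 : η ≤ 1.5 / 10 ^ 7 := by nlinarith
  refine ⟨hη1.trans (by norm_num), ?_⟩
  set u := √η with hu
  have hu0 : 0 < u := Real.sqrt_pos.2 hη
  have huu : u ^ 2 = η := Real.sq_sqrt hη.le
  have hu1 : u ≤ 4 / 10 ^ 4 := by
    by_contra! hlt
    nlinarith
  have h4 : -Real.log η ≤ 2 / u := by
    rw [← huu, Real.log_pow, ← mul_neg, ← Real.log_inv]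
    have := Real.log_le_self (inv_nonneg.2 hu0.le)
    push_cast
    rw [div_eq_mul_inv]
    linarith
  have h5 : η * (-Real.log η) ≤ 2 * u := by
    calc η * (-Real.log η) ≤ η * (2 / u) := by gcongr
      _ = 2 * u := by rw [← huu]; field_simp
  have h6 : Real.log (16 * W / η) = 4 * Real.log 2 + Real.log W - Real.log η := by
    rw [Real.log_div (by positivity) hη.ne', Real.log_mul (by norm_num) (by positivity),
      show (16 : ℝ) = 2 ^ 4 by norm_num, Real.log_pow]
    norm_num
  rw [h6]
  nlinarith

namespace DirichletCharacter

lemma sum_re_sub_le_of_norm_le {F : ℂ → ℂ} (hF : Differentiable ℂ F) {s₀ : ℂ} {η M : ℝ}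
    (hη : 0 < η) (hM : 0 < M) (hs₀ : s₀.re = 1 + η) (hne : ∀ s : ℂ, 1 < s.re → F s ≠ 0)
    (hb : ∀ s, ‖s - s₀‖ ≤ 3 / 4 → ‖F s‖ ≤ Real.exp M * ‖F s₀‖) (Z : Finset ℂ)
    (hcard : Z.card ≤ 2) (hZ : ∀ ρ ∈ Z, ‖ρ - s₀‖ ≤ 3 / 4 ∧ F ρ = 0) :
    ∑ ρ ∈ Z, (η / (s₀ - ρ)).re - η * (8 / 3 + 16 / 3 * M) ≤ η * (logDeriv F s₀).re := by
  classical
  have hd : Differentiable ℂ fun z ↦ F (s₀ + z) := hF.comp (by fun_prop)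
  have key := sum_re_sub_le_re_logDeriv (f := fun z ↦ F (s₀ + z)) (R := 3 / 4) (M := M)
    (by norm_num) hM hd (by simpa using hne s₀ (by linarith))
    (fun z hz ↦ by simpa using hb (s₀ + z) (by simpa using hz))
    (fun z _ hz ↦ by
      by_contra! hlt
      exact hne (s₀ + z) (by simp; linarith) hz)
    (Z.image (fun ρ ↦ ρ - s₀)) (by
      intro z hz
      obtain ⟨ρ, hρ, rfl⟩ := Finset.mem_image.1 hz
      simpa using hZ ρ hρ)
  rw [Finset.sum_image (fun a _ b _ h ↦ by simpa using h)] at key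
  have hld : logDeriv (fun z ↦ F (s₀ + z)) 0 = logDeriv F s₀ := by
    rw [logDeriv_apply, logDeriv_apply, deriv_comp_const_add, add_zero]
  rw [hld] at key
  have h1 : ∑ ρ ∈ Z, ((1 / (s₀ - ρ)).re - 4 / 3) ≤ ∑ x ∈ Z,
      (-(1 / (x - s₀)) + (starRingEnd ℂ) (x - s₀) / ((3 / 4 : ℝ) : ℂ) ^ 2).re := by
    refine Finset.sum_le_sum fun ρ hρ ↦ ?_
    rw [add_re, ← neg_sub ρ s₀, ← div_neg, sub_eq_add_neg]
    gcongr
    rw [show (((3 / 4 : ℝ) : ℂ)) ^ 2 = (((3 / 4 : ℝ) ^ 2 : ℝ) : ℂ) by push_cast; rfl,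
      div_ofReal_re, conj_re, le_div_iff₀ (by norm_num)]
    have := (abs_le.1 ((abs_re_le_norm (ρ - s₀)).trans (hZ ρ hρ).1)).1
    linarith
  rw [Finset.sum_sub_distrib, Finset.sum_const, nsmul_eq_mul] at h1
  have h2 : (Z.card : ℝ) ≤ 2 := by exact_mod_cast hcard
  have h3 : ∑ ρ ∈ Z, (η / (s₀ - ρ)).re = η * ∑ ρ ∈ Z, (1 / (s₀ - ρ)).re := by
    rw [Finset.mul_sum]
    refine Finset.sum_congr rfl fun ρ _ ↦ ?_
    rw [← re_ofReal_mul, mul_one_div]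
  rw [h3]
  nlinarith

lemma LFunctionTrivChar₁_of_ne_one {q : ℕ} [NeZero q] {s : ℂ} (hs : s ≠ 1) :
    LFunctionTrivChar₁ q s = (s - 1) * (1 : DirichletCharacter ℂ q).LFunction s :=
  Function.update_of_ne hs _ _

lemma logDeriv_LFunctionTrivChar₁ {q : ℕ} [NeZero q] {s : ℂ} (hs : 1 < s.re) :
    logDeriv (LFunctionTrivChar₁ q) s
      = 1 / (s - 1) + logDeriv (1 : DirichletCharacter ℂ q).LFunction s := by
  have hs1 : s ≠ 1 := fun h ↦ by simp [h] at hs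
  have h0 := LFunction_ne_zero_of_one_le_re (1 : DirichletCharacter ℂ q) (Or.inr hs1) hs.le
  have h1 := deriv_LFunctionTrivChar₁_apply_of_ne_one q hs1
  rw [LFunctionTrivChar] at h1
  rw [logDeriv_apply, logDeriv_apply, h1, LFunctionTrivChar₁_of_ne_one hs1]
  have := sub_ne_zero.2 hs1
  field_simp
  ring

/-- Upper bound for the real part of the negated logarithmic derivative of `L(s, χ)` to the right of
the line `re s = 1`, retaining up to two zeros. -/
lemma sum_re_sub_le_logDeriv_LFunction {q : ℕ} [NeZero q] (χ : DirichletCharacter ℂ q) {t η : ℝ}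
    (hη : 0 < η) (h : η * Real.log (q * (|t| + 2)) ≤ 1 / 10 ^ 7) (Z : Finset ℂ)
    (hcard : Z.card ≤ 2)
    (hZ : ∀ ρ ∈ Z, ρ ≠ 1 ∧ χ.LFunction ρ = 0 ∧ ‖ρ - (1 + η + t * I)‖ ≤ 3 / 4) :
    ∑ ρ ∈ Z, (η / (1 + η + t * I - ρ)).re - (η / (η + t * I)).re * (if χ = 1 then 1 else 0) - 1 / 50
      ≤ η * (logDeriv χ.LFunction (1 + η + t * I)).re := by
  have hq : (1 : ℝ) ≤ q := by exact_mod_cast Nat.pos_of_neZero q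
  have ht := abs_nonneg t
  set W : ℝ := q * (|t| + 2) with hW
  have hW2 : 2 ≤ W := by nlinarith
  obtain ⟨hη1, hη2⟩ := mul_log_bound_of_mul_log_le hη hW2 h
  set s₀ : ℂ := 1 + η + t * I with hs₀
  have hs₀re : s₀.re = 1 + η := by simp [hs₀]
  have hs₀im : s₀.im = t := by simp [hs₀]
  have hbase : 1 ≤ 16 * W / η := by rw [le_div_iff₀ hη]; linarith
  have hM : 0 < 2 * Real.log (16 * W / η) :=
    mul_pos two_pos (Real.log_pos (by rw [lt_div_iff₀ hη]; linarith))
  have hexp : Real.exp (2 * Real.log (16 * W / η)) = (16 * W / η) ^ 2 := by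
    rw [mul_comm, Real.exp_mul, Real.exp_log (by positivity)]
    norm_num
  have hs₀1 : ‖s₀ - 1‖ ≤ η + |t| := by
    refine (norm_le_abs_re_add_abs_im _).trans ?_
    simp [hs₀re, hs₀im, abs_of_pos hη]
  have hgeom : ∀ s : ℂ, ‖s - s₀‖ ≤ 3 / 4 →
      1 / 4 ≤ s.re ∧ ‖s‖ ≤ |t| + 2 ∧ ‖s - 1‖ ≤ |t| + 1 := by
    intro s hs
    have h1 := (abs_le.1 ((abs_re_le_norm _).trans hs)).1
    rw [sub_re, hs₀re] at h1
    have h2 : ‖s - 1‖ ≤ |t| + 1 := by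
      calc ‖s - 1‖ = ‖(s - s₀) + (s₀ - 1)‖ := by ring_nf
        _ ≤ 3 / 4 + (η + |t|) := (norm_add_le _ _).trans <| add_le_add hs hs₀1
        _ ≤ |t| + 1 := by linarith
    refine ⟨by linarith, ?_, h2⟩
    calc ‖s‖ = ‖(s - 1) + 1‖ := by ring_nf
      _ ≤ (|t| + 1) + 1 := (norm_add_le _ _).trans <| add_le_add h2 <| by simp
      _ = |t| + 2 := by ring
  have hq1 : ∀ s : ℂ, 1 / 4 ≤ s.re → (2 * (q : ℝ) - 1) / s.re ≤ 4 * (2 * q - 1) := by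
    intro s hs
    rw [div_le_iff₀ (by linarith)]
    nlinarith
  have hlow := χ.half_le_norm_LFunction hη (by linarith) hs₀re
  by_cases hχ : χ = 1
  · subst hχ
    have hs₀ne : s₀ ≠ 1 := fun h ↦ by simp [h] at hs₀re; linarith
    have hη' : η ≤ ‖s₀ - 1‖ := by
      have := abs_re_le_norm (s₀ - 1)
      simpa [hs₀re, abs_of_pos hη] using this
    have key := sum_re_sub_le_of_norm_le (differentiable_LFunctionTrivChar₁ q) (s₀ := s₀) hη hM
      hs₀re ?_ ?_ Z hcard ?_
    · rw [logDeriv_LFunctionTrivChar₁ (by linarith), add_re, mul_add η (re _),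
        ← re_ofReal_mul, mul_one_div] at key
      have h1 : s₀ - 1 = η + t * I := by rw [hs₀]; ring
      rw [h1] at key
      simp only [if_true, mul_one]
      linarith
    · intro s hs
      have hs1 : s ≠ 1 := fun h ↦ by simp [h] at hs
      rw [LFunctionTrivChar₁_of_ne_one hs1]
      exact mul_ne_zero (sub_ne_zero.2 hs1)
        (LFunction_ne_zero_of_one_le_re _ (Or.inr hs1) hs.le)
    · intro s hs
      obtain ⟨h1, h2, h3⟩ := hgeom s hs
      rw [hexp, LFunctionTrivChar₁_of_ne_one hs₀ne, norm_mul]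
      calc _ ≤ ‖s‖ * (1 + ‖s - 1‖ * ((2 * q - 1) / s.re)) :=
            norm_LFunctionTrivChar₁_le (by linarith)
        _ ≤ (|t| + 2) * (1 + (|t| + 1) * (4 * (2 * q - 1))) := by
          have := hq1 s h1
          have : 0 ≤ (2 * (q : ℝ) - 1) / s.re := div_nonneg (by linarith) (by linarith)
          gcongr
        _ ≤ (16 * W / η) ^ 2 * (η * (η / 2)) := by
          have : (16 * W / η) ^ 2 * (η * (η / 2)) = 128 * W ^ 2 := by field_simp; norm_num
          rw [this, hW]
          have h4 : 1 + (|t| + 1) * (4 * (2 * q - 1)) ≤ 8 * (q * (|t| + 2)) := by nlinarith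
          have h5 : |t| + 2 ≤ q * (|t| + 2) := by nlinarith
          nlinarith
        _ ≤ _ := by
          gcongr
    · intro ρ hρ
      obtain ⟨h1, h2, h3⟩ := hZ ρ hρ
      refine ⟨h3, ?_⟩
      rw [LFunctionTrivChar₁_of_ne_one h1, h2, mul_zero]
  · have key := sum_re_sub_le_of_norm_le (differentiable_LFunction hχ) (s₀ := s₀) hη hM
      hs₀re (fun s hs ↦ LFunction_ne_zero_of_one_le_re _ (Or.inl hχ) hs.le) ?_ Z hcard
      (fun ρ hρ ↦ ⟨(hZ ρ hρ).2.2, (hZ ρ hρ).2.1⟩)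
    · simp only [hχ, if_false, mul_zero, sub_zero]
      linarith
    · intro s hs
      obtain ⟨h1, h2, h3⟩ := hgeom s hs
      rw [hexp]
      calc _ ≤ ‖s‖ * ((2 * q - 1) / s.re) := norm_LFunction_le hχ (by linarith)
        _ ≤ (|t| + 2) * (4 * (2 * q - 1)) := by
          gcongr
          · exact div_nonneg (by linarith) (by linarith)
          · exact hq1 s h1
        _ ≤ (16 * W / η) * (η / 2) := by
          have : (16 * W / η) * (η / 2) = 8 * W := by field_simp; norm_num
          rw [this, hW]
          nlinarith
        _ ≤ (16 * W / η) ^ 2 * (η / 2) := by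
          gcongr
          nlinarith
        _ ≤ _ := by gcongr

end DirichletCharacter

end

section

open Complex ArithmeticFunction

namespace DirichletCharacter

lemma logDeriv_LFunction_eq {q : ℕ} [NeZero q] (χ : DirichletCharacter ℂ q) {s : ℂ}
    (hs : 1 < s.re) :
    -logDeriv χ.LFunction s = LSeries ((fun n : ℕ ↦ χ n) * fun n ↦ (vonMangoldt n : ℂ)) s := by
  rw [LSeries_twist_vonMangoldt_eq χ hs, logDeriv_apply, deriv_LFunction_eq_deriv_LSeries χ hs,
    LFunction_eq_LSeries χ hs, neg_div]

lemma hasSum_neg_re_logDeriv_LFunction {q : ℕ} [NeZero q] (χ : DirichletCharacter ℂ q) {σ : ℝ}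
    (hσ : 1 < σ) (t : ℝ) :
    HasSum (fun n : ℕ ↦ vonMangoldt n / (n : ℝ) ^ σ * (χ n * (n : ℂ) ^ (-(t * I))).re)
      (-(logDeriv χ.LFunction (σ + t * I)).re) := by
  have hs : 1 < ((σ : ℂ) + t * I).re := by simpa using hσ
  have h1 := (LSeriesSummable_twist_vonMangoldt χ hs).hasSum
  rw [← neg_re, logDeriv_LFunction_eq χ hs]
  have h2 := Complex.hasSum_re h1
  refine h2.congr_fun fun n ↦ ?_
  rcases eq_or_ne n 0 with rfl | hn
  · simp
  · have hn' : (n : ℂ) ≠ 0 := by exact_mod_cast hn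
    rw [LSeries.term_of_ne_zero hn, Pi.mul_apply, cpow_add _ _ hn', cpow_neg, ← re_ofReal_mul]
    congr 1
    push_cast
    rw [ofReal_cpow n.cast_nonneg]
    push_cast
    field_simp

lemma three_mul_add_re_nonneg {z : ℂ} (hz : ‖z‖ = 1) : 0 ≤ 3 + 4 * z.re + (z ^ 2).re := by
  have h1 := Complex.sq_norm z
  rw [hz, normSq_apply] at h1
  rw [pow_two z, mul_re]
  nlinarith [sq_nonneg (z.re + 1)]

lemma re_logDeriv_three_four_one {q : ℕ} [NeZero q] (χ : DirichletCharacter ℂ q) {σ : ℝ}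
    (hσ : 1 < σ) (t : ℝ) :
    3 * (logDeriv (1 : DirichletCharacter ℂ q).LFunction (σ + (0 : ℝ) * I)).re
      + 4 * (logDeriv χ.LFunction (σ + t * I)).re
      + (logDeriv (χ ^ 2).LFunction (σ + (2 * t : ℝ) * I)).re ≤ 0 := by
  have h0 := (hasSum_neg_re_logDeriv_LFunction (1 : DirichletCharacter ℂ q) hσ 0).mul_left 3
  have h1 := (hasSum_neg_re_logDeriv_LFunction χ hσ t).mul_left 4
  have h2 := hasSum_neg_re_logDeriv_LFunction (χ ^ 2) hσ (2 * t)
  have h3 := ((h0.add h1).add h2).nonneg fun n ↦ ?_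
  · linarith
  rcases eq_or_ne n 0 with rfl | hn
  · simp
  have hn' : (n : ℂ) ≠ 0 := by exact_mod_cast hn
  by_cases hu : IsUnit (n : ZMod q)
  · have hz : ‖χ n * (n : ℂ) ^ (-(t * I))‖ = 1 := by
      rw [norm_mul, norm_natCast_cpow_of_pos (Nat.pos_of_ne_zero hn), ← hu.unit_spec,
        χ.unit_norm_eq_one]
      simp
    have h4 := three_mul_add_re_nonneg hz
    have h5 : (χ ^ 2) n * (n : ℂ) ^ (-(((2 * t : ℝ) : ℂ) * I))
        = (χ n * (n : ℂ) ^ (-(t * I))) ^ 2 := by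
      rw [mul_pow, ← cpow_nat_mul, MulChar.pow_apply' _ two_ne_zero]
      congr 2
      push_cast
      ring
    rw [h5, MulChar.one_apply hu]
    have h6 : 0 ≤ vonMangoldt n / (n : ℝ) ^ σ := div_nonneg vonMangoldt_nonneg (by positivity)
    have h7 : ((1 : ℂ) * (n : ℂ) ^ (-(((0 : ℝ) : ℂ) * I))).re = 1 := by simp
    rw [h7]
    nlinarith
  · simp [MulChar.map_nonunit _ hu]

lemma re_logDeriv_one_add_nonpos {q : ℕ} [NeZero q] (χ : DirichletCharacter ℂ q) {σ : ℝ}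
    (hσ : 1 < σ) :
    (logDeriv (1 : DirichletCharacter ℂ q).LFunction (σ + (0 : ℝ) * I)).re
      + (logDeriv χ.LFunction (σ + (0 : ℝ) * I)).re ≤ 0 := by
  have h0 := hasSum_neg_re_logDeriv_LFunction (1 : DirichletCharacter ℂ q) hσ 0
  have h1 := hasSum_neg_re_logDeriv_LFunction χ hσ 0
  have h3 := (h0.add h1).nonneg fun n ↦ ?_
  · linarith
  by_cases hu : IsUnit (n : ZMod q)
  · have h6 : 0 ≤ vonMangoldt n / (n : ℝ) ^ σ := div_nonneg vonMangoldt_nonneg (by positivity)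
    have h7 := (abs_le.1 ((abs_re_le_norm _).trans (χ.norm_le_one n))).1
    simp only [MulChar.one_apply hu, ofReal_zero, zero_mul, neg_zero, cpow_zero, mul_one, one_re]
    nlinarith
  · simp [MulChar.map_nonunit _ hu]

lemma re_logDeriv_quadratic_nonpos {q : ℕ} [NeZero q] {χ ψ : DirichletCharacter ℂ q}
    (hχ : χ ^ 2 = 1) (hψ : ψ ^ 2 = 1) {σ : ℝ} (hσ : 1 < σ) :
    (logDeriv (1 : DirichletCharacter ℂ q).LFunction (σ + (0 : ℝ) * I)).re
      + (logDeriv χ.LFunction (σ + (0 : ℝ) * I)).re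
      + (logDeriv ψ.LFunction (σ + (0 : ℝ) * I)).re
      + (logDeriv (χ * ψ).LFunction (σ + (0 : ℝ) * I)).re ≤ 0 := by
  have h0 := hasSum_neg_re_logDeriv_LFunction (1 : DirichletCharacter ℂ q) hσ 0
  have h1 := hasSum_neg_re_logDeriv_LFunction χ hσ 0
  have h2 := hasSum_neg_re_logDeriv_LFunction ψ hσ 0
  have h3 := hasSum_neg_re_logDeriv_LFunction (χ * ψ) hσ 0
  have h4 := (((h0.add h1).add h2).add h3).nonneg fun n ↦ ?_
  · linarith
  by_cases hu : IsUnit (n : ZMod q)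
  · have h6 : 0 ≤ vonMangoldt n / (n : ℝ) ^ σ := div_nonneg vonMangoldt_nonneg (by positivity)
    have hval : ∀ φ : DirichletCharacter ℂ q, φ ^ 2 = 1 → φ n = 1 ∨ φ n = -1 := by
      intro φ hφ
      rw [← sq_eq_one_iff, ← MulChar.pow_apply' _ two_ne_zero, hφ, MulChar.one_apply hu]
    simp only [MulChar.one_apply hu, MulChar.mul_apply, ofReal_zero, zero_mul, neg_zero,
      cpow_zero, mul_one, one_re]
    rcases hval χ hχ with h | h <;> rcases hval ψ hψ with h' | h' <;> simp [h, h'] <;> linarith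
  · simp [MulChar.map_nonunit _ hu]

end DirichletCharacter

end

section

open Complex ComplexConjugate

namespace DirichletCharacter

lemma one_sub_mul_prime_cpow_ne_zero {w s : ℂ} (hw : ‖w‖ ≤ 1) (hs : 0 < s.re) {p : ℕ}
    (hp : p.Prime) : 1 - w * (p : ℂ) ^ (-s) ≠ 0 := by
  intro h
  have h1 : ‖w * (p : ℂ) ^ (-s)‖ = 1 := by rw [← sub_eq_zero.1 h, norm_one]
  rw [norm_mul, norm_natCast_cpow_of_pos hp.pos] at h1
  have h2 : (p : ℝ) ^ (-s).re < 1 :=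
    Real.rpow_lt_one_of_one_lt_of_neg (by exact_mod_cast hp.one_lt) (by simpa using hs)
  nlinarith [norm_nonneg w, Real.rpow_nonneg p.cast_nonneg (-s).re]

lemma LFunction_changeLevel_eq_zero_iff {M N : ℕ} [NeZero M] [NeZero N] (hMN : M ∣ N)
    (χ : DirichletCharacter ℂ M) {s : ℂ} (h : χ ≠ 1 ∨ s ≠ 1) (hs : 0 < s.re) :
    LFunction (changeLevel hMN χ) s = 0 ↔ LFunction χ s = 0 := by
  rw [LFunction_changeLevel hMN χ h, mul_eq_zero, or_iff_left]
  exact Finset.prod_ne_zero_iff.2 fun p hp ↦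
    one_sub_mul_prime_cpow_ne_zero (χ.norm_le_one _) hs (Nat.prime_of_mem_primeFactors hp)

lemma LFunction_one_eq_zero_iff {N : ℕ} [NeZero N] {s : ℂ} (h : s ≠ 1) (hs : 0 < s.re) :
    (1 : DirichletCharacter ℂ N).LFunction s = 0 ↔ riemannZeta s = 0 := by
  rw [← changeLevel_one N.one_dvd, LFunction_changeLevel_eq_zero_iff N.one_dvd _ (Or.inr h) hs,
    LFunction_modOne_eq]

lemma conj_apply_of_sq_eq_one {q : ℕ} {χ : DirichletCharacter ℂ q} (hχ : χ ^ 2 = 1)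
    (a : ZMod q) : conj (χ a) = χ a := by
  have h1 : χ⁻¹ = χ := by rw [inv_eq_iff_mul_eq_one, ← pow_two, hχ]
  rw [starRingEnd_apply, MulChar.star_apply', h1]

lemma LFunction_conj {q : ℕ} [NeZero q] {χ : DirichletCharacter ℂ q} (hχ1 : χ ≠ 1)
    (hχ : χ ^ 2 = 1) (s : ℂ) : χ.LFunction (conj s) = conj (χ.LFunction s) := by
  have hd : Differentiable ℂ (conj ∘ χ.LFunction ∘ conj) := by
    intro z
    have := (differentiable_LFunction hχ1 (conj z)).conj_conj
    simpa using this
  have heq : (conj ∘ χ.LFunction ∘ conj) = χ.LFunction := by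
    refine AnalyticOnNhd.eq_of_eventuallyEq (z₀ := 2) (fun z _ ↦ hd.analyticAt z)
      (fun z _ ↦ (differentiable_LFunction hχ1).analyticAt z) ?_
    have : {z : ℂ | 1 < z.re} ∈ nhds (2 : ℂ) :=
      (isOpen_lt continuous_const continuous_re).mem_nhds (by simp)
    filter_upwards [this] with z hz
    simp only [Function.comp_apply]
    rw [LFunction_eq_LSeries χ hz, LFunction_eq_LSeries χ (by simpa using hz), LSeries, LSeries,
      Complex.conj_tsum]
    refine tsum_congr fun n ↦ ?_
    rcases eq_or_ne n 0 with rfl | hn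
    · simp
    · rw [LSeries.term_of_ne_zero hn, LSeries.term_of_ne_zero hn, map_div₀,
        conj_apply_of_sq_eq_one hχ, cpow_conj _ _ (by simp [natCast_arg, Real.pi_ne_zero.symm])]
      simp
  have h2 := congrFun heq s
  rw [← h2]
  simp

lemma re_div_self_add {η δ : ℝ} (hη : 0 < η) (hδ : 0 ≤ δ) (hδη : δ ≤ η / 100) :
    99 / 100 ≤ ((η : ℂ) / ((η + δ : ℝ) : ℂ)).re := by
  rw [← ofReal_div, ofReal_re, le_div_iff₀ (by linarith)]
  linarith

lemma re_div_add_mul_I (η t : ℝ) :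
    ((η : ℂ) / (η + t * I)).re = η ^ 2 / (η ^ 2 + t ^ 2) := by
  rw [div_re]
  simp [normSq_apply]
  ring

/-- Zeros in the region `1 - η / 100 ≤ re ρ` can only be real, and belong to quadratic
characters. -/
lemma quadratic_and_im_eq_zero_of_LFunction_eq_zero {q : ℕ} [NeZero q]
    {χ : DirichletCharacter ℂ q} {β t η : ℝ} (hη : 0 < η)
    (h : η * Real.log (q * (2 * |t| + 2)) ≤ 1 / 10 ^ 7) (hρ1 : (β : ℂ) + t * I ≠ 1)
    (hρ : χ.LFunction (β + t * I) = 0) (hβ : 1 - β ≤ η / 100) :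
    χ ≠ 1 ∧ χ ^ 2 = 1 ∧ t = 0 ∧ β < 1 := by
  have hq : (1 : ℝ) ≤ q := by exact_mod_cast Nat.pos_of_neZero q
  have ht0 := abs_nonneg t
  have hle : ∀ x : ℝ, 0 ≤ x → x ≤ 2 * |t| → η * Real.log (q * (x + 2)) ≤ 1 / 10 ^ 7 := by
    intro x hx hxt
    refine le_trans ?_ h
    gcongr
  have hη1 : η ≤ 1 / 4 := (mul_log_bound_of_mul_log_le hη (by nlinarith) h).1
  have hβ1 : β < 1 := by
    by_contra! hle
    exact LFunction_ne_zero_of_one_le_re χ (Or.inr hρ1) (by simpa using hle) hρ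
  obtain ⟨δ, hδ⟩ : ∃ δ, δ = 1 - β := ⟨_, rfl⟩
  have hδ0 : 0 < δ := by linarith
  have hδη : δ ≤ η / 100 := by linarith
  have hβδ : (β : ℂ) = 1 - δ := by rw [hδ]; push_cast; ring
  have hσ : 1 < 1 + η := by linarith
  have hcast : ((1 + η : ℝ) : ℂ) = 1 + η := by push_cast; rfl
  have b0 := (1 : DirichletCharacter ℂ q).sum_re_sub_le_logDeriv_LFunction (t := 0) hη
    (hle _ (by simp) (by simp)) ∅ (by simp) (by simp)
  have b1 := χ.sum_re_sub_le_logDeriv_LFunction (t := t) hη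
    (hle _ ht0 (by linarith)) {(β : ℂ) + t * I} (by simp) (by
      intro ρ hmem
      obtain rfl := Finset.mem_singleton.1 hmem
      refine ⟨hρ1, hρ, ?_⟩
      rw [show (β : ℂ) + t * I - (1 + η + t * I) = ((β - (1 + η) : ℝ) : ℂ) by push_cast; ring,
        Complex.norm_real, Real.norm_eq_abs, abs_le]
      constructor <;> linarith)
  have b2 := (χ ^ 2).sum_re_sub_le_logDeriv_LFunction (t := 2 * t) hη
    (by rw [abs_mul, abs_two]; exact hle _ (by linarith) le_rfl) ∅ (by simp) (by simp)
  have h341 := χ.re_logDeriv_three_four_one hσ t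
  rw [hcast] at h341
  rw [Finset.sum_singleton, show (1 : ℂ) + η + t * I - (β + t * I) = ((η + δ : ℝ) : ℂ) by
    rw [hβδ]; push_cast; ring] at b1
  have h99 := re_div_self_add hη hδ0.le hδη
  rw [re_div_add_mul_I] at b0 b1 b2
  rw [Finset.sum_empty, if_pos rfl, zero_pow two_ne_zero, add_zero, div_self (by positivity)] at b0
  rw [Finset.sum_empty] at b2
  have key : 4 / 5 ≤ 4 * (η ^ 2 / (η ^ 2 + t ^ 2) * (if χ = 1 then 1 else 0))
      + η ^ 2 / (η ^ 2 + (2 * t) ^ 2) * (if χ ^ 2 = 1 then 1 else 0) := by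
    have := mul_le_mul_of_nonneg_left h341 hη.le
    nlinarith
  have hχ1 : χ ≠ 1 := by
    rintro rfl
    rw [if_pos rfl, if_pos (one_pow 2), mul_one, mul_one] at key
    have h1 : η ^ 2 / (η ^ 2 + (2 * t) ^ 2) ≤ η ^ 2 / (η ^ 2 + t ^ 2) := by
      gcongr η ^ 2 / (η ^ 2 + ?_)
      nlinarith [sq_nonneg t]
    have h2 : 4 / 25 ≤ η ^ 2 / (η ^ 2 + t ^ 2) := by linarith
    rw [le_div_iff₀ (by positivity)] at h2
    have h3 : η ≤ 1 / 100 := by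
      have h4 : Real.log 2 ≤ Real.log (q * (2 * |t| + 2)) :=
        Real.log_le_log (by norm_num) (by nlinarith)
      have := Real.log_two_gt_d9
      nlinarith
    have ht : |t| ≤ 3 * η := by
      refine abs_le_of_sq_le_sq ?_ (by linarith)
      nlinarith
    rw [LFunction_one_eq_zero_iff hρ1 (by simp; linarith)] at hρ
    refine riemannZeta_ne_zero_of_norm_sub_one_lt ?_ hρ
    refine (norm_le_abs_re_add_abs_im _).trans_lt ?_
    have : |β - 1| ≤ η / 100 := by rw [abs_le]; constructor <;> linarith
    simp
    linarith
  rw [if_neg hχ1, mul_zero, mul_zero, zero_add] at key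
  have hχ2 : χ ^ 2 = 1 := by
    by_contra hne
    rw [if_neg hne] at key
    norm_num at key
  refine ⟨hχ1, hχ2, ?_, hβ1⟩
  rw [if_pos hχ2, mul_one, le_div_iff₀ (by positivity)] at key
  by_contra ht
  have htη : t ^ 2 ≤ η ^ 2 / 16 := by nlinarith
  have htη' : |t| ≤ η / 4 := by
    refine abs_le_of_sq_le_sq ?_ (by linarith)
    nlinarith
  have hρ' : χ.LFunction (β + (-t : ℝ) * I) = 0 := by
    have h1 := LFunction_conj hχ1 hχ2 (β + t * I)
    rw [hρ, map_zero] at h1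
    simpa using h1
  have hterm : ∀ u : ℝ, u ^ 2 = t ^ 2 →
      92 / 100 ≤ ((η : ℂ) / (1 + η + (0 : ℝ) * I - (β + u * I))).re := by
    intro u hu
    have h1 : (1 : ℂ) + η + (0 : ℝ) * I - (β + u * I) = ((η + δ : ℝ) : ℂ) + (-u : ℝ) * I := by
      rw [hβδ]; push_cast; ring
    rw [h1, div_re]
    simp only [ofReal_re, ofReal_im, normSq_add_mul_I, add_re, mul_re, I_re, I_im, zero_mul,
      zero_div, add_zero, mul_zero, mul_one, sub_zero]
    rw [neg_sq, hu, le_div_iff₀ (by positivity)]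
    nlinarith
  have hne : (β : ℂ) + t * I ≠ β + (-t : ℝ) * I := by
    intro h
    have := congrArg Complex.im h
    simp at this
    exact ht (by linarith)
  have c1 := χ.sum_re_sub_le_logDeriv_LFunction (t := 0) hη
    (hle _ (by simp) (by simp)) {(β : ℂ) + t * I, (β : ℂ) + (-t : ℝ) * I} Finset.card_le_two (by
      have hn : ∀ u : ℝ, |u| ≤ η / 4 → ‖(β : ℂ) + u * I - (1 + η + (0 : ℝ) * I)‖ ≤ 3 / 4 := by
        intro u hu
        refine (norm_le_abs_re_add_abs_im _).trans ?_
        have : |β - (1 + η)| ≤ η + η / 100 := by rw [abs_le]; constructor <;> linarith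
        simp
        linarith
      intro ρ hmem
      rcases Finset.mem_insert.1 hmem with rfl | hmem
      · exact ⟨hρ1, hρ, hn _ htη'⟩
      · obtain rfl := Finset.mem_singleton.1 hmem
        refine ⟨fun h ↦ ?_, hρ', hn _ (by rwa [abs_neg])⟩
        have := congrArg Complex.re h
        simp at this
        linarith)
  rw [Finset.sum_pair hne, if_neg hχ1] at c1
  have hpos := χ.re_logDeriv_one_add_nonpos hσ
  rw [hcast] at hpos
  have := hterm t rfl
  have := hterm (-t) (neg_sq t)
  nlinarith

/-- Landau: two quadratic characters with a real zero very close to `1` are induced by the same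
primitive character. -/
lemma conductor_eq_of_LFunction_eq_zero {q r : ℕ} [NeZero q] [NeZero r]
    {χ : DirichletCharacter ℂ q} {ψ : DirichletCharacter ℂ r} (hχ1 : χ ≠ 1) (hχ : χ ^ 2 = 1)
    (hψ1 : ψ ≠ 1) (hψ : ψ ^ 2 = 1) {β γ η : ℝ} (hη : 0 < η)
    (h : η * Real.log (q * r * 2) ≤ 1 / 10 ^ 7) (hβ : χ.LFunction β = 0)
    (hγ : ψ.LFunction γ = 0) (hβ1 : β < 1) (hγ1 : γ < 1) (hβη : 1 - β ≤ η / 100)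
    (hγη : 1 - γ ≤ η / 100) : χ.conductor = ψ.conductor := by
  have : NeZero (q * r) := ⟨mul_ne_zero (NeZero.ne q) (NeZero.ne r)⟩
  set χ' := changeLevel (Dvd.intro r rfl : q ∣ q * r) χ with hχ'
  set ψ' := changeLevel (Dvd.intro_left q rfl : r ∣ q * r) ψ with hψ'
  have hW : (2 : ℝ) ≤ (q * r : ℕ) * 2 := by
    have : 1 ≤ q * r := Nat.pos_of_neZero _
    have : (1 : ℝ) ≤ (q * r : ℕ) := by exact_mod_cast this
    linarith
  have h' : η * Real.log ((q * r : ℕ) * (|(0 : ℝ)| + 2)) ≤ 1 / 10 ^ 7 := by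
    simpa using h
  have hη1 : η ≤ 1 / 4 := (mul_log_bound_of_mul_log_le hη hW (by simpa using h)).1
  have hχ'1 : χ' ≠ 1 := fun hh ↦ hχ1 ((changeLevel_eq_one_iff _).1 hh)
  have hψ'1 : ψ' ≠ 1 := fun hh ↦ hψ1 ((changeLevel_eq_one_iff _).1 hh)
  have hχ'2 : χ' ^ 2 = 1 := by rw [hχ', ← map_pow, hχ, map_one]
  have hψ'2 : ψ' ^ 2 = 1 := by rw [hψ', ← map_pow, hψ, map_one]
  have hprod : χ' * ψ' = 1 := by
    by_contra hne
    have hβ' : χ'.LFunction β = 0 :=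
      (LFunction_changeLevel_eq_zero_iff _ χ (Or.inl hχ1) (by simp; linarith)).2 hβ
    have hγ' : ψ'.LFunction γ = 0 :=
      (LFunction_changeLevel_eq_zero_iff _ ψ (Or.inl hψ1) (by simp; linarith)).2 hγ
    have bound : ∀ φ : DirichletCharacter ℂ (q * r), φ ≠ 1 → ∀ b : ℝ, φ.LFunction b = 0 → b < 1 →
        1 - b ≤ η / 100 →
        97 / 100 ≤ η * (logDeriv φ.LFunction (1 + η + (0 : ℝ) * I)).re := by
      intro φ hφ b hb hb1 hbη
      have b1 := φ.sum_re_sub_le_logDeriv_LFunction (t := 0) hη h' {(b : ℂ)} (by simp) (by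
        intro ρ hmem
        obtain rfl := Finset.mem_singleton.1 hmem
        refine ⟨by exact_mod_cast hb1.ne, hb, ?_⟩
        rw [show (b : ℂ) - (1 + η + (0 : ℝ) * I) = ((b - (1 + η) : ℝ) : ℂ) by push_cast; ring,
          Complex.norm_real, Real.norm_eq_abs, abs_le]
        constructor <;> linarith)
      have h99 := re_div_self_add hη (sub_pos.2 hb1).le hbη
      rw [Finset.sum_singleton, if_neg hφ, show (1 : ℂ) + η + (0 : ℝ) * I - b
        = ((η + (1 - b) : ℝ) : ℂ) by push_cast; ring] at b1
      linarith
    have b0 := (1 : DirichletCharacter ℂ (q * r)).sum_re_sub_le_logDeriv_LFunction (t := 0) hη h' ∅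
      (by simp) (by simp)
    rw [re_div_add_mul_I, Finset.sum_empty, if_pos rfl, zero_pow two_ne_zero, add_zero,
      div_self (by positivity)] at b0
    have b3 := (χ' * ψ').sum_re_sub_le_logDeriv_LFunction (t := 0) hη h' ∅ (by simp) (by simp)
    rw [Finset.sum_empty, if_neg hne] at b3
    have hpos := re_logDeriv_quadratic_nonpos hχ'2 hψ'2 (σ := 1 + η) (by linarith)
    rw [show ((1 + η : ℝ) : ℂ) = 1 + η by push_cast; rfl] at hpos
    have := bound χ' hχ'1 β hβ' hβ1 hβη
    have := bound ψ' hψ'1 γ hγ' hγ1 hγη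
    nlinarith
  have heq : χ' = ψ' := by
    rw [← mul_left_inj ψ', hprod, ← pow_two, hψ'2]
  rw [← conductor_changeLevel χ (Dvd.intro r rfl : q ∣ q * r),
    ← conductor_changeLevel ψ (Dvd.intro_left q rfl : r ∣ q * r), ← hχ', ← hψ', heq]

end DirichletCharacter

end

section

open Complex Filter Topology

namespace DirichletCharacter

lemma totient_div_eq_prod {q : ℕ} (hq : q ≠ 0) :
    (q.totient : ℝ) / q = ∏ p ∈ q.primeFactors, (1 - (p : ℝ)⁻¹) := by
  have h := q.totient_eq_mul_prod_factors
  have h' : (q.totient : ℝ) = q * ∏ p ∈ q.primeFactors, (1 - (p : ℝ)⁻¹) := by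
    have := congrArg (Rat.cast : ℚ → ℝ) h
    push_cast at this
    exact this
  rw [h', mul_div_cancel_left₀ _ (by exact_mod_cast hq)]

lemma tendsto_LFunction_one_sub {q : ℕ} [NeZero q] :
    Tendsto (fun s ↦ (1 : DirichletCharacter ℂ q).LFunction s
      - q.totient * (q : ℂ) ^ (-s) * (1 / (s - 1) / Gammaℝ s)) (𝓝[≠] 1)
      (𝓝 ((1 : DirichletCharacter ℂ q).LFunction 1)) := by
  have hq : (q : ℂ) ≠ 0 := by exact_mod_cast NeZero.ne q
  have hsum : ∑ j : ZMod q, (1 : DirichletCharacter ℂ q) j = q.totient := by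
    have := MulChar.sum_one_eq_card_units (R := ZMod q) (R' := ℂ)
    rw [this, ZMod.card_units_eq_totient]
  have h1 : Tendsto (fun s : ℂ ↦ (q : ℂ) ^ (-s) * ∑ j : ZMod q, (1 : DirichletCharacter ℂ q) j *
      (HurwitzZeta.hurwitzZeta (ZMod.toAddCircle j) s - 1 / (s - 1) / Gammaℝ s)) (𝓝 1)
      (𝓝 ((q : ℂ) ^ (-1 : ℂ) * ∑ j : ZMod q, (1 : DirichletCharacter ℂ q) j *
      (HurwitzZeta.hurwitzZeta (ZMod.toAddCircle j) 1))) := by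
    refine Tendsto.mul ?_ (tendsto_finsetSum _ fun j _ ↦ tendsto_const_nhds.mul
      (HurwitzZeta.tendsto_hurwitzZeta_sub_one_div_nhds_one _))
    exact ((continuous_neg.const_cpow (Or.inl hq)).tendsto 1)
  refine (h1.mono_left nhdsWithin_le_nhds).congr fun s ↦ ?_
  simp only [LFunction, ZMod.LFunction, mul_sub, Finset.sum_sub_distrib, ← Finset.sum_mul, hsum]
  ring

/-- The conventional value `(γ - log (4π)) / 2` of the Riemann zeta function at `1`. -/
lemma lt_riemannZeta_one :
    -(3 / 2 * Real.log 2) < (Real.eulerMascheroniConstant - Real.log (4 * Real.pi)) / 2 := by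
  have h1 := Real.one_half_lt_eulerMascheroniConstant
  have h2 := Real.log_two_lt_d9
  have h3 : Real.log (4 * Real.pi) * 3 ≤ 11 * Real.log 2 := by
    have h4 : (4 * Real.pi) ^ 3 ≤ 2 ^ 11 := by
      calc (4 * Real.pi) ^ 3 ≤ (4 * 3.15) ^ 3 := by
            gcongr
            exact Real.pi_lt_d2.le
        _ ≤ _ := by norm_num
    have h5 := Real.log_le_log (by positivity) h4
    rw [Real.log_pow, Real.log_pow] at h5
    push_cast at h5
    linarith
  linarith

lemma LFunction_one_apply_one_ne_zero {q : ℕ} [NeZero q] :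
    (1 : DirichletCharacter ℂ q).LFunction 1 ≠ 0 := by
  rcases eq_or_ne q 1 with rfl | hq1
  · rw [LFunction_modOne_eq]
    exact riemannZeta_one_ne_zero
  have hq0 : q ≠ 0 := NeZero.ne q
  have hq : (q : ℂ) ≠ 0 := by exact_mod_cast hq0
  set P : ℝ := ∏ p ∈ q.primeFactors, (1 - (p : ℝ)⁻¹) with hP
  have hfac : ∀ p ∈ q.primeFactors, 0 < 1 - (p : ℝ)⁻¹ := fun p hp ↦ by
    rw [sub_pos]
    exact inv_lt_one_of_one_lt₀ (by exact_mod_cast (Nat.prime_of_mem_primeFactors hp).one_lt)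
  have hPpos : 0 < P := Finset.prod_pos hfac
  have hPφ : (q.totient : ℝ) / q = P := totient_div_eq_prod hq0
  set D : ℝ := ∑ p ∈ q.primeFactors, (∏ r ∈ q.primeFactors.erase p, (1 - (r : ℝ)⁻¹)) *
    ((p : ℝ)⁻¹ * Real.log p) with hD
  let K : ℂ → ℂ := fun s ↦
    ∏ p ∈ q.primeFactors, (1 - (p : ℂ) ^ (-s)) - q.totient * (q : ℂ) ^ (-s)
  have hcpow : ∀ n : ℕ, n ≠ 0 →
      HasDerivAt (fun s : ℂ ↦ (n : ℂ) ^ (-s)) (-((n : ℂ)⁻¹ * Real.log n)) 1 := by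
    intro n hn
    convert (hasDerivAt_neg (1 : ℂ)).const_cpow (c := (n : ℂ)) (Or.inl (by exact_mod_cast hn))
      using 1
    rw [cpow_neg_one, natCast_log]
    ring
  have hK : HasDerivAt K ((D + P * Real.log q : ℝ) : ℂ) 1 := by
    have h1 := HasDerivAt.fun_finsetProd (u := q.primeFactors)
      (f := fun (p : ℕ) (s : ℂ) ↦ 1 - (p : ℂ) ^ (-s)) (f' := fun p ↦ (p : ℂ)⁻¹ * Real.log p)
      (x := 1) fun p hp ↦ by
        simpa using (hcpow p (Nat.prime_of_mem_primeFactors hp).ne_zero).const_sub 1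
    refine (h1.fun_sub ((hcpow q hq0).const_mul (q.totient : ℂ))).congr_deriv ?_
    rw [← hPφ, hD]
    push_cast
    simp only [cpow_neg_one, smul_eq_mul]
    rw [div_eq_mul_inv]
    ring
  have hK1 : K 1 = 0 := by
    have : ((q.totient : ℝ) / q : ℂ) = (P : ℂ) := by exact_mod_cast congrArg ofReal hPφ
    rw [hP] at this
    push_cast at this
    simp only [K, cpow_neg_one]
    rw [← this]
    ring
  have hlim : Tendsto (fun s ↦ (1 : DirichletCharacter ℂ q).LFunction s
      - q.totient * (q : ℂ) ^ (-s) * (1 / (s - 1) / Gammaℝ s)) (𝓝[≠] 1)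
      (𝓝 ((P * ((Real.eulerMascheroniConstant - Real.log (4 * Real.pi)) / 2) +
        (D + P * Real.log q) : ℝ) : ℂ)) := by
    have hP1 : Tendsto (fun s : ℂ ↦ ∏ p ∈ q.primeFactors, (1 - (p : ℂ) ^ (-s))) (𝓝[≠] 1)
        (𝓝 (P : ℂ)) := by
      have h0 : ContinuousAt (fun s : ℂ ↦ ∏ p ∈ q.primeFactors, (1 - (p : ℂ) ^ (-s))) 1 :=
        tendsto_finsetProd _ fun p hp ↦
          ((hcpow p (Nat.prime_of_mem_primeFactors hp).ne_zero).const_sub 1).continuousAt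
      convert h0.tendsto.mono_left nhdsWithin_le_nhds using 2
      rw [hP]
      push_cast
      simp only [cpow_neg_one]
    have hG : Tendsto (fun s : ℂ ↦ (Gammaℝ s)⁻¹) (𝓝[≠] 1) (𝓝 1) := by
      have := (differentiable_Gammaℝ_inv.continuous.tendsto 1).mono_left
        (nhdsWithin_le_nhds (s := {1}ᶜ))
      simpa [Gammaℝ_one] using this
    have hslope := hasDerivAt_iff_tendsto_slope.1 hK
    have hmain := (hP1.mul ZetaAsymptotics.tendsto_riemannZeta_sub_one_div_Gammaℝ).add
      (hslope.mul hG)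
    rw [mul_one] at hmain
    have hval : ((P * ((Real.eulerMascheroniConstant - Real.log (4 * Real.pi)) / 2) +
        (D + P * Real.log q) : ℝ) : ℂ) = (P : ℂ) * ((Real.eulerMascheroniConstant -
          Complex.log (4 * Real.pi)) / 2) + ((D + P * Real.log q : ℝ) : ℂ) := by
      have : Complex.log (4 * Real.pi) = (Real.log (4 * Real.pi) : ℂ) := by
        rw [ofReal_log (by positivity)]
        push_cast
        rfl
      rw [this]
      push_cast
      ring
    rw [hval]
    refine hmain.congr' ?_
    filter_upwards [self_mem_nhdsWithin] with s hs
    have h1 : (1 : DirichletCharacter ℂ q).LFunction s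
        = (∏ p ∈ q.primeFactors, (1 - (p : ℂ) ^ (-s))) * riemannZeta s :=
      LFunctionTrivChar_eq_mul_riemannZeta hs
    rw [h1, slope_def_field, hK1]
    simp only [K]
    ring
  rw [tendsto_nhds_unique tendsto_LFunction_one_sub hlim]
  have hlog : P * (3 / 2 * Real.log 2) ≤ D + P * Real.log q := by
    have hterm : ∀ p ∈ q.primeFactors, 0 ≤ (∏ r ∈ q.primeFactors.erase p, (1 - (r : ℝ)⁻¹)) *
        ((p : ℝ)⁻¹ * Real.log p) := fun p _ ↦
      mul_nonneg (Finset.prod_nonneg fun r hr ↦ (hfac r (Finset.mem_of_mem_erase hr)).le)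
        (mul_nonneg (by positivity) (Real.log_natCast_nonneg p))
    have hl2 : 0 < Real.log 2 := Real.log_pos one_lt_two
    by_cases h2 : 2 ∣ q
    · have hmem : 2 ∈ q.primeFactors := by simp [Nat.prime_two, h2, hq0]
      have h3 := Finset.single_le_sum hterm hmem
      have h4 := Finset.mul_prod_erase q.primeFactors (fun p : ℕ ↦ 1 - (p : ℝ)⁻¹) hmem
      rw [← hP] at h4
      have h5 : Real.log 2 ≤ Real.log q :=
        Real.log_le_log (by norm_num) (by exact_mod_cast Nat.le_of_dvd (Nat.pos_of_ne_zero hq0) h2)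
      rw [← hD] at h3
      push_cast at h3 h4
      nlinarith
    · have h3 : 3 ≤ q := by omega
      have h4 : 3 / 2 * Real.log 2 ≤ Real.log q := by
        have h5 := Real.log_le_log (x := 2 ^ 3) (y := 3 ^ 2) (by norm_num) (by norm_num)
        rw [Real.log_pow, Real.log_pow] at h5
        have h6 : Real.log 3 ≤ Real.log q := Real.log_le_log (by norm_num) (by exact_mod_cast h3)
        push_cast at h5
        linarith
      have : 0 ≤ D := Finset.sum_nonneg hterm
      nlinarith
  have hlt := mul_lt_mul_of_pos_left lt_riemannZeta_one hPpos
  rw [Ne, ofReal_eq_zero]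
  apply ne_of_gt
  linarith

end DirichletCharacter

end

namespace DirichletCharacter

lemma one_add_pow_of_mul_self_eq_zero {R : Type*} [CommRing R] {x : R} (hx : x * x = 0) (n : ℕ) :
    (1 + x) ^ n = 1 + n * x := by
  induction n with
  | zero => simp
  | succ n ih =>
    rw [pow_succ, ih]
    push_cast
    linear_combination (n : R) * hx

/-- If a primitive character is trivial on the units congruent to `1` modulo a divisor `d` of its
level, then `d` is the level. -/
lemma IsPrimitive.dvd_of_forall_apply_eq_one {q : ℕ} [NeZero q] {χ : DirichletCharacter ℂ q}
    (hχ : χ.IsPrimitive) {d : ℕ} (hd : d ∣ q)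
    (h : ∀ k : ℤ, IsUnit (1 + d * k : ZMod q) → χ (1 + d * k : ZMod q) = 1) : q ∣ d := by
  have hmem : d ∈ χ.conductorSet := by
    rw [mem_conductorSet_iff, factorsThrough_iff_ker_unitsMap hd]
    intro u hu
    obtain ⟨k, hk⟩ : ∃ k : ℤ, (u : ZMod q) = 1 + d * k := by
      rw [MonoidHom.mem_ker, ← Units.val_inj, Units.val_one, ZMod.unitsMap_def, Units.coe_map] at hu
      have h1 : ZMod.castHom hd (ZMod d) u.val = ((u.val.val : ℤ) : ZMod d) := by simp
      rw [MonoidHom.coe_coe, h1, ← Int.cast_one, eq_comm,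
        ZMod.intCast_eq_intCast_iff_dvd_sub] at hu
      obtain ⟨k, hk⟩ := hu
      refine ⟨k, ?_⟩
      have h2 : (u : ZMod q) = ((u.val.val : ℤ) : ZMod q) := by simp
      rw [h2, show ((u.val.val : ℤ)) = 1 + d * k by linarith]
      push_cast
      rfl
    rw [MonoidHom.mem_ker, ← Units.val_inj, MulChar.coe_toUnitHom, hk, Units.val_one]
    exact h k (hk ▸ u.isUnit)
  rw [← show χ.conductor = q from hχ]
  exact χ.conductor_dvd_of_mem_conductorSet hmem

/-- The conductor of a quadratic character is not divisible by the square of an odd prime. -/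
lemma IsPrimitive.not_sq_dvd_of_odd {q : ℕ} [NeZero q] {χ : DirichletCharacter ℂ q}
    (hχ : χ.IsPrimitive) (hχ2 : χ ^ 2 = 1) {p : ℕ} (hp : 1 < p) (hodd : _root_.Odd p) :
    ¬ p ^ 2 ∣ q := by
  rintro ⟨m, hm⟩
  have hq0 : q ≠ 0 := NeZero.ne q
  have hdvd : q ∣ p * m := hχ.dvd_of_forall_apply_eq_one ⟨p, by rw [hm]; ring⟩ fun k hk ↦ by
    have hq : ((p ^ 2 * m : ℕ) : ZMod q) = 0 := by rw [← hm]; simp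
    push_cast at hq
    have h1 : (1 + (p * m : ℕ) * k : ZMod q) ^ p = 1 := by
      rw [one_add_pow_of_mul_self_eq_zero]
      · push_cast
        linear_combination (k : ZMod q) * hq
      · push_cast
        linear_combination (k ^ 2 * m : ZMod q) * hq
    have h2 : χ (1 + (p * m : ℕ) * k : ZMod q) ^ p = 1 := by rw [← map_pow, h1, map_one]
    rcases MulChar.isQuadratic_iff_sq_eq_one.2 hχ2 (1 + (p * m : ℕ) * k : ZMod q) with h | h | h
    · exact absurd h (hk.map χ).ne_zero
    · exact h
    · rw [h, hodd.neg_one_pow] at h2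
      norm_num at h2
  have hpm : p * m ≠ 0 := by
    rintro h
    apply hq0
    rw [hm, pow_two, mul_assoc, h, mul_zero]
  have := Nat.le_of_dvd (Nat.pos_of_ne_zero hpm) hdvd
  have : p * m < p * (p * m) := lt_mul_of_one_lt_left (Nat.pos_of_ne_zero hpm) hp
  nlinarith

/-- The conductor of a quadratic character is not divisible by `16`. -/
lemma IsPrimitive.not_sixteen_dvd {q : ℕ} [NeZero q] {χ : DirichletCharacter ℂ q}
    (hχ : χ.IsPrimitive) (hχ2 : χ ^ 2 = 1) : ¬ 16 ∣ q := by
  rintro ⟨m, hm⟩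
  have hq0 : q ≠ 0 := NeZero.ne q
  have hdvd : q ∣ 8 * m := hχ.dvd_of_forall_apply_eq_one ⟨2, by rw [hm]; ring⟩ fun k hk ↦ by
    have hq : ((16 * m : ℕ) : ZMod q) = 0 := by rw [← hm]; simp
    push_cast at hq
    have h1 : (1 + (8 * m : ℕ) * k : ZMod q) = (1 + 4 * m * k) ^ 2 := by
      push_cast
      linear_combination (-k ^ 2 * m : ZMod q) * hq
    have h0 := (hk.map χ).ne_zero
    rw [h1, map_pow] at h0 ⊢
    rcases MulChar.isQuadratic_iff_sq_eq_one.2 hχ2 (1 + 4 * m * k : ZMod q) with h | h | h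
    · simp [h] at h0
    · rw [h, one_pow]
    · rw [h]; norm_num
  have := Nat.le_of_dvd (by omega) hdvd
  omega


/-- The conductor of a quadratic character is exponentially bounded in terms of its largest prime
factor. -/
lemma IsPrimitive.le_of_forall_prime_le {q : ℕ} [NeZero q] {χ : DirichletCharacter ℂ q}
    (hχ : χ.IsPrimitive) (hχ2 : χ ^ 2 = 1) {B : ℕ} (hB : ∀ p : ℕ, p.Prime → p ∣ q → p ≤ B) :
    q ≤ 8 * 4 ^ B := by
  have hdvd : q ∣ 8 * primorial B := by
    rw [Nat.dvd_iff_prime_pow_dvd_dvd]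
    intro p k hp hk
    rcases Nat.eq_zero_or_pos k with rfl | hk0
    · simp
    rcases hp.eq_two_or_odd' with rfl | hodd
    · have hk4 : k ≤ 3 := by
        by_contra! h
        exact hχ.not_sixteen_dvd hχ2 ((pow_dvd_pow 2 h).trans hk)
      exact ((pow_dvd_pow 2 hk4).trans (by norm_num)).mul_right _
    · have hk1 : k ≤ 1 := by
        by_contra! h
        exact hχ.not_sq_dvd_of_odd hχ2 hp.one_lt hodd ((pow_dvd_pow p h).trans hk)
      obtain rfl : k = 1 := by omega
      rw [pow_one] at hk ⊢
      refine Dvd.dvd.mul_left (Finset.dvd_prod_of_mem _ ?_) 8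
      simp [hp, hB p hp hk]
  refine (Nat.le_of_dvd (mul_pos (by norm_num) (primorial_pos B)) hdvd).trans ?_
  gcongr
  exact primorial_le_four_pow B

end DirichletCharacter

section

open Filter Topology

lemma succ_mul_pow_le_sum_sq_pow {y : ℝ} (hy : 0 ≤ y) : ∀ n : ℕ,
    (n + 1) * y ^ n ≤ ∑ i ∈ Finset.range (n + 1), (y ^ 2) ^ i
  | 0 => by simp
  | 1 => by
    simp [Finset.sum_range_succ]
    nlinarith [sq_nonneg (y - 1)]
  | n + 2 => by
    have ih := succ_mul_pow_le_sum_sq_pow hy n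
    have h1 : ∑ i ∈ Finset.range (n + 1), (y ^ 2) ^ (i + 1)
        = y ^ 2 * ∑ i ∈ Finset.range (n + 1), (y ^ 2) ^ i := by
      rw [Finset.mul_sum]
      simp only [pow_succ']
    have h2 := mul_le_mul_of_nonneg_left ih (sq_nonneg y)
    have h3 : (y ^ 2) ^ (n + 2) = (y ^ (n + 2)) ^ 2 := by ring
    have h4 : y ^ 2 * ((n + 1) * y ^ n) = (n + 1) * y ^ (n + 2) := by ring
    rw [Finset.sum_range_succ, Finset.sum_range_succ', h1, h3]
    push_cast
    nlinarith [sq_nonneg (y ^ (n + 2) - 1)]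

/-- Abel summation: a bound for sums against a nonnegative antitone weight. -/
lemma sum_mul_le_of_antitone {w a : ℕ → ℝ} {C : ℝ} (hw : Antitone w) (hw0 : ∀ n, 0 ≤ w n)
    (ha : ∀ n, ∑ i ∈ Finset.range n, a i ≤ C) (N : ℕ) :
    ∑ i ∈ Finset.range N, a i * w i ≤ C * w 0 := by
  have key : ∀ n, ∑ i ∈ Finset.range n, a i * w i - w n * ∑ i ∈ Finset.range n, a i
      ≤ C * (w 0 - w n) := by
    intro n
    induction n with
    | zero => simp
    | succ n ih =>
      have h1 := mul_le_mul_of_nonneg_left (ha (n + 1)) (sub_nonneg.2 (hw n.le_succ))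
      rw [Finset.sum_range_succ] at h1 ⊢
      rw [Finset.sum_range_succ]
      simp only [Nat.succ_eq_add_one] at h1
      nlinarith
  have h1 := key N
  have h2 := mul_le_mul_of_nonneg_left (ha N) (hw0 N)
  linarith

/-- The sequence `1 / n - (1 - x) x ^ n / (1 - x ^ n)`, shifted by one. -/
noncomputable def lambertWeight (x : ℝ) (n : ℕ) : ℝ :=
  1 / (n + 1) - x ^ (n + 1) / ∑ i ∈ Finset.range (n + 1), x ^ i

lemma one_le_sum_range_pow {x : ℝ} (hx : 0 ≤ x) (n : ℕ) :
    1 ≤ ∑ i ∈ Finset.range (n + 1), x ^ i := by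
  rw [Finset.sum_range_succ']
  have : 0 ≤ ∑ i ∈ Finset.range n, x ^ (i + 1) := Finset.sum_nonneg fun i _ ↦ by positivity
  simpa

lemma lambertWeight_zero (x : ℝ) : lambertWeight x 0 = 1 - x := by
  simp [lambertWeight]

lemma lambertWeight_nonneg {x : ℝ} (hx : 0 ≤ x) (hx1 : x ≤ 1) (n : ℕ) : 0 ≤ lambertWeight x n := by
  have hT := one_le_sum_range_pow hx n
  rw [lambertWeight, sub_nonneg, div_le_div_iff₀ (by linarith) (by positivity), one_mul, mul_comm]
  calc ((n : ℝ) + 1) * x ^ (n + 1) = ∑ i ∈ Finset.range (n + 1), x ^ (n + 1) := by simp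
    _ ≤ _ := Finset.sum_le_sum fun i hi ↦
      pow_le_pow_of_le_one hx hx1 (Finset.mem_range.1 hi).le

lemma antitone_lambertWeight {x : ℝ} (hx : 0 ≤ x) (hx1 : x ≤ 1) : Antitone (lambertWeight x) := by
  refine antitone_nat_of_succ_le fun n ↦ ?_
  obtain ⟨y, hy, rfl⟩ : ∃ y, 0 ≤ y ∧ x = y ^ 2 := ⟨√x, Real.sqrt_nonneg x, (Real.sq_sqrt hx).symm⟩
  have hy1 : y ≤ 1 := by nlinarith
  have hT := one_le_sum_range_pow hx n
  have hT' := one_le_sum_range_pow hx (n + 1)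
  have hrec : ∑ i ∈ Finset.range (n + 1 + 1), (y ^ 2) ^ i
      = y ^ 2 * ∑ i ∈ Finset.range (n + 1), (y ^ 2) ^ i + 1 := by
    rw [Finset.sum_range_succ', Finset.mul_sum]
    simp [pow_succ']
  have h1 := succ_mul_pow_le_sum_sq_pow hy n
  have h2 := succ_mul_pow_le_sum_sq_pow hy (n + 1)
  simp only [lambertWeight]
  set S := ∑ i ∈ Finset.range (n + 1), (y ^ 2) ^ i
  set S' := ∑ i ∈ Finset.range (n + 1 + 1), (y ^ 2) ^ i
  push_cast at h2 ⊢
  have h3 : (n + 1) * (n + 2) * (y ^ 2) ^ (n + 1) ≤ S * S' := by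
    calc (n + 1) * (n + 2) * (y ^ 2) ^ (n + 1)
        = ((n + 1) * y ^ n) * ((n + 1 + 1) * y ^ (n + 1)) * y := by ring
      _ ≤ ((n + 1) * y ^ n) * ((n + 1 + 1) * y ^ (n + 1)) * 1 := by gcongr
      _ ≤ S * S' := by rw [mul_one]; gcongr
  have h4 : (y ^ 2) ^ (n + 1) / S - (y ^ 2) ^ (n + 1 + 1) / S' = (y ^ 2) ^ (n + 1) / (S * S') := by
    rw [div_sub_div _ _ (by linarith) (by linarith)]
    congr 1
    rw [hrec]
    ring
  have h5 : (1 : ℝ) / (n + 1) - 1 / (n + 1 + 1) = 1 / ((n + 1) * (n + 2)) := by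
    field_simp
    ring
  have h6 : (y ^ 2) ^ (n + 1) / (S * S') ≤ 1 / ((n + 1) * (n + 2)) := by
    rw [div_le_div_iff₀ (by positivity) (by positivity)]
    linarith
  linarith

namespace DirichletCharacter
open ArithmeticFunction Complex
open scoped ComplexOrder ComplexConjugate

lemma ofReal_re_apply_of_sq_eq_one {q : ℕ} {χ : DirichletCharacter ℂ q} (hχ : χ ^ 2 = 1)
    (a : ZMod q) : ((χ a).re : ℂ) = χ a :=
  conj_eq_iff_re.1 (conj_apply_of_sq_eq_one hχ a)

lemma zetaMul_apply {q : ℕ} (χ : DirichletCharacter ℂ q) (n : ℕ) :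
    χ.zetaMul n = ∑ i ∈ n.divisors, χ i := by
  rw [zetaMul, coe_zeta_mul_apply]
  refine Finset.sum_congr rfl fun i hi ↦ ?_
  simp [toArithmeticFunction, (Nat.pos_of_mem_divisors hi).ne']

lemma one_le_zetaMul_sq {q : ℕ} {χ : DirichletCharacter ℂ q} (hχ : χ ^ 2 = 1) {m : ℕ}
    (hm : m ≠ 0) : 1 ≤ χ.zetaMul (m ^ 2) := by
  rw [χ.isMultiplicative_zetaMul.multiplicative_factorization _ (pow_ne_zero 2 hm)]
  rw [Finsupp.prod, ← Finset.prod_const_one (s := (m ^ 2).factorization.support)]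
  refine Finset.prod_le_prod (fun _ _ ↦ zero_le_one) fun p hp ↦ ?_
  have hp' : p.Prime := Nat.prime_of_mem_primeFactors (by simpa using hp)
  rw [Nat.factorization_pow]
  rw [Finsupp.smul_apply, smul_eq_mul, zetaMul_apply, Nat.sum_divisors_prime_pow hp']
  simp only [Nat.cast_pow, map_pow]
  rcases MulChar.isQuadratic_iff_sq_eq_one.mpr hχ p with h | h | h
  · rw [h, Finset.sum_range_succ']
    simp
  · simp only [h, one_pow, Finset.sum_const, Finset.card_range, nsmul_eq_mul, mul_one]
    exact_mod_cast Nat.le_add_left 1 _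
  · rw [h, neg_one_geom_sum, if_neg]
    simp [parity_simps]

lemma ofReal_sum_divisorsAntidiagonal {q : ℕ} {χ : DirichletCharacter ℂ q} (hχ : χ ^ 2 = 1)
    (n : ℕ) : ((∑ c ∈ n.divisorsAntidiagonal, (χ c.1).re : ℝ) : ℂ) = χ.zetaMul n := by
  have h := Nat.sum_divisorsAntidiagonal (n := n) fun i _ ↦ (χ i).re
  rw [zetaMul_apply, h]
  push_cast
  exact Finset.sum_congr rfl fun i _ ↦ ofReal_re_apply_of_sq_eq_one hχ i

lemma sum_pow_sq_le_tsum {q : ℕ} {χ : DirichletCharacter ℂ q} (hχ : χ ^ 2 = 1) {x : ℝ}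
    (hx : 0 ≤ x) (hx1 : x < 1) (M : ℕ) :
    ∑ m ∈ Finset.range M, x ^ ((m + 1) ^ 2)
      ≤ ∑' n : ℕ, (χ (n + 1 : ℕ)).re * (x ^ (n + 1) / (1 - x ^ (n + 1))) := by
  have hxn : ‖x‖ < 1 := by rwa [Real.norm_of_nonneg hx]
  let F : ℕ+ × ℕ+ → ℝ := fun c ↦ (χ (c.1 : ℕ)).re * x ^ (c.1 * c.2 : ℕ)
  have hF : Summable F := by
    refine Summable.of_norm_bounded (summable_prod_mul_pow 0 hxn) fun c ↦ ?_
    simp only [F, norm_mul, pow_zero, one_mul]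
    rw [Real.norm_of_nonneg (pow_nonneg hx _)]
    exact mul_le_of_le_one_left (pow_nonneg hx _)
      ((abs_re_le_norm _).trans (χ.norm_le_one _))
  have h1 : ∑' c, F c = ∑' n : ℕ, (χ (n + 1 : ℕ)).re * (x ^ (n + 1) / (1 - x ^ (n + 1))) := by
    rw [hF.tsum_prod,
      ← tsum_pnat_eq_tsum_succ (f := fun n : ℕ ↦ (χ (n : ℕ)).re * (x ^ n / (1 - x ^ n)))]
    refine tsum_congr fun n ↦ ?_
    simp only [F]
    rw [tsum_mul_left, tsum_pnat_eq_tsum_succ (f := fun k : ℕ ↦ x ^ (n * k : ℕ))]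
    congr 1
    have h2 : x ^ (n : ℕ) < 1 := pow_lt_one₀ hx hx1 n.ne_zero
    simp only [pow_mul, pow_succ']
    rw [tsum_mul_left, tsum_geometric_of_lt_one (pow_nonneg hx _) h2, div_eq_mul_inv]
  have hF' := (sigmaAntidiagonalEquivProd.summable_iff (f := F)).2 hF
  have h3 : ∀ n : ℕ+, ∑' c : Nat.divisorsAntidiagonal n, (F ∘ sigmaAntidiagonalEquivProd) ⟨n, c⟩
      = (∑ c ∈ (n : ℕ).divisorsAntidiagonal, (χ c.1).re) * x ^ (n : ℕ) := by
    intro n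
    rw [tsum_fintype, Finset.sum_mul, ← Finset.sum_coe_sort (n : ℕ).divisorsAntidiagonal]
    refine Finset.sum_congr rfl fun c _ ↦ ?_
    simp only [F, Function.comp_apply, sigmaAntidiagonalEquivProd, divisorsAntidiagonalFactors,
      Equiv.coe_fn_mk, PNat.mk_coe]
    rw [(Nat.mem_divisorsAntidiagonal.1 c.2).1]
  have hsum := hF'.sigma
  have h4 : ∑' c, F c
      = ∑' n : ℕ+, (∑ c ∈ (n : ℕ).divisorsAntidiagonal, (χ c.1).re) * x ^ (n : ℕ) := by
    rw [← sigmaAntidiagonalEquivProd.tsum_eq, ← tsum_congr h3]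
    exact hF'.tsum_sigma
  rw [← h1, h4]
  simp only [h3] at hsum
  have hr : ∀ n : ℕ, 0 ≤ ∑ c ∈ n.divisorsAntidiagonal, (χ c.1).re := fun n ↦ by
    have := zetaMul_nonneg hχ n
    rw [← ofReal_sum_divisorsAntidiagonal hχ] at this
    exact_mod_cast this
  have hr1 : ∀ m : ℕ, m ≠ 0 → 1 ≤ ∑ c ∈ (m ^ 2).divisorsAntidiagonal, (χ c.1).re := fun m hm ↦ by
    have := one_le_zetaMul_sq hχ hm
    rw [← ofReal_sum_divisorsAntidiagonal hχ] at this
    exact_mod_cast this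
  have h5 := hsum.sum_le_tsum ((Finset.range M).image fun m : ℕ ↦ m.succPNat ^ 2)
    fun n _ ↦ mul_nonneg (hr n) (pow_nonneg hx _)
  refine le_trans ?_ h5
  rw [Finset.sum_image]
  · refine Finset.sum_le_sum fun m _ ↦ ?_
    simp only [PNat.pow_coe, Nat.succPNat_coe, Nat.succ_eq_add_one]
    exact le_mul_of_one_le_left (pow_nonneg hx _) (hr1 _ m.succ_ne_zero)
  · intro a _ b _ hab
    have h6 := congrArg PNat.val hab
    have h7 : (a + 1) ^ 2 = (b + 1) ^ 2 := by simpa using h6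
    exact Nat.succ_injective (Nat.pow_left_injective two_ne_zero h7)

end DirichletCharacter

end

section

open Filter Topology

namespace DirichletCharacter

lemma sum_range_neg_re_le {q : ℕ} [NeZero q] {χ : DirichletCharacter ℂ q} (hχ : χ ≠ 1) (N : ℕ) :
    ∑ n ∈ Finset.range N, -(χ (n + 1 : ℕ)).re ≤ 2 * q := by
  have h := χ.norm_sumError_le (x := N) (Nat.cast_nonneg N)
  rw [sumError, meanValue_of_ne_one hχ, zero_mul, sub_zero, Nat.floor_natCast] at h
  have h1 : ∑ k ∈ Finset.Icc 1 N, χ k = ∑ n ∈ Finset.range N, χ (n + 1 : ℕ) := by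
    rw [Finset.range_eq_Ico, Finset.sum_Ico_add' (fun k : ℕ ↦ χ k)]
    rfl
  rw [h1] at h
  have h2 := (abs_le.1 ((Complex.abs_re_le_norm _).trans h)).1
  rw [Complex.re_sum] at h2
  rw [Finset.sum_neg_distrib]
  linarith

lemma hasSum_re_LFunction {q : ℕ} [NeZero q] (χ : DirichletCharacter ℂ q) {s : ℝ} (hs : 1 < s) :
    HasSum (fun n : ℕ ↦ (χ (n + 1 : ℕ)).re * ((n : ℝ) + 1) ^ (-s)) (χ.LFunction s).re := by
  have hs' : 1 < (s : ℂ).re := by simpa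
  have h1 : HasSum (LSeries.term (χ ·) s) (χ.LFunction s) := by
    rw [LFunction_eq_LSeries χ hs']
    exact (LSeriesSummable_of_one_lt_re χ hs').LSeriesHasSum
  rw [← hasSum_nat_add_iff' 1] at h1
  simp only [Finset.range_one, Finset.sum_singleton, LSeries.term_zero, sub_zero] at h1
  convert Complex.hasSum_re h1 using 2 with n
  rw [LSeries.term_of_ne_zero (Nat.succ_ne_zero n)]
  have : ((n + 1 : ℕ) : ℂ) ^ (s : ℂ) = (((n : ℝ) + 1) ^ s : ℝ) := by
    rw [Complex.ofReal_cpow (by positivity)]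
    push_cast
    rfl
  rw [this, Complex.div_ofReal_re, Real.rpow_neg (by positivity), div_eq_mul_inv]

lemma abs_re_apply_le_one {q : ℕ} (χ : DirichletCharacter ℂ q) (a : ZMod q) : |(χ a).re| ≤ 1 :=
  (Complex.abs_re_le_norm _).trans (χ.norm_le_one a)

lemma norm_lambert_term_le {q : ℕ} (χ : DirichletCharacter ℂ q) {x : ℝ} (hx : 0 ≤ x)
    (hx1 : x < 1) {s : ℝ} (hs : 1 < s) (n : ℕ) :
    ‖(χ (n + 1 : ℕ)).re * ((n : ℝ) + 1) ^ (1 - s) *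
      (x ^ (n + 1) / ∑ i ∈ Finset.range (n + 1), x ^ i)‖ ≤ x ^ n := by
  have hT := one_le_sum_range_pow hx n
  have h1 : ((n : ℝ) + 1) ^ (1 - s) ≤ 1 :=
    Real.rpow_le_one_of_one_le_of_nonpos (by linarith [n.cast_nonneg (α := ℝ)]) (by linarith)
  have h2 : x ^ (n + 1) ≤ x ^ n := pow_le_pow_of_le_one hx hx1.le n.le_succ
  rw [norm_mul, norm_mul, Real.norm_eq_abs, Real.norm_of_nonneg (by positivity),
    Real.norm_of_nonneg (by positivity)]
  calc _ ≤ 1 * 1 * (x ^ n / 1) :=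
        mul_le_mul (mul_le_mul (abs_re_apply_le_one χ _) h1 (by positivity) zero_le_one)
          (div_le_div₀ (by positivity) h2 one_pos hT) (by positivity) (by norm_num)
    _ = x ^ n := by ring

lemma tsum_sub_re_LFunction_le_of_one_lt {q : ℕ} [NeZero q] {χ : DirichletCharacter ℂ q}
    (hχ : χ ≠ 1) {x : ℝ} (hx : 0 ≤ x) (hx1 : x < 1) {s : ℝ} (hs : 1 < s) :
    ∑' n : ℕ, (χ (n + 1 : ℕ)).re * ((n : ℝ) + 1) ^ (1 - s) *
      (x ^ (n + 1) / ∑ i ∈ Finset.range (n + 1), x ^ i) - (χ.LFunction s).re ≤ 2 * q * (1 - x) := by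
  have hsum : Summable fun n : ℕ ↦ (χ (n + 1 : ℕ)).re * ((n : ℝ) + 1) ^ (1 - s) *
      (x ^ (n + 1) / ∑ i ∈ Finset.range (n + 1), x ^ i) :=
    Summable.of_norm_bounded (summable_geometric_of_lt_one hx hx1)
      (norm_lambert_term_le χ hx hx1 hs)
  have hS := hsum.hasSum.sub (hasSum_re_LFunction χ hs)
  refine le_of_tendsto' hS.tendsto_sum_nat fun N ↦ ?_
  have hw : Antitone fun n : ℕ ↦ ((n : ℝ) + 1) ^ (1 - s) * lambertWeight x n := by
    intro m n h
    exact mul_le_mul (Real.rpow_le_rpow_of_nonpos (by positivity) (by gcongr) (by linarith))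
      (antitone_lambertWeight hx hx1.le h) (lambertWeight_nonneg hx hx1.le n) (by positivity)
  have := sum_mul_le_of_antitone hw
    (fun n ↦ mul_nonneg (by positivity) (lambertWeight_nonneg hx hx1.le n))
    (sum_range_neg_re_le hχ) N
  simp only [lambertWeight_zero, Nat.cast_zero, zero_add, Real.one_rpow, one_mul] at this
  refine le_of_eq_of_le (Finset.sum_congr rfl fun n _ ↦ ?_) this
  have hn : (0 : ℝ) < n + 1 := by positivity
  rw [lambertWeight, sub_eq_add_neg 1 s, Real.rpow_add hn, Real.rpow_one]
  field_simp
  ring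

lemma tsum_sub_re_LFunction_one_le {q : ℕ} [NeZero q] {χ : DirichletCharacter ℂ q} (hχ : χ ≠ 1)
    {x : ℝ} (hx : 0 ≤ x) (hx1 : x < 1) :
    ∑' n : ℕ, (χ (n + 1 : ℕ)).re * (x ^ (n + 1) / ∑ i ∈ Finset.range (n + 1), x ^ i)
      - (χ.LFunction 1).re ≤ 2 * q * (1 - x) := by
  refine le_of_tendsto (f := fun s : ℝ ↦ ∑' n : ℕ, (χ (n + 1 : ℕ)).re * ((n : ℝ) + 1) ^ (1 - s) *
    (x ^ (n + 1) / ∑ i ∈ Finset.range (n + 1), x ^ i) - (χ.LFunction s).re)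
    (x := 𝓝[>] 1) ?_ (eventually_mem_nhdsWithin.mono fun s hs ↦
      tsum_sub_re_LFunction_le_of_one_lt hχ hx hx1 hs)
  refine Tendsto.sub ?_ ?_
  · refine tendsto_tsum_of_dominated_convergence (summable_geometric_of_lt_one hx hx1)
      (fun n ↦ ?_) (eventually_mem_nhdsWithin.mono fun s hs n ↦ ?_)
    · have : Continuous fun s : ℝ ↦ (χ (n + 1 : ℕ)).re * ((n : ℝ) + 1) ^ (1 - s) *
          (x ^ (n + 1) / ∑ i ∈ Finset.range (n + 1), x ^ i) := by
        have hn : (n : ℝ) + 1 ≠ 0 := by positivity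
        exact (continuous_const.mul (continuous_const.rpow (by fun_prop)
          fun _ ↦ Or.inl hn)).mul continuous_const
      simpa using (this.tendsto 1).mono_left nhdsWithin_le_nhds
    · exact norm_lambert_term_le χ hx hx1 hs n
  · have : Continuous fun s : ℝ ↦ (χ.LFunction s).re :=
      Complex.continuous_re.comp
        ((differentiable_LFunction hχ).continuous.comp Complex.continuous_ofReal)
    simpa using (this.tendsto 1).mono_left nhdsWithin_le_nhds

/-- An effective lower bound for `L(1, χ)`, where `χ` is a quadratic character. -/
lemma one_div_le_re_LFunction_one {q : ℕ} [NeZero q] {χ : DirichletCharacter ℂ q} (hχ : χ ≠ 1)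
    (hχ2 : χ ^ 2 = 1) : 1 / (64 * q) ≤ (χ.LFunction 1).re := by
  have hq : (1 : ℝ) ≤ q := by exact_mod_cast NeZero.one_le
  set x : ℝ := 1 - 1 / (2 * (8 * q) ^ 2) with hxdef
  have hpos : (0 : ℝ) < 1 / (2 * (8 * q) ^ 2) := by positivity
  have hle : 1 / (2 * (8 * (q : ℝ)) ^ 2) ≤ 1 := by
    rw [div_le_one (by positivity)]
    nlinarith
  have hx : 0 ≤ x := by linarith
  have hx1 : x < 1 := by linarith
  have h1 := tsum_sub_re_LFunction_one_le hχ hx hx1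
  have h2 := sum_pow_sq_le_tsum hχ2 hx hx1 (8 * q)
  have h3 : ∑' n : ℕ, (χ (n + 1 : ℕ)).re * (x ^ (n + 1) / ∑ i ∈ Finset.range (n + 1), x ^ i)
      = (1 - x) * ∑' n : ℕ, (χ (n + 1 : ℕ)).re * (x ^ (n + 1) / (1 - x ^ (n + 1))) := by
    rw [← tsum_mul_left]
    refine tsum_congr fun n ↦ ?_
    have hn : x ^ (n + 1) < 1 := pow_lt_one₀ hx hx1 n.succ_ne_zero
    have h : 1 - x ^ (n + 1) ≠ 0 := by linarith
    have h' : 1 - x ≠ 0 := by linarith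
    rw [← mul_neg_geom_sum x (n + 1)] at h ⊢
    have := right_ne_zero_of_mul h
    field_simp
  have h4 : 4 * (q : ℝ) ≤ ∑ m ∈ Finset.range (8 * q), x ^ ((m + 1) ^ 2) := by
    have h5 : (1 / 2 : ℝ) ≤ x ^ ((8 * q) ^ 2) := by
      have := one_add_mul_le_pow (a := -(1 / (2 * (8 * (q : ℝ)) ^ 2))) (by linarith) ((8 * q) ^ 2)
      rw [← sub_eq_add_neg 1] at this
      refine le_trans (le_of_eq ?_) this
      push_cast
      field_simp
      norm_num
    calc 4 * (q : ℝ) = ∑ m ∈ Finset.range (8 * q), (1 / 2 : ℝ) := by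
          simp
          ring
      _ ≤ _ := by
          refine Finset.sum_le_sum fun m hm ↦ h5.trans ?_
          refine pow_le_pow_of_le_one hx hx1.le (Nat.pow_le_pow_left ?_ 2)
          exact Finset.mem_range.1 hm
  rw [h3] at h1
  have h5 : (1 - x) * (4 * q) ≤ (1 - x) * ∑' n : ℕ, (χ (n + 1 : ℕ)).re *
      (x ^ (n + 1) / (1 - x ^ (n + 1))) :=
    mul_le_mul_of_nonneg_left (h4.trans h2) (by linarith)
  have h6 : 1 / (64 * (q : ℝ)) = (1 - x) * (2 * q) := by
    rw [hxdef]
    field_simp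
    norm_num
  linarith

/-- A real zero of the `L`-function of a quadratic character is not too close to `1`. -/
lemma one_div_le_one_sub_of_LFunction_eq_zero {q : ℕ} [NeZero q] {χ : DirichletCharacter ℂ q}
    (hχ : χ ≠ 1) (hχ2 : χ ^ 2 = 1) {β : ℝ} (hβ : χ.LFunction β = 0) (hβ1 : β ≤ 1) :
    1 / (1536 * q ^ 2) ≤ 1 - β := by
  have hq : (1 : ℝ) ≤ q := by exact_mod_cast NeZero.one_le
  by_cases hβ2 : 1 - β < 1 / 2
  swap
  · refine le_trans ?_ (not_lt.1 hβ2)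
    rw [div_le_div_iff₀ (by positivity) (by positivity)]
    nlinarith
  have hbound : ∀ z ∈ Metric.ball (1 : ℂ) (1 / 2), ‖χ.LFunction z‖ ≤ 6 * q := by
    intro z hz
    rw [Metric.mem_ball, Complex.dist_eq] at hz
    have h1 : 1 / 2 < z.re := by
      have := (abs_le.1 ((Complex.abs_re_le_norm (z - 1)).trans hz.le)).1
      have h2 := (abs_lt.1 ((Complex.abs_re_le_norm (z - 1)).trans_lt hz)).1
      simp at h2
      linarith
    have h2 : ‖z‖ ≤ 3 / 2 := by
      have := norm_add_le (z - 1) 1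
      simp at this
      linarith
    calc _ ≤ ‖z‖ * ((2 * q - 1) / z.re) := norm_LFunction_le hχ (by linarith)
      _ ≤ 3 / 2 * ((2 * q) / (1 / 2)) := by
          have h3 : (2 * (q : ℝ) - 1) / z.re ≤ 2 * q / (1 / 2) :=
            div_le_div₀ (by positivity) (by linarith) (by norm_num) h1.le
          have h4 : 0 ≤ (2 * (q : ℝ) - 1) / z.re := div_nonneg (by linarith) (by linarith)
          exact mul_le_mul h2 h3 h4 (by norm_num)
      _ = 6 * q := by ring
  have hmaps : Set.MapsTo χ.LFunction (Metric.ball 1 (1 / 2))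
      (Metric.closedBall (χ.LFunction 1) (12 * q)) := by
    intro z hz
    rw [Metric.mem_closedBall, Complex.dist_eq]
    have := norm_sub_le (χ.LFunction z) (χ.LFunction 1)
    linarith [hbound z hz, hbound 1 (Metric.mem_ball_self (by norm_num))]
  have hdist : dist (β : ℂ) 1 = 1 - β := by
    rw [Complex.dist_eq, ← Complex.ofReal_one, ← Complex.ofReal_sub, Complex.norm_real,
      Real.norm_eq_abs, abs_sub_comm, abs_of_nonneg (by linarith)]
  have h1 := Complex.dist_le_div_mul_dist_of_mapsTo_ball
    (differentiable_LFunction hχ).differentiableOn hmaps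
    (z := (β : ℂ)) (by rw [Metric.mem_ball, hdist]; exact hβ2)
  rw [hβ, dist_zero_left, hdist] at h1
  have h2 := (one_div_le_re_LFunction_one hχ hχ2).trans ((Complex.re_le_norm _).trans h1)
  rw [div_le_iff₀ (by positivity)] at h2 ⊢
  nlinarith

end DirichletCharacter

end

namespace DirichletCharacter

/-- The conductor of a quadratic character whose `L`-function has a real zero close to `1` has a
large prime factor. -/
lemma exists_prime_dvd_conductor {q : ℕ} [NeZero q] {χ : DirichletCharacter ℂ q} (hχ : χ ≠ 1)
    (hχ2 : χ ^ 2 = 1) {β : ℝ} (hβ : χ.LFunction β = 0) (hβ0 : 0 < β) (hβ1 : β ≤ 1) :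
    ∃ p : ℕ, p.Prime ∧ p ∣ χ.conductor ∧ 1 / (1536 * (8 * 4 ^ p) ^ 2) ≤ 1 - β := by
  have : NeZero χ.conductor := ⟨conductor_ne_zero χ⟩
  have hdvd := conductor_dvd_level χ
  have hχ' : changeLevel hdvd χ.primitiveCharacter = χ := changeLevel_primitiveCharacter χ
  have h1 : χ.primitiveCharacter ≠ 1 := fun h ↦ hχ (by rw [← hχ', h, changeLevel_one])
  have h2 : χ.primitiveCharacter ^ 2 = 1 := by
    apply changeLevel_injective hdvd
    rw [map_pow, hχ', hχ2, map_one]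
  have h3 : χ.primitiveCharacter.LFunction β = 0 := by
    rwa [← LFunction_changeLevel_eq_zero_iff hdvd _ (Or.inl h1) (by simpa using hβ0), hχ']
  have h4 : χ.conductor ≠ 1 := fun h ↦ hχ (eq_one_iff_conductor_eq_one.2 h)
  obtain ⟨p, hp, hmax⟩ := Finset.exists_max_image χ.conductor.primeFactors id
    ⟨_, Nat.mem_primeFactors.2
      ⟨Nat.minFac_prime h4, Nat.minFac_dvd _, conductor_ne_zero χ⟩⟩
  have h5 : χ.conductor ≤ 8 * 4 ^ p :=
    χ.primitiveCharacter_isPrimitive.le_of_forall_prime_le h2 fun r hr hrq ↦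
      hmax r (Nat.mem_primeFactors.2 ⟨hr, hrq, conductor_ne_zero χ⟩)
  refine ⟨p, Nat.prime_of_mem_primeFactors hp, Nat.dvd_of_mem_primeFactors hp,
    le_trans ?_ (one_div_le_one_sub_of_LFunction_eq_zero h1 h2 h3 hβ1)⟩
  have h6 : (χ.conductor : ℝ) ≤ 8 * 4 ^ p := by exact_mod_cast h5
  have h7 : (0 : ℝ) < χ.conductor := by exact_mod_cast Nat.pos_of_neZero _
  gcongr

lemma log_log_le_of_one_div_le {Q δ : ℝ} (hQ : 1 < Q) {p : ℕ} (hp : 2 ≤ p)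
    (h : 1 / (1536 * (8 * 4 ^ p) ^ 2) ≤ δ) (hδ : δ ≤ 1 / 1536 / Real.log Q) :
    Real.log (Real.log Q) ≤ 7 * p := by
  have hlog := Real.log_pos hQ
  have h1 : Real.log Q ≤ (8 * 4 ^ p) ^ 2 := by
    have h2 := h.trans hδ
    rw [div_div, div_le_div_iff₀ (by positivity) (by positivity)] at h2
    linarith
  have h2 : ((8 : ℝ) * 4 ^ p) ^ 2 = 2 ^ (6 + 4 * p) := by
    rw [pow_add, pow_mul, mul_pow, ← pow_mul, mul_comm p 2, pow_mul]
    norm_num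
  have h3 : ((6 + 4 * p : ℕ) : ℝ) ≤ 7 * p := by
    exact_mod_cast (by omega : 6 + 4 * p ≤ 7 * p)
  calc Real.log (Real.log Q) ≤ Real.log (2 ^ (6 + 4 * p)) := Real.log_le_log hlog (h2 ▸ h1)
    _ = (6 + 4 * p : ℕ) * Real.log 2 := Real.log_pow _ _
    _ ≤ (7 * p) * 1 := by
      gcongr
      linarith [Real.log_two_lt_d9]
    _ = 7 * p := mul_one _

/-- Zeros close to the line `Re s = 1` are real and belong to quadratic characters. -/
lemma quadratic_of_LFunction_eq_zero {q : ℕ} [NeZero q] {χ : DirichletCharacter ℂ q} {Q σ t : ℝ}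
    (hQ : 100 ≤ Q) (hq : (q : ℝ) ≤ Q) (h : χ.LFunction (σ + t * Complex.I) = 0)
    (hσ : 1 - σ < 1 / 10 ^ 10 / Real.log (Q * (1 + |t|))) :
    χ ≠ 1 ∧ χ ^ 2 = 1 ∧ t = 0 ∧ σ < 1 := by
  have ht := abs_nonneg t
  have hq1 : (1 : ℝ) ≤ q := by exact_mod_cast Nat.pos_of_neZero q
  have hQt : 100 ≤ Q * (1 + |t|) := by nlinarith
  have hlog : 0 < Real.log (Q * (1 + |t|)) := Real.log_pos (by linarith)
  have hle : Real.log (q * (2 * |t| + 2)) ≤ 2 * Real.log (Q * (1 + |t|)) := by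
    rw [← Nat.cast_ofNat, ← Real.log_pow]
    refine Real.log_le_log (by positivity) ?_
    calc (q : ℝ) * (2 * |t| + 2) ≤ Q * (2 * |t| + 2) := by gcongr
      _ ≤ (Q * (1 + |t|)) ^ 2 := by nlinarith
  refine quadratic_and_im_eq_zero_of_LFunction_eq_zero
    (η := 1 / 10 ^ 8 / Real.log (Q * (1 + |t|))) (by positivity) ?_ ?_ h ?_
  · rw [div_mul_eq_mul_div, div_le_iff₀ hlog]
    linarith
  · intro h1
    rw [h1] at h
    by_cases hχ : χ = 1
    · subst hχ
      exact LFunction_one_apply_one_ne_zero h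
    · exact LFunction_apply_one_ne_zero hχ h
  · refine hσ.le.trans (le_of_eq ?_)
    field_simp
    norm_num

lemma conductor_eq_of_one_sub_lt {q r : ℕ} [NeZero q] [NeZero r]
    {χ : DirichletCharacter ℂ q} {ψ : DirichletCharacter ℂ r} (hχ1 : χ ≠ 1) (hχ : χ ^ 2 = 1)
    (hψ1 : ψ ≠ 1) (hψ : ψ ^ 2 = 1) {Q β γ : ℝ} (hQ : 100 ≤ Q) (hq : (q : ℝ) ≤ Q)
    (hr : (r : ℝ) ≤ Q) (hβ : χ.LFunction β = 0) (hγ : ψ.LFunction γ = 0) (hβ1 : β < 1)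
    (hγ1 : γ < 1) (hβQ : 1 - β < 1 / 10 ^ 10 / Real.log Q)
    (hγQ : 1 - γ < 1 / 10 ^ 10 / Real.log Q) : χ.conductor = ψ.conductor := by
  have hlog : 0 < Real.log Q := Real.log_pos (by linarith)
  have hq1 : (1 : ℝ) ≤ q := by exact_mod_cast Nat.pos_of_neZero q
  have hr1 : (1 : ℝ) ≤ r := by exact_mod_cast Nat.pos_of_neZero r
  have hle : Real.log (q * r * 2) ≤ 3 * Real.log Q := by
    rw [show 3 * Real.log Q = Real.log (Q ^ 3) by simp [Real.log_pow]]
    refine Real.log_le_log (by positivity) ?_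
    calc (q : ℝ) * r * 2 ≤ Q * Q * Q := by
          gcongr
          linarith
      _ = Q ^ 3 := by ring
  have heq : 1 / 10 ^ 10 / Real.log Q = 1 / 10 ^ 8 / Real.log Q / 100 := by
    field_simp
    norm_num
  refine conductor_eq_of_LFunction_eq_zero hχ1 hχ hψ1 hψ (η := 1 / 10 ^ 8 / Real.log Q)
    (by positivity) ?_ hβ hγ hβ1 hγ1 (heq ▸ hβQ.le) (heq ▸ hγQ.le)
  rw [div_mul_eq_mul_div, div_le_iff₀ hlog]
  linarith

end DirichletCharacter

/-- Landau–Page type zero-free region: there is an absolute constant `c > 0` such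
that for every `Q ≥ 100` there is `B*`, either `1` or a prime with
`B* ≥ c·log log Q`, such that for all moduli `q ≤ Q` coprime to `B*`, all Dirichlet
characters `χ mod q`, and all zeros `σ + it` of `L(·, χ)`, one has
`1 - σ ≥ c/log(Q·(1 + |t|))`. -/
theorem landau_page_zero_free_region :
    ∃ c : ℝ, 0 < c ∧ ∀ Q : ℝ, 100 ≤ Q →
      ∃ B : ℕ, 0 < B ∧ (B = 1 ∨ (B.Prime ∧ c * Real.log (Real.log Q) ≤ (B : ℝ))) ∧
        ∀ q : ℕ, ∀ hq : q ≠ 0, (q : ℝ) ≤ Q → Nat.Coprime q B →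
        ∀ χ : DirichletCharacter ℂ q, ∀ σ t : ℝ,
          @DirichletCharacter.LFunction q ⟨hq⟩ χ ((σ : ℂ) + (t : ℂ) * Complex.I) = 0 →
          c / Real.log (Q * (1 + |t|)) ≤ 1 - σ := by
  refine ⟨1 / 10 ^ 10, by norm_num, fun Q hQ ↦ ?_⟩
  have hlog : 1 ≤ Real.log Q := by
    rw [Real.le_log_iff_exp_le (by linarith)]
    linarith [Real.exp_one_lt_d9]
  by_cases hex : ∃ (r : ℕ) (_ : NeZero r) (ψ : DirichletCharacter ℂ r) (γ : ℝ),
      (r : ℝ) ≤ Q ∧ ψ ≠ 1 ∧ ψ ^ 2 = 1 ∧ ψ.LFunction γ = 0 ∧ γ < 1 ∧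
        1 - γ < 1 / 10 ^ 10 / Real.log Q
  · obtain ⟨r, _, ψ, γ, hr, hψ1, hψ, hγ, hγ1, hγQ⟩ := hex
    have hγ0 : 0 < γ := by
      have : 1 / 10 ^ 10 / Real.log Q ≤ 1 / 10 ^ 10 := div_le_self (by norm_num) hlog
      norm_num at this hγQ ⊢
      linarith
    obtain ⟨p, hp, hpdvd, hple⟩ :=
      DirichletCharacter.exists_prime_dvd_conductor hψ1 hψ hγ hγ0 hγ1.le
    have hll : Real.log (Real.log Q) ≤ 7 * p := by
      refine DirichletCharacter.log_log_le_of_one_div_le (by linarith) hp.two_le hple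
        (hγQ.le.trans ?_)
      gcongr
      norm_num
    have hll0 : 0 ≤ Real.log (Real.log Q) := Real.log_nonneg hlog
    refine ⟨p, hp.pos, Or.inr ⟨hp, by linarith⟩, fun q hq hqQ hcop χ σ t h ↦ ?_⟩
    have : NeZero q := ⟨hq⟩
    by_contra! hσ
    obtain ⟨hχ1, hχ, rfl, hσ1⟩ := DirichletCharacter.quadratic_of_LFunction_eq_zero hQ hqQ h hσ
    simp only [Complex.ofReal_zero, zero_mul, add_zero, abs_zero, mul_one] at h hσ
    have hcond := DirichletCharacter.conductor_eq_of_one_sub_lt hχ1 hχ hψ1 hψ hQ hqQ hr h hγ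
      hσ1 hγ1 hσ hγQ
    have hpq : p ∣ q := (hcond ▸ hpdvd).trans (DirichletCharacter.conductor_dvd_level χ)
    exact hp.one_lt.ne' (Nat.eq_one_of_dvd_coprimes hcop hpq dvd_rfl)
  · refine ⟨1, one_pos, Or.inl rfl, fun q hq hqQ _ χ σ t h ↦ ?_⟩
    have : NeZero q := ⟨hq⟩
    by_contra! hσ
    obtain ⟨hχ1, hχ, rfl, hσ1⟩ := DirichletCharacter.quadratic_of_LFunction_eq_zero hQ hqQ h hσ
    simp only [Complex.ofReal_zero, zero_mul, add_zero, abs_zero, mul_one] at h hσ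
    exact hex ⟨q, this, χ, σ, hqQ, hχ1, hχ, h, hσ1, hσ⟩
end
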